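/- arXiv:math/0505105 — 3 statements merged into one kernel-verified Lean document; each statement's English description precedes it below -/
import Mathlib

section
/- There exists C > 0 such that ∫₀^∞ (S_◁ f)^p(x) u(x) dx ≤ C ∫₀^∞ f^p(x) u(x) dx for every nonnegative measurable f on (0,∞) that is decreasing on each interval (n, n+1), n = 0,1,2,…, and satisfies f(x) ≥ f(x+1) for all x > 0, if and only if there exists C > 0 such that for every decreasing sequence (a_n)_{n≥0} ⊆ [0,1], ∑_{n=0}^∞ ∫_{a_n}^1 (a_n/t)^p u(n+t) dt ≤ C ∑_{n=0}^∞ ∫_0^{a_n} u(n+t) dt. -/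
open MeasureTheory Set
open scoped ENNReal NNReal

/-- The Hardy-type operator with variable end-points,
`S_◁ f(x) = (1/(x-[x])) ∫_{[x]}^x f(t) dt`. -/
noncomputable def Sblack (f : ℝ → ℝ≥0) (x : ℝ) : ℝ≥0∞ :=
  (∫⁻ t in Set.Ioc (⌊x⌋ : ℝ) x, (f t : ℝ≥0∞)) / ENNReal.ofReal (x - ⌊x⌋)


/-- Truncated dilation of a sequence by a factor `2 ^ j`. -/
noncomputable def dyadicDilate (j : ℕ) (a : ℕ → ℝ) (n : ℕ) : ℝ := min 1 (2 ^ j * a n)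

lemma dyadicDilate_mem_Icc {a : ℕ → ℝ} (ha : ∀ n, a n ∈ Icc (0 : ℝ) 1) (j n : ℕ) :
    dyadicDilate j a n ∈ Icc (0 : ℝ) 1 :=
  ⟨le_min zero_le_one (mul_nonneg (by positivity) (ha n).1), min_le_left _ _⟩

lemma Antitone.dyadicDilate {a : ℕ → ℝ} (ha : Antitone a) (j : ℕ) :
    Antitone (dyadicDilate j a) := fun _ _ h =>
  min_le_min le_rfl (mul_le_mul_of_nonneg_left (ha h) (by positivity))

lemma dyadicDilate_dyadicDilate (i j : ℕ) (a : ℕ → ℝ) :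
    dyadicDilate i (dyadicDilate j a) = dyadicDilate (i + j) a := by
  funext n
  have h1 : (1 : ℝ) ≤ 2 ^ i := one_le_pow₀ (by norm_num)
  simp only [_root_.dyadicDilate]
  rw [mul_min_of_nonneg _ _ (by positivity), ← min_assoc, mul_one, min_eq_left h1, pow_add,
    mul_assoc]

lemma dyadicDilate_zero {a : ℕ → ℝ} (ha : ∀ n, a n ∈ Icc (0 : ℝ) 1) : dyadicDilate 0 a = a := by
  funext n
  simp [dyadicDilate, (ha n).2]

/-- The averaging operator applied to the indicator of `⋃ n, (n, n + a n)`, in the coordinates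
`(n, t)` for the point `n + t`. -/
noncomputable def cutoff (a : ℕ → ℝ) (z : ℕ × ℝ) : ℝ≥0∞ := ENNReal.ofReal (min 1 (a z.1 / z.2))

lemma measurable_cutoff (a : ℕ → ℝ) : Measurable (cutoff a) := by
  have h : Measurable fun z : ℕ × ℝ => a z.1 := (measurable_of_countable a).comp measurable_fst
  exact (measurable_const.min (h.div measurable_snd)).ennreal_ofReal

lemma measurableSet_snd_le (a : ℕ → ℝ) : MeasurableSet {z : ℕ × ℝ | z.2 ≤ a z.1} :=
  measurableSet_le measurable_snd ((measurable_of_countable a).comp measurable_fst)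

lemma sum_geometric_indicator_le {p : ℝ} (hp : 0 < p) (m : ℕ) {y : ℝ} (hy : 0 ≤ y) :
    ∑ j ∈ Finset.range m, (if 1 ≤ (2 : ℝ) ^ j * y then ((2 : ℝ) ^ (-p)) ^ j else 0) ≤
      (1 - (2 : ℝ) ^ (-p))⁻¹ * (min 1 y) ^ p := by
  have h0 : 0 < (2 : ℝ) ^ (-p) := by positivity
  have h1 : (2 : ℝ) ^ (-p) < 1 := Real.rpow_lt_one_of_one_lt_of_neg (by norm_num) (by linarith)
  have hc : 0 < (1 - (2 : ℝ) ^ (-p))⁻¹ := inv_pos.2 (by linarith)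
  have hbig : ∀ (m : ℕ) (y : ℝ), 1 ≤ y →
      ∑ j ∈ Finset.range m, (if 1 ≤ (2 : ℝ) ^ j * y then ((2 : ℝ) ^ (-p)) ^ j else 0) ≤
        (1 - (2 : ℝ) ^ (-p))⁻¹ * (min 1 y) ^ p := by
    intro m y hy
    rw [min_eq_left hy, Real.one_rpow, mul_one]
    calc _ ≤ ∑ j ∈ Finset.range m, ((2 : ℝ) ^ (-p)) ^ j := by
          refine Finset.sum_le_sum fun j _ => ?_
          split_ifs
          · exact le_rfl
          · positivity
      _ ≤ ∑' j, ((2 : ℝ) ^ (-p)) ^ j :=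
          (summable_geometric_of_lt_one h0.le h1).sum_le_tsum _ (fun _ _ => by positivity)
      _ = _ := tsum_geometric_of_lt_one h0.le h1
  induction m generalizing y with
  | zero => simpa using by positivity
  | succ m ih =>
    by_cases h : 1 ≤ y
    · exact hbig _ _ h
    · rw [Finset.sum_range_succ']
      push Not at h
      have e : ∀ j ∈ Finset.range m,
          (if 1 ≤ (2 : ℝ) ^ (j + 1) * y then ((2 : ℝ) ^ (-p)) ^ (j + 1) else 0) =
            (2 : ℝ) ^ (-p) * (if 1 ≤ (2 : ℝ) ^ j * (2 * y) then ((2 : ℝ) ^ (-p)) ^ j else 0) := by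
        intro j _
        rw [pow_succ (2 : ℝ) j, mul_assoc, mul_ite, mul_zero, pow_succ' _ j]
      rw [Finset.sum_congr rfl e, ← Finset.mul_sum, min_eq_right h.le]
      have h2 := ih (y := 2 * y) (by positivity)
      have h3 : (min 1 (2 * y)) ^ p ≤ 2 ^ p * y ^ p := by
        rw [← Real.mul_rpow (by norm_num) hy]
        exact Real.rpow_le_rpow (le_min zero_le_one (by positivity)) (min_le_right _ _) hp.le
      have h4 : (2 : ℝ) ^ (-p) * 2 ^ p = 1 := by
        rw [← Real.rpow_add (by norm_num)]; simp
      simp only [pow_zero, one_mul, not_le.2 h, if_false, add_zero]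
      calc _ ≤ (2 : ℝ) ^ (-p) * ((1 - (2 : ℝ) ^ (-p))⁻¹ * (2 ^ p * y ^ p)) := by
            gcongr
            exact h2.trans (by gcongr)
        _ = ((2 : ℝ) ^ (-p) * 2 ^ p) * ((1 - (2 : ℝ) ^ (-p))⁻¹ * y ^ p) := by ring
        _ = _ := by rw [h4, one_mul]

section SelfImprovement

variable {M : Measure (ℕ × ℝ)} {p : ℝ} {B : ℝ≥0∞}

lemma sum_dyadicDilate_le (hM : ∀ᵐ z ∂M, z.2 ∈ Ioc (0 : ℝ) 1) (hp : 0 < p)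
    (hB : ∀ a : ℕ → ℝ, (∀ n, a n ∈ Icc (0 : ℝ) 1) → Antitone a →
      ∫⁻ z, cutoff a z ^ p ∂M ≤ B * M {z | z.2 ≤ a z.1})
    {a : ℕ → ℝ} (ha : ∀ n, a n ∈ Icc (0 : ℝ) 1) (ha' : Antitone a) (m : ℕ) :
    ∑ j ∈ Finset.range m, ENNReal.ofReal ((2 : ℝ) ^ (-p)) ^ j *
        M {z | z.2 ≤ dyadicDilate j a z.1} ≤
      ENNReal.ofReal (1 - (2 : ℝ) ^ (-p))⁻¹ * B * M {z | z.2 ≤ a z.1} := by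
  have hs := fun j => measurableSet_snd_le (dyadicDilate j a)
  calc _ = ∫⁻ z, ∑ j ∈ Finset.range m, {z : ℕ × ℝ | z.2 ≤ dyadicDilate j a z.1}.indicator
        (fun _ => ENNReal.ofReal ((2 : ℝ) ^ (-p)) ^ j) z ∂M := by
        rw [lintegral_finsetSum _ fun j _ => measurable_const.indicator (hs j)]
        refine Finset.sum_congr rfl fun j _ => ?_
        rw [lintegral_indicator_const (hs j)]
    _ ≤ ∫⁻ z, ENNReal.ofReal (1 - (2 : ℝ) ^ (-p))⁻¹ * cutoff a z ^ p ∂M := by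
        refine lintegral_mono_ae ?_
        filter_upwards [hM] with z hz
        have hy : 0 ≤ a z.1 / z.2 := div_nonneg (ha _).1 hz.1.le
        have h1 : (2 : ℝ) ^ (-p) < 1 :=
          Real.rpow_lt_one_of_one_lt_of_neg (by norm_num) (by linarith)
        have hmin : 0 ≤ min 1 (a z.1 / z.2) := le_min zero_le_one hy
        have key := ENNReal.ofReal_le_ofReal (sum_geometric_indicator_le hp m hy)
        rw [ENNReal.ofReal_mul (inv_nonneg.2 (by linarith)),
          ← ENNReal.ofReal_rpow_of_nonneg hmin hp.le,
          ENNReal.ofReal_sum_of_nonneg (fun j _ => by split_ifs <;> positivity)] at key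
        refine le_trans (Finset.sum_le_sum fun j _ => ?_) key
        by_cases hj : z.2 ≤ dyadicDilate j a z.1
        · have h2 : 1 ≤ (2 : ℝ) ^ j * (a z.1 / z.2) := by
            rw [← mul_div_assoc, one_le_div hz.1]
            exact hj.trans (min_le_right _ _)
          rw [if_pos h2,
            indicator_of_mem (show z ∈ {z : ℕ × ℝ | z.2 ≤ dyadicDilate j a z.1} from hj),
            ENNReal.ofReal_pow (by positivity)]
        · rw [indicator_of_notMem (show z ∉ {z : ℕ × ℝ | z.2 ≤ dyadicDilate j a z.1} from hj)]
          exact zero_le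
    _ ≤ _ := by
        rw [lintegral_const_mul _ ((measurable_cutoff a).pow_const p), mul_assoc]
        gcongr
        exact hB a ha ha'

lemma exists_dilation_gain (hM : ∀ᵐ z ∂M, z.2 ∈ Ioc (0 : ℝ) 1) (hp : 0 < p) (hBt : B ≠ ∞)
    (hB : ∀ a : ℕ → ℝ, (∀ n, a n ∈ Icc (0 : ℝ) 1) → Antitone a →
      ∫⁻ z, cutoff a z ^ p ∂M ≤ B * M {z | z.2 ≤ a z.1}) :
    ∃ m : ℕ, 0 < m ∧ ∀ a : ℕ → ℝ, (∀ n, a n ∈ Icc (0 : ℝ) 1) → Antitone a →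
      2 * ENNReal.ofReal ((2 : ℝ) ^ (-p)) ^ m * M {z | z.2 ≤ dyadicDilate m a z.1} ≤
        M {z | z.2 ≤ a z.1} := by
  set θ := ENNReal.ofReal ((2 : ℝ) ^ (-p)) with hθ
  set D := ENNReal.ofReal (1 - (2 : ℝ) ^ (-p))⁻¹ * B with hD
  have hDt : D ≠ ∞ := ENNReal.mul_ne_top ENNReal.ofReal_ne_top hBt
  obtain ⟨m, hm⟩ := ENNReal.exists_nat_gt (r := 2 * (D * D))
    (ENNReal.mul_ne_top (by simp) (ENNReal.mul_ne_top hDt hDt))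
  have hm0 : (m : ℝ≥0∞) ≠ 0 := (zero_le.trans_lt hm).ne'
  refine ⟨m, Nat.pos_of_ne_zero (by simpa using hm0), fun a ha ha' => ?_⟩
  have h1 : ∀ j ∈ Finset.range m, θ ^ m * M {z | z.2 ≤ dyadicDilate m a z.1} ≤
      D * (θ ^ j * M {z | z.2 ≤ dyadicDilate j a z.1}) := by
    intro j hj
    have hjm : j < m := Finset.mem_range.1 hj
    have h := sum_dyadicDilate_le hM hp hB (dyadicDilate_mem_Icc ha j) (ha'.dyadicDilate j)
      (m - j + 1)
    have h2 := (Finset.single_le_sum (f := fun i => θ ^ i *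
      M {z | z.2 ≤ dyadicDilate i (dyadicDilate j a) z.1}) (fun _ _ => zero_le)
      (Finset.self_mem_range_succ (m - j))).trans h
    simp only [dyadicDilate_dyadicDilate, Nat.sub_add_cancel hjm.le] at h2
    calc _ = θ ^ j * (θ ^ (m - j) * M {z | z.2 ≤ dyadicDilate m a z.1}) := by
          rw [← mul_assoc, ← pow_add, Nat.add_sub_cancel' hjm.le]
      _ ≤ θ ^ j * (D * M {z | z.2 ≤ dyadicDilate j a z.1}) := by gcongr
      _ = _ := by ring
  have h2 := Finset.sum_le_sum h1
  rw [Finset.sum_const, Finset.card_range, nsmul_eq_mul, ← Finset.mul_sum] at h2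
  have h3 := h2.trans (mul_le_mul_right (sum_dyadicDilate_le hM hp hB ha ha' m) D)
  refine (ENNReal.mul_le_mul_iff_right hm0 (ENNReal.natCast_ne_top m)).1 ?_
  calc _ = 2 * (m * (θ ^ m * M {z | z.2 ≤ dyadicDilate m a z.1})) := by ring
    _ ≤ 2 * (D * (D * M {z | z.2 ≤ a z.1})) := by gcongr
    _ = 2 * (D * D) * M {z | z.2 ≤ a z.1} := by ring
    _ ≤ _ := by gcongr

lemma iterate_dilation_gain {γ : ℝ≥0∞} {m : ℕ}
    (h : ∀ a : ℕ → ℝ, (∀ n, a n ∈ Icc (0 : ℝ) 1) → Antitone a →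
      γ * M {z | z.2 ≤ dyadicDilate m a z.1} ≤ M {z | z.2 ≤ a z.1})
    {a : ℕ → ℝ} (ha : ∀ n, a n ∈ Icc (0 : ℝ) 1) (ha' : Antitone a) (k : ℕ) :
    γ ^ k * M {z | z.2 ≤ dyadicDilate (m * k) a z.1} ≤ M {z | z.2 ≤ a z.1} := by
  induction k with
  | zero => simp [dyadicDilate_zero ha]
  | succ k ih =>
    have h1 := h _ (dyadicDilate_mem_Icc ha (m * k)) (ha'.dyadicDilate _)
    rw [dyadicDilate_dyadicDilate, add_comm m, ← Nat.mul_succ] at h1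
    refine le_trans ?_ ih
    rw [pow_succ, mul_assoc]
    gcongr

lemma cutoff_rpow_le_tsum {a : ℕ → ℝ} (ha : ∀ n, a n ∈ Icc (0 : ℝ) 1) {m : ℕ} (hm : 0 < m)
    {q : ℝ} (hq : 0 < q) {z : ℕ × ℝ} (hz : z.2 ∈ Ioc (0 : ℝ) 1) :
    cutoff a z ^ q ≤ ∑' k : ℕ, {z : ℕ × ℝ | z.2 ≤ dyadicDilate (m * k) a z.1}.indicator
      (fun _ => ENNReal.ofReal (2 ^ (m * q)) * ENNReal.ofReal (2 ^ (-(m * q))) ^ k) z := by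
  have hm' : (0 : ℝ) < m := by exact_mod_cast hm
  rcases (ha z.1).1.eq_or_lt with h0 | h0
  · simp [cutoff, ← h0, hq]
  have hex : ∃ k : ℕ, z.2 ≤ 2 ^ (m * k) * a z.1 := by
    obtain ⟨k, hk⟩ := pow_unbounded_of_one_lt (z.2 / a z.1)
      (one_lt_pow₀ (one_lt_two (α := ℝ)) hm.ne')
    refine ⟨k, ?_⟩
    rw [pow_mul]
    exact ((div_lt_iff₀ h0).1 hk).le
  classical
  have hk := Nat.find_spec hex
  have hmin := fun i => Nat.find_min hex (m := i)
  set k := Nat.find hex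
  refine le_trans ?_ (ENNReal.le_tsum k)
  rw [indicator_of_mem (show z ∈ {z : ℕ × ℝ | z.2 ≤ dyadicDilate (m * k) a z.1} from
    le_min hz.2 hk)]
  have hc : 0 ≤ min 1 (a z.1 / z.2) := le_min zero_le_one (div_nonneg h0.le hz.1.le)
  rw [cutoff, ENNReal.ofReal_rpow_of_nonneg hc hq.le, ← ENNReal.ofReal_pow (by positivity),
    ← ENNReal.ofReal_mul (by positivity)]
  refine ENNReal.ofReal_le_ofReal ?_
  have e : (2 : ℝ) ^ (m * q) * ((2 : ℝ) ^ (-(m * q))) ^ k = ((2 : ℝ) ^ ((m : ℝ) - m * k)) ^ q := by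
    rw [← Real.rpow_natCast, ← Real.rpow_mul (by norm_num), ← Real.rpow_mul (by norm_num),
      ← Real.rpow_add (by norm_num)]
    ring_nf
  rw [e]
  refine Real.rpow_le_rpow hc ?_ hq.le
  rcases Nat.eq_zero_or_pos k with hk0 | hk0
  · refine (min_le_left _ _).trans (Real.one_le_rpow (by norm_num) ?_)
    simp [hk0]
  · have h1 := hmin (k - 1) (by omega)
    push Not at h1
    refine (min_le_right _ _).trans ?_
    rw [div_le_iff₀ hz.1]
    have e2 : (2 : ℝ) ^ ((m : ℝ) - m * k) * 2 ^ (m * (k - 1)) = 1 := by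
      rw [← Real.rpow_natCast, ← Real.rpow_add (by norm_num)]
      push_cast [Nat.cast_sub (show 1 ≤ k from hk0)]
      ring_nf
      simp
    calc a z.1 = (2 : ℝ) ^ ((m : ℝ) - m * k) * (2 ^ (m * (k - 1)) * a z.1) := by
          rw [← mul_assoc, e2, one_mul]
      _ ≤ _ := by gcongr

/-- The class of weights is open in the exponent. -/
lemma exists_lt_exponent (hM : ∀ᵐ z ∂M, z.2 ∈ Ioc (0 : ℝ) 1) (hp : 0 < p) (hBt : B ≠ ∞)
    (hB : ∀ a : ℕ → ℝ, (∀ n, a n ∈ Icc (0 : ℝ) 1) → Antitone a →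
      ∫⁻ z, cutoff a z ^ p ∂M ≤ B * M {z | z.2 ≤ a z.1}) :
    ∃ q : ℝ, 0 < q ∧ q < p ∧ ∃ K : ℝ≥0∞, K ≠ ∞ ∧
      ∀ a : ℕ → ℝ, (∀ n, a n ∈ Icc (0 : ℝ) 1) → Antitone a →
        ∫⁻ z, cutoff a z ^ q ∂M ≤ K * M {z | z.2 ≤ a z.1} := by
  obtain ⟨m, hm, hgain⟩ := exists_dilation_gain hM hp hBt hB
  have hm' : (0 : ℝ) < m := by exact_mod_cast hm
  set δ := min (p / 2) (1 / (2 * m)) with hδ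
  have hδ0 : 0 < δ := lt_min (by positivity) (by positivity)
  have hδp : δ ≤ p / 2 := min_le_left _ _
  have hδm : m * δ ≤ 1 / 2 := by
    calc m * δ ≤ m * (1 / (2 * m)) := by gcongr; exact min_le_right _ _
      _ = 1 / 2 := by field_simp
  set q := p - δ with hq
  have hq0 : 0 < q := by linarith
  set R := ENNReal.ofReal ((2 : ℝ) ^ (-(1 / 2) : ℝ)) with hR
  have hR1 : R < 1 := by
    rw [hR, ENNReal.ofReal_lt_one]
    exact Real.rpow_lt_one_of_one_lt_of_neg (by norm_num) (by norm_num)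
  set Λ := ENNReal.ofReal (2 ^ (m * q))
  refine ⟨q, hq0, by linarith, Λ * (1 - R)⁻¹, ENNReal.mul_ne_top ENNReal.ofReal_ne_top
    (ENNReal.inv_ne_top.2 (tsub_pos_of_lt hR1).ne'), fun a ha ha' => ?_⟩
  have hratio : ENNReal.ofReal (2 ^ (-(m * q))) ≤
      R * (2 * ENNReal.ofReal ((2 : ℝ) ^ (-p)) ^ m) := by
    have e2 : (2 : ℝ≥0∞) = ENNReal.ofReal 2 := by simp
    rw [hR, ← ENNReal.ofReal_pow (by positivity), e2, ← ENNReal.ofReal_mul (by norm_num),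
      ← ENNReal.ofReal_mul (by positivity)]
    refine ENNReal.ofReal_le_ofReal ?_
    have e : (2 : ℝ) ^ (-(1 / 2) : ℝ) * (2 * ((2 : ℝ) ^ (-p)) ^ m) =
        2 ^ (1 / 2 - m * p : ℝ) := by
      have e3 : (2 : ℝ) * ((2 : ℝ) ^ (-p)) ^ m = 2 ^ (1 - m * p : ℝ) := by
        rw [← Real.rpow_natCast, ← Real.rpow_mul (by norm_num), sub_eq_add_neg,
          Real.rpow_add (by norm_num), Real.rpow_one]
        ring_nf
      rw [e3, ← Real.rpow_add (by norm_num)]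
      ring_nf
    rw [e]
    refine Real.rpow_le_rpow_of_exponent_le (by norm_num) ?_
    rw [hq]
    linarith
  calc _ ≤ ∫⁻ z, ∑' k : ℕ, {z : ℕ × ℝ | z.2 ≤ dyadicDilate (m * k) a z.1}.indicator
        (fun _ => Λ * ENNReal.ofReal (2 ^ (-(m * q))) ^ k) z ∂M :=
        lintegral_mono_ae (hM.mono fun z hz => cutoff_rpow_le_tsum ha hm hq0 hz)
    _ = ∑' k : ℕ, Λ * ENNReal.ofReal (2 ^ (-(m * q))) ^ k *
          M {z | z.2 ≤ dyadicDilate (m * k) a z.1} := by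
        rw [lintegral_tsum fun k =>
          (measurable_const.indicator (measurableSet_snd_le _)).aemeasurable]
        refine tsum_congr fun k => ?_
        rw [lintegral_indicator_const (measurableSet_snd_le _)]
    _ ≤ ∑' k : ℕ, Λ * (R ^ k * M {z | z.2 ≤ a z.1}) := by
        refine ENNReal.tsum_le_tsum fun k => ?_
        rw [mul_assoc]
        gcongr Λ * ?_
        calc _ ≤ (R * (2 * ENNReal.ofReal ((2 : ℝ) ^ (-p)) ^ m)) ^ k *
              M {z | z.2 ≤ dyadicDilate (m * k) a z.1} := by gcongr
          _ = R ^ k * ((2 * ENNReal.ofReal ((2 : ℝ) ^ (-p)) ^ m) ^ k *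
              M {z | z.2 ≤ dyadicDilate (m * k) a z.1}) := by rw [mul_pow, mul_assoc]
          _ ≤ _ := by
            gcongr R ^ k * ?_
            exact iterate_dilation_gain hgain ha ha' k
    _ = _ := by
        rw [ENNReal.tsum_mul_left, ENNReal.tsum_mul_right, ENNReal.tsum_geometric, mul_assoc]

end SelfImprovement

section Antitone

variable {h : ℝ → ℝ≥0∞} {p q : ℝ}

lemma setLIntegral_Ioc_rpow_sub_one (hp : 0 < p) {s : ℝ} (hs : 0 < s) :
    ∫⁻ x in Ioc 0 s, ENNReal.ofReal (x ^ (p - 1)) = ENNReal.ofReal (s ^ p / p) := by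
  have hi : IntervalIntegrable (fun x : ℝ => x ^ (p - 1)) volume 0 s :=
    intervalIntegral.intervalIntegrable_rpow' (by linarith)
  rw [← ofReal_integral_eq_lintegral_ofReal hi.1
    ((ae_restrict_mem measurableSet_Ioc).mono fun x hx => Real.rpow_nonneg hx.1.le _),
    ← intervalIntegral.integral_of_le hs.le, integral_rpow (Or.inl (by linarith))]
  simp [Real.zero_rpow hp.ne']

lemma setLIntegral_Ioi_rpow {r c s : ℝ} (hr : r < -1) (hc : 0 ≤ c) (hs : 0 < s) :
    ∫⁻ x in Ioi s, ENNReal.ofReal (c * x ^ r) =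
      ENNReal.ofReal (c * (-s ^ (r + 1) / (r + 1))) := by
  rw [← integral_Ioi_rpow_of_lt hr hs, ← integral_const_mul]
  exact (ofReal_integral_eq_lintegral_ofReal ((integrableOn_Ioi_rpow_of_lt hr hs).const_mul c)
    ((ae_restrict_mem measurableSet_Ioi).mono fun x hx =>
      mul_nonneg hc (Real.rpow_nonneg (hs.trans hx).le _))).symm

lemma Antitone.rpow_mul_le_lintegral (hh : Antitone h) (hp : 0 < p) (hq : 0 < q) {s : ℝ}
    (hs : 0 < s) :
    h s ^ q * ENNReal.ofReal (s ^ p / p) ≤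
      ∫⁻ x in Ioi 0, ENNReal.ofReal (x ^ (p - 1)) * h x ^ q := by
  have hm : Measurable fun x : ℝ => ENNReal.ofReal (x ^ (p - 1)) := by fun_prop
  rw [← setLIntegral_Ioc_rpow_sub_one hp hs, ← lintegral_const_mul _ hm]
  refine (setLIntegral_mono' measurableSet_Ioc fun x hx => ?_).trans
    (lintegral_mono_set Ioc_subset_Ioi_self)
  rw [mul_comm]
  gcongr
  exact hh hx.2

/-- A Hardy-type inequality interpolating between the bound `h ≤ 1` and the exponent `q`. -/
lemma Antitone.lintegral_rpow_le (hh : Antitone h) (h1 : ∀ s, h s ≤ 1) (hq : 0 < q)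
    (hqp : q < p) :
    (∫⁻ s in Ioi 0, h s) ^ p ≤ ENNReal.ofReal (p * (p / (p - q)) ^ p) *
      ∫⁻ s in Ioi 0, ENNReal.ofReal (s ^ (p - 1)) * h s ^ q := by
  have hp : 0 < p := hq.trans hqp
  have hpq : 0 < p - q := sub_pos.2 hqp
  have hC : 0 < p * (p / (p - q)) ^ p := by positivity
  have hle := fun s hs => hh.rpow_mul_le_lintegral (p := p) (s := s) hp hq hs
  set I := ∫⁻ s in Ioi 0, ENNReal.ofReal (s ^ (p - 1)) * h s ^ q with hI
  clear_value I
  rcases eq_or_ne I ∞ with hIt | hIt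
  · rw [hIt, ENNReal.mul_top (by simpa using hC)]
    exact le_top
  lift I to ℝ≥0 using hIt
  have hdecay : ∀ s : ℝ, 0 < s → h s ≤ ENNReal.ofReal ((p * I) ^ (1 / q) * s ^ (-p / q)) := by
    intro s hs
    have hsp : 0 < s ^ p / p := by positivity
    have h2 : h s ^ q ≤ ENNReal.ofReal (p * I * s ^ (-p)) := by
      have h3 := (ENNReal.le_div_iff_mul_le (Or.inl (by simpa using hsp))
        (Or.inl ENNReal.ofReal_ne_top)).2 (hle s hs)
      rw [← ENNReal.ofReal_coe_nnreal, ← ENNReal.ofReal_div_of_pos hsp] at h3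
      refine h3.trans_eq (congrArg _ ?_)
      rw [Real.rpow_neg hs.le]
      field_simp
    have h4 := ENNReal.rpow_le_rpow h2 (one_div_nonneg.2 hq.le)
    rw [← ENNReal.rpow_mul, mul_one_div_cancel hq.ne', ENNReal.rpow_one,
      ENNReal.ofReal_rpow_of_nonneg (by positivity) (by positivity),
      Real.mul_rpow (by positivity) (by positivity), ← Real.rpow_mul hs.le, mul_one_div] at h4
    exact h4
  rcases eq_or_ne I 0 with h0 | h0
  · have hz : ∫⁻ s in Ioi 0, h s = 0 := by
      rw [← lintegral_zero (μ := volume.restrict (Ioi (0 : ℝ)))]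
      refine setLIntegral_congr_fun measurableSet_Ioi fun s hs => ?_
      have := hdecay s hs
      rw [h0, NNReal.coe_zero, mul_zero, Real.zero_rpow (by positivity), zero_mul] at this
      simpa using this
    rw [hz, ENNReal.zero_rpow_of_pos hp]
    exact zero_le
  · have hX : 0 < p * (I : ℝ) := mul_pos hp (by exact_mod_cast pos_iff_ne_zero.2 h0)
    set X := p * (I : ℝ) with hXdef
    have hs0 : 0 < X ^ (1 / p) := by positivity
    have hr : -p / q < -1 := by
      rw [div_lt_iff₀ hq]; linarith
    have hbound : ∫⁻ s in Ioi 0, h s ≤ ENNReal.ofReal (X ^ (1 / p) * (p / (p - q))) := by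
      calc ∫⁻ s in Ioi 0, h s
          ≤ (∫⁻ s in Ioc 0 (X ^ (1 / p)), h s) + ∫⁻ s in Ioi (X ^ (1 / p)), h s := by
            rw [← Ioc_union_Ioi_eq_Ioi hs0.le]
            exact lintegral_union_le _ _ _
        _ ≤ (∫⁻ s in Ioc 0 (X ^ (1 / p)), 1) +
            ∫⁻ s in Ioi (X ^ (1 / p)), ENNReal.ofReal (X ^ (1 / q) * s ^ (-p / q)) := by
            refine add_le_add (lintegral_mono fun s => h1 s) ?_
            exact setLIntegral_mono' measurableSet_Ioi fun s hs => hdecay s (hs0.trans hs)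
        _ = _ := by
            rw [setLIntegral_one, Real.volume_Ioc, setLIntegral_Ioi_rpow hr (by positivity) hs0,
              sub_zero, ← ENNReal.ofReal_add hs0.le]
            · congr 1
              have e : X ^ (1 / q) * (X ^ (1 / p)) ^ (-p / q + 1) = X ^ (1 / p) := by
                rw [← Real.rpow_mul hX.le, ← Real.rpow_add hX]
                congr 1
                field_simp
                ring
              have e2 : -p / q + 1 = -((p - q) / q) := by field_simp; ring
              rw [← mul_div_assoc, mul_neg, e, e2]
              field_simp
              ring
            · refine mul_nonneg (by positivity) (div_nonneg_of_nonpos ?_ (by linarith))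
              exact neg_nonpos.2 (by positivity)
    refine (ENNReal.rpow_le_rpow hbound hp.le).trans_eq ?_
    rw [ENNReal.ofReal_rpow_of_nonneg (by positivity) hp.le, ← ENNReal.ofReal_coe_nnreal,
      ← ENNReal.ofReal_mul hC.le, Real.mul_rpow hs0.le (by positivity), ← Real.rpow_mul hX.le,
      one_div_mul_cancel hp.ne', Real.rpow_one]
    congr 1
    rw [hXdef]
    ring

end Antitone

/-- The measure `u(x) dx` on `(0, ∞)` in the coordinates `(n, t)` for the point `x = n + t` with
`0 < t ≤ 1`. -/
noncomputable def stripMeasure (u : ℝ → ℝ≥0) : Measure (ℕ × ℝ) :=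
  ((Measure.count : Measure ℕ).prod (volume.restrict (Ioc (0 : ℝ) 1))).withDensity
    fun z => ((u (z.1 + z.2) : ℝ≥0) : ℝ≥0∞)

section Strip

variable {u : ℝ → ℝ≥0}

instance : SigmaFinite (stripMeasure u) :=
  SigmaFinite.withDensity fun z : ℕ × ℝ => u (z.1 + z.2)

lemma measurable_strip_add : Measurable fun z : ℕ × ℝ => (z.1 : ℝ) + z.2 :=
  ((measurable_of_countable fun n : ℕ => (n : ℝ)).comp measurable_fst).add measurable_snd

lemma lintegral_stripMeasure (hu : Measurable u) {g : ℕ × ℝ → ℝ≥0∞} (hg : Measurable g) :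
    ∫⁻ z, g z ∂stripMeasure u =
      ∑' n : ℕ, ∫⁻ t in Ioc (0 : ℝ) 1, g (n, t) * (u ((n : ℝ) + t) : ℝ≥0∞) := by
  have hd : Measurable fun z : ℕ × ℝ => ((u (z.1 + z.2) : ℝ≥0) : ℝ≥0∞) :=
    (hu.comp measurable_strip_add).coe_nnreal_ennreal
  rw [stripMeasure, lintegral_withDensity_eq_lintegral_mul _ hd hg,
    lintegral_prod _ (hd.mul hg).aemeasurable, lintegral_count]
  simp only [Pi.mul_apply, mul_comm]

lemma setLIntegral_stripMeasure (hu : Measurable u) {g : ℕ × ℝ → ℝ≥0∞} (hg : Measurable g)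
    {s : Set (ℕ × ℝ)} (hs : MeasurableSet s) :
    ∫⁻ z in s, g z ∂stripMeasure u =
      ∑' n : ℕ, ∫⁻ t in Prod.mk n ⁻¹' s ∩ Ioc (0 : ℝ) 1,
        g (n, t) * (u ((n : ℝ) + t) : ℝ≥0∞) := by
  rw [← lintegral_indicator hs, lintegral_stripMeasure hu (hg.indicator hs)]
  refine tsum_congr fun n => ?_
  have hs' : MeasurableSet (Prod.mk n ⁻¹' s) := measurable_prodMk_left hs
  rw [← Measure.restrict_restrict hs', ← lintegral_indicator hs']
  refine lintegral_congr fun t => ?_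
  by_cases h : (n, t) ∈ s
  · rw [indicator_of_mem h, indicator_of_mem (show t ∈ Prod.mk n ⁻¹' s from h)]
  · rw [indicator_of_notMem h, indicator_of_notMem (show t ∉ Prod.mk n ⁻¹' s from h), zero_mul]

lemma stripMeasure_snd_le (hu : Measurable u) {a : ℕ → ℝ} (ha : ∀ n, a n ∈ Icc (0 : ℝ) 1) :
    stripMeasure u {z | z.2 ≤ a z.1} =
      ∑' n : ℕ, ∫⁻ t in Ioc (0 : ℝ) (a n), (u ((n : ℝ) + t) : ℝ≥0∞) := by
  rw [← setLIntegral_one, setLIntegral_stripMeasure hu measurable_const (measurableSet_snd_le a)]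
  refine tsum_congr fun n => ?_
  have e : Prod.mk n ⁻¹' {z : ℕ × ℝ | z.2 ≤ a z.1} ∩ Ioc (0 : ℝ) 1 = Ioc 0 (a n) := by
    ext t
    simp only [mem_inter_iff, mem_preimage, mem_ofPred_eq, mem_Ioc]
    exact ⟨fun h => ⟨h.2.1, h.1⟩, fun h => ⟨h.2, h.1, h.2.trans (ha n).2⟩⟩
  rw [e]
  simp

lemma setLIntegral_stripMeasure_lt_snd (hu : Measurable u) {a : ℕ → ℝ}
    (ha : ∀ n, a n ∈ Icc (0 : ℝ) 1) {g : ℕ × ℝ → ℝ≥0∞} (hg : Measurable g) :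
    ∫⁻ z in {z | z.2 ≤ a z.1}ᶜ, g z ∂stripMeasure u =
      ∑' n : ℕ, ∫⁻ t in Ioc (a n) 1, g (n, t) * (u ((n : ℝ) + t) : ℝ≥0∞) := by
  rw [setLIntegral_stripMeasure hu hg (measurableSet_snd_le a).compl]
  refine tsum_congr fun n => ?_
  have e : Prod.mk n ⁻¹' {z : ℕ × ℝ | z.2 ≤ a z.1}ᶜ ∩ Ioc (0 : ℝ) 1 = Ioc (a n) 1 := by
    ext t
    simp only [mem_inter_iff, mem_preimage, mem_compl_iff, mem_ofPred_eq, mem_Ioc, not_le]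
    exact ⟨fun h => ⟨h.1, h.2.2⟩, fun h => ⟨h.1, (ha n).1.trans_lt h.1, h.2⟩⟩
  rw [e]

lemma ae_stripMeasure_snd_ne (a : ℕ → ℝ) : ∀ᵐ z ∂stripMeasure u, z.2 ≠ a z.1 := by
  refine (withDensity_absolutelyContinuous _ _).ae_le (ae_iff.2 ?_)
  simp only [ne_eq, not_not]
  refine Measure.measure_prod_null_of_ae_null
    (measurableSet_eq_fun measurable_snd ((measurable_of_countable a).comp measurable_fst))
    (Filter.Eventually.of_forall fun n => ?_)
  have e : Prod.mk n ⁻¹' {z : ℕ × ℝ | z.2 = a z.1} = {a n} := by ext; simp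
  beta_reduce
  rw [e]
  simp

lemma ae_stripMeasure_mem_Ioo : ∀ᵐ z ∂stripMeasure u, z.2 ∈ Ioo (0 : ℝ) 1 := by
  have h : ∀ᵐ z ∂stripMeasure u, z.2 ∈ Ioc (0 : ℝ) 1 := by
    refine (withDensity_absolutelyContinuous _ _).ae_le (ae_iff.2 ?_)
    have hs : MeasurableSet {z : ℕ × ℝ | ¬ z.2 ∈ Ioc (0 : ℝ) 1} :=
      (measurable_snd measurableSet_Ioc).compl
    refine Measure.measure_prod_null_of_ae_null hs (Filter.Eventually.of_forall fun n => ?_)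
    have e : Prod.mk n ⁻¹' {z : ℕ × ℝ | ¬ z.2 ∈ Ioc (0 : ℝ) 1} = (Ioc (0 : ℝ) 1)ᶜ := rfl
    beta_reduce
    rw [e, Measure.restrict_apply measurableSet_Ioc.compl]
    simp
  filter_upwards [h, ae_stripMeasure_snd_ne fun _ => 1] with z hz hz'
  exact ⟨hz.1, lt_of_le_of_ne hz.2 hz'⟩

lemma setLIntegral_Ioc_add (g : ℝ → ℝ≥0∞) (c t : ℝ) :
    ∫⁻ x in Ioc c (c + t), g x = ∫⁻ x in Ioc 0 t, g (c + x) := by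
  rw [← lintegral_indicator measurableSet_Ioc, ← lintegral_indicator measurableSet_Ioc,
    ← lintegral_add_left_eq_self _ c]
  refine lintegral_congr fun x => ?_
  simp only [indicator, mem_Ioc, lt_add_iff_pos_right, add_le_add_iff_left]

lemma setLIntegral_Ioi_mul_eq_lintegral_stripMeasure (hu : Measurable u) {g : ℝ → ℝ≥0∞}
    (hg : Measurable g) :
    ∫⁻ x in Ioi (0 : ℝ), g x * (u x : ℝ≥0∞) = ∫⁻ z, g (z.1 + z.2) ∂stripMeasure u := by
  have hU : (⋃ n : ℕ, Ioc (n : ℝ) (n + 1)) = Ioi 0 := by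
    ext x
    simp only [mem_iUnion, mem_Ioc, mem_Ioi]
    refine ⟨fun ⟨n, hn, _⟩ => n.cast_nonneg.trans_lt hn, fun hx => ?_⟩
    have h1 : 0 < ⌈x⌉₊ := Nat.ceil_pos.2 hx
    refine ⟨⌈x⌉₊ - 1, ?_, ?_⟩
    · exact Nat.lt_ceil.1 (by omega)
    · rw [Nat.cast_sub h1]
      simpa using Nat.le_ceil x
  have hd : Pairwise (Function.onFun Disjoint fun n : ℕ => Ioc (n : ℝ) (n + 1)) := by
    intro i j hij
    have := pairwise_disjoint_Ioc_add_intCast (0 : ℝ) (show (i : ℤ) ≠ j by exact_mod_cast hij)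
    simpa [Function.onFun] using this
  rw [← hU, lintegral_iUnion (fun _ => measurableSet_Ioc) hd,
    lintegral_stripMeasure (g := fun z => g (z.1 + z.2)) hu (hg.comp measurable_strip_add)]
  exact tsum_congr fun n => setLIntegral_Ioc_add _ _ _

end Strip

section Averages

variable {f : ℝ → ℝ≥0}

lemma measurable_Sblack (hf : Measurable f) : Measurable (Sblack f) := by
  have hfl : Measurable fun x : ℝ => (⌊x⌋ : ℝ) :=
    (measurable_of_countable fun n : ℤ => (n : ℝ)).comp measurable_id.floor
  have hs : MeasurableSet {z : ℝ × ℝ | (⌊z.1⌋ : ℝ) < z.2 ∧ z.2 ≤ z.1} :=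
    (measurableSet_lt (hfl.comp measurable_fst) measurable_snd).inter
      (measurableSet_le measurable_snd measurable_fst)
  have hm : Measurable fun z : ℝ × ℝ => (f z.2 : ℝ≥0∞) :=
    (hf.comp measurable_snd).coe_nnreal_ennreal
  have h := (hm.indicator hs).lintegral_prod_right' (ν := volume)
  refine Measurable.div ?_ (measurable_id.sub hfl).ennreal_ofReal
  convert h using 2 with x
  rw [← lintegral_indicator measurableSet_Ioc]
  rfl

lemma Sblack_natCast_add (f : ℝ → ℝ≥0) (n : ℕ) {t : ℝ} (ht : t ∈ Ioo (0 : ℝ) 1) :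
    Sblack f (n + t) = (∫⁻ x in Ioc 0 t, (f (n + x) : ℝ≥0∞)) / ENNReal.ofReal t := by
  have h : ⌊(n : ℝ) + t⌋ = n := by
    rw [Int.floor_natCast_add, Int.floor_eq_zero_iff.2 ⟨ht.1.le, ht.2⟩, add_zero]
  rw [Sblack, h, Int.cast_natCast, add_sub_cancel_left,
    setLIntegral_Ioc_add (fun x => (f x : ℝ≥0∞))]

/-- The length of the level set `{f > s}` in the interval `(n, n + 1)`. -/
noncomputable def levelLength (f : ℝ → ℝ≥0) (s : ℝ) (n : ℕ) : ℝ :=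
  volume.real {x | x ∈ Ioo (0 : ℝ) 1 ∧ s < f (n + x)}

lemma volume_level_ne_top (f : ℝ → ℝ≥0) (s : ℝ) (n : ℕ) :
    volume {x | x ∈ Ioo (0 : ℝ) 1 ∧ s < f (n + x)} ≠ ∞ :=
  measure_ne_top_of_subset (fun _ hx => hx.1) (by simp : volume (Ioo (0 : ℝ) 1) ≠ ∞)

lemma levelLength_mem_Icc (f : ℝ → ℝ≥0) (s : ℝ) (n : ℕ) : levelLength f s n ∈ Icc (0 : ℝ) 1 := by
  refine ⟨measureReal_nonneg, ?_⟩
  calc levelLength f s n ≤ volume.real (Ioo (0 : ℝ) 1) :=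
        measureReal_mono (fun _ hx => hx.1) (by simp)
    _ = 1 := by simp

lemma antitone_levelLength_left (f : ℝ → ℝ≥0) (n : ℕ) : Antitone fun s => levelLength f s n :=
  fun _ _ h => measureReal_mono (fun _ hx => ⟨hx.1, h.trans_lt hx.2⟩) (volume_level_ne_top f _ n)

lemma antitone_levelLength (hf : ∀ x : ℝ, 0 < x → f (x + 1) ≤ f x) (s : ℝ) :
    Antitone (levelLength f s) := by
  refine antitone_nat_of_succ_le fun n => ?_
  refine measureReal_mono (fun x hx => ⟨hx.1, hx.2.trans_le ?_⟩) (volume_level_ne_top f s n)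
  have h := hf (n + x) (add_pos_of_nonneg_of_pos n.cast_nonneg hx.1.1)
  rw [show ((n + 1 : ℕ) : ℝ) + x = n + x + 1 by push_cast; ring]
  exact_mod_cast h

lemma lt_of_lt_levelLength {n : ℕ}
    (hf : ∀ x y : ℝ, (n : ℝ) < x → x ≤ y → y < (n : ℝ) + 1 → f y ≤ f x) {s t : ℝ}
    (ht : 0 < t) (h : t < levelLength f s n) : s < f (n + t) := by
  by_contra! hs
  refine h.not_ge ?_
  calc levelLength f s n ≤ volume.real (Ioo 0 t) := by
        refine measureReal_mono (fun x hx => ⟨hx.1.1, ?_⟩) (by simp)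
        by_contra! hx'
        have := hf (n + t) (n + x) (by linarith) (by linarith) (by linarith [hx.1.2])
        exact (hx.2.trans_le (by exact_mod_cast this)).not_ge hs
    _ = t := by simp [ht.le]

lemma Sblack_le_lintegral_cutoff (hf : Measurable f) {z : ℕ × ℝ} (hz : z.2 ∈ Ioo (0 : ℝ) 1) :
    Sblack f (z.1 + z.2) ≤ ∫⁻ s in Ioi 0, cutoff (levelLength f s) z := by
  obtain ⟨n, t⟩ := z
  simp only at hz ⊢
  have hm : Measurable fun x : ℝ => (f (n + x) : ℝ) :=
    (hf.comp (measurable_const_add _)).coe_nnreal_real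
  have e : ∫⁻ x in Ioc 0 t, (f (n + x) : ℝ≥0∞) =
      ∫⁻ s in Ioi 0, volume.restrict (Ioc 0 t) {x | s < (f (n + x) : ℝ)} := by
    rw [← lintegral_eq_lintegral_meas_lt _ (Filter.Eventually.of_forall fun x => by simp)
      hm.aemeasurable]
    simp
  have ht : ENNReal.ofReal t ≠ 0 := by simpa using hz.1
  rw [Sblack_natCast_add f n hz, e, div_eq_mul_inv,
    ← lintegral_mul_const' _ _ (ENNReal.inv_ne_top.2 ht)]
  refine lintegral_mono fun s => ?_
  have hmin : min 1 (levelLength f s n / t) = min t (levelLength f s n) / t := by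
    rw [← min_div_div_right hz.1.le, div_self hz.1.ne']
  rw [← div_eq_mul_inv, cutoff, hmin, ENNReal.ofReal_div_of_pos hz.1]
  gcongr
  rw [ENNReal.ofReal_min, Measure.restrict_apply (measurableSet_lt measurable_const hm)]
  refine le_min ((measure_mono inter_subset_right).trans (by simp)) ?_
  rw [levelLength, ofReal_measureReal (volume_level_ne_top f s n)]
  exact measure_mono fun x hx => ⟨⟨hx.2.1, hx.2.2.trans_lt hz.2⟩, hx.1⟩

lemma measurable_cutoff_levelLength (f : ℝ → ℝ≥0) :
    Measurable fun w : (ℕ × ℝ) × ℝ => cutoff (levelLength f w.2) w.1 := by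
  have h : Measurable fun w : ℕ × ℝ => levelLength f w.2 w.1 :=
    measurable_from_prod_countable_right fun n => (antitone_levelLength_left f n).measurable
  have h' : Measurable fun w : (ℕ × ℝ) × ℝ => levelLength f w.2 w.1.1 :=
    h.comp ((measurable_fst.comp measurable_fst).prodMk measurable_snd)
  exact (measurable_const.min (h'.div (measurable_snd.comp measurable_fst))).ennreal_ofReal

end Averages

lemma cutoff_rpow_bound_of_sequences {u : ℝ → ℝ≥0} (hu : Measurable u) {p : ℝ} (hp : 0 < p)
    {C : ℝ≥0∞} {a : ℕ → ℝ} (ha : ∀ n, a n ∈ Icc (0 : ℝ) 1)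
    (hC : ∑' n : ℕ, ∫⁻ t in Ioc (a n) 1,
        ENNReal.ofReal ((a n / t) ^ p) * (u ((n : ℝ) + t) : ℝ≥0∞) ≤
      C * ∑' n : ℕ, ∫⁻ t in Ioc (0 : ℝ) (a n), (u ((n : ℝ) + t) : ℝ≥0∞)) :
    ∫⁻ z, cutoff a z ^ p ∂stripMeasure u ≤ (1 + C) * stripMeasure u {z | z.2 ≤ a z.1} := by
  have hg : Measurable fun z : ℕ × ℝ => ENNReal.ofReal ((a z.1 / z.2) ^ p) :=
    ((((measurable_of_countable a).comp measurable_fst).div measurable_snd).pow_const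
      p).ennreal_ofReal
  rw [← stripMeasure_snd_le hu ha, ← setLIntegral_stripMeasure_lt_snd hu ha hg] at hC
  rw [← lintegral_add_compl _ (measurableSet_snd_le a), add_mul, one_mul]
  refine add_le_add ?_ (le_trans ?_ hC)
  · rw [← setLIntegral_one]
    refine lintegral_mono fun z => ENNReal.rpow_le_one ?_ hp.le
    exact ENNReal.ofReal_le_one.2 (min_le_left _ _)
  · refine lintegral_mono_ae ?_
    filter_upwards [ae_restrict_of_ae ae_stripMeasure_mem_Ioo] with z hz
    have h0 : 0 ≤ a z.1 / z.2 := div_nonneg (ha _).1 hz.1.le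
    rw [cutoff, ENNReal.ofReal_rpow_of_nonneg (le_min zero_le_one h0) hp.le]
    exact ENNReal.ofReal_le_ofReal
      (Real.rpow_le_rpow (le_min zero_le_one h0) (min_le_right _ _) hp.le)

lemma exists_Sblack_bound {u : ℝ → ℝ≥0} (hu : Measurable u) {p : ℝ} (hp : 0 < p)
    {B : ℝ≥0∞} (hBt : B ≠ ∞)
    (hB : ∀ a : ℕ → ℝ, (∀ n, a n ∈ Icc (0 : ℝ) 1) → Antitone a →
      ∫⁻ z, cutoff a z ^ p ∂stripMeasure u ≤ B * stripMeasure u {z | z.2 ≤ a z.1}) :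
    ∃ K : ℝ≥0∞, K ≠ ∞ ∧ ∀ f : ℝ → ℝ≥0, Measurable f →
        (∀ n : ℕ, ∀ x y : ℝ, (n : ℝ) < x → x ≤ y → y < (n : ℝ) + 1 → f y ≤ f x) →
        (∀ x : ℝ, 0 < x → f (x + 1) ≤ f x) →
        ∫⁻ x in Ioi (0 : ℝ), Sblack f x ^ p * (u x : ℝ≥0∞) ≤
          K * ∫⁻ x in Ioi (0 : ℝ), (f x : ℝ≥0∞) ^ p * (u x : ℝ≥0∞) := by
  obtain ⟨q, hq, hqp, K, hKt, hK⟩ := exists_lt_exponent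
    (ae_stripMeasure_mem_Ioo.mono fun z hz => ⟨hz.1, hz.2.le⟩) hp hBt hB
  set c := ENNReal.ofReal (p * (p / (p - q)) ^ p)
  have hp' : ENNReal.ofReal p ≠ 0 := by simpa using hp
  refine ⟨c * (K * (ENNReal.ofReal p)⁻¹), ENNReal.mul_ne_top ENNReal.ofReal_ne_top
    (ENNReal.mul_ne_top hKt (ENNReal.inv_ne_top.2 hp')), fun f hf hmono hshift => ?_⟩
  have hfp : Measurable fun x => (f x : ℝ≥0∞) ^ p := hf.coe_nnreal_ennreal.pow_const p
  have hfs : Measurable fun z : ℕ × ℝ => (f (z.1 + z.2) : ℝ) :=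
    (hf.comp measurable_strip_add).coe_nnreal_real
  rw [setLIntegral_Ioi_mul_eq_lintegral_stripMeasure hu ((measurable_Sblack hf).pow_const p),
    setLIntegral_Ioi_mul_eq_lintegral_stripMeasure hu hfp]
  have hmc := measurable_cutoff_levelLength f
  have hrp : Measurable fun s : ℝ => ENNReal.ofReal (s ^ (p - 1)) := by fun_prop
  have hlayer : ∫⁻ z, (f (z.1 + z.2) : ℝ≥0∞) ^ p ∂stripMeasure u = ENNReal.ofReal p *
      ∫⁻ s in Ioi 0, stripMeasure u {z | s < (f (z.1 + z.2) : ℝ)} *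
        ENNReal.ofReal (s ^ (p - 1)) := by
    rw [← lintegral_rpow_eq_lintegral_meas_lt_mul _
      (Filter.Eventually.of_forall fun z => by simp) hfs.aemeasurable hp]
    refine lintegral_congr fun z => ?_
    rw [← ENNReal.ofReal_rpow_of_nonneg (by simp) hp.le, ENNReal.ofReal_coe_nnreal]
  have hlevel : ∀ s, stripMeasure u {z | z.2 ≤ levelLength f s z.1} ≤
      stripMeasure u {z | s < (f (z.1 + z.2) : ℝ)} := by
    intro s
    refine measure_mono_ae ?_
    filter_upwards [ae_stripMeasure_mem_Ioo, ae_stripMeasure_snd_ne (levelLength f s)]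
      with z hz hne hle
    exact lt_of_lt_levelLength (hmono z.1) hz.1 (lt_of_le_of_ne hle hne)
  calc ∫⁻ z, Sblack f (z.1 + z.2) ^ p ∂stripMeasure u
      ≤ ∫⁻ z, (c * ∫⁻ s in Ioi 0, ENNReal.ofReal (s ^ (p - 1)) *
          cutoff (levelLength f s) z ^ q) ∂stripMeasure u := by
        refine lintegral_mono_ae ?_
        filter_upwards [ae_stripMeasure_mem_Ioo] with z hz
        refine (ENNReal.rpow_le_rpow (Sblack_le_lintegral_cutoff hf hz) hp.le).trans ?_
        refine Antitone.lintegral_rpow_le (fun s s' hs => ?_) (fun s => ?_) hq hqp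
        · refine ENNReal.ofReal_le_ofReal (min_le_min le_rfl ?_)
          exact div_le_div_of_nonneg_right (antitone_levelLength_left f z.1 hs) hz.1.le
        · exact ENNReal.ofReal_le_one.2 (min_le_left _ _)
    _ = c * ∫⁻ s in Ioi 0, ENNReal.ofReal (s ^ (p - 1)) *
          ∫⁻ z, cutoff (levelLength f s) z ^ q ∂stripMeasure u := by
        rw [lintegral_const_mul' _ _ ENNReal.ofReal_ne_top, lintegral_lintegral_swap]
        · congr 1
          refine lintegral_congr fun s => ?_
          rw [lintegral_const_mul' _ _ ENNReal.ofReal_ne_top]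
        · exact ((hrp.comp measurable_snd).mul (hmc.pow_const q)).aemeasurable
    _ ≤ c * ∫⁻ s in Ioi 0, K * (stripMeasure u {z | s < (f (z.1 + z.2) : ℝ)} *
          ENNReal.ofReal (s ^ (p - 1))) := by
        gcongr c * ?_
        refine lintegral_mono fun s => ?_
        calc _ ≤ ENNReal.ofReal (s ^ (p - 1)) *
              (K * stripMeasure u {z | s < (f (z.1 + z.2) : ℝ)}) := by
              gcongr ENNReal.ofReal (s ^ (p - 1)) * ?_
              refine (hK _ (levelLength_mem_Icc f s) (antitone_levelLength hshift s)).trans ?_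
              gcongr K * ?_
              exact hlevel s
          _ = _ := by ring
    _ = _ := by
        rw [lintegral_const_mul' _ _ hKt, hlayer, mul_assoc, mul_assoc,
          ← mul_assoc (ENNReal.ofReal p)⁻¹, ENNReal.inv_mul_cancel hp' ENNReal.ofReal_ne_top,
          one_mul]

section SawtoothIndicator

/-- The indicator function of `⋃ n, (n, n + a n)`. -/
noncomputable def sawtoothIndicator (a : ℕ → ℝ) (x : ℝ) : ℝ≥0 :=
  {x : ℝ | 0 < Int.fract x ∧ Int.fract x < a ⌊x⌋₊}.indicator 1 x

variable {a : ℕ → ℝ}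

lemma measurable_sawtoothIndicator (a : ℕ → ℝ) : Measurable (sawtoothIndicator a) := by
  refine measurable_one.indicator ?_
  exact (measurableSet_lt measurable_const measurable_fract).inter
    (measurableSet_lt measurable_fract ((measurable_of_countable a).comp Nat.measurable_floor))

lemma sawtoothIndicator_natCast_add (a : ℕ → ℝ) (n : ℕ) {t : ℝ} (ht : t ∈ Ioo (0 : ℝ) 1) :
    sawtoothIndicator a (n + t) = if t < a n then 1 else 0 := by
  have h1 : Int.fract ((n : ℝ) + t) = t := by
    rw [Int.fract_natCast_add, Int.fract_eq_self.2 ⟨ht.1.le, ht.2⟩]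
  have h2 : ⌊(n : ℝ) + t⌋₊ = n := by
    rw [Nat.floor_eq_iff (add_nonneg n.cast_nonneg ht.1.le)]
    constructor <;> linarith [ht.1, ht.2]
  simp only [sawtoothIndicator, indicator, mem_ofPred_eq, h1, h2, ht.1, true_and, Pi.one_apply]

lemma sawtoothIndicator_le_of_le (a : ℕ → ℝ) (n : ℕ) (x y : ℝ) (hx : (n : ℝ) < x) (hxy : x ≤ y)
    (hy : y < (n : ℝ) + 1) : sawtoothIndicator a y ≤ sawtoothIndicator a x := by
  have h1 := sawtoothIndicator_natCast_add a n (t := x - n) ⟨by linarith, by linarith⟩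
  have h2 := sawtoothIndicator_natCast_add a n (t := y - n) ⟨by linarith, by linarith⟩
  rw [add_sub_cancel] at h1 h2
  rw [h1, h2]
  split_ifs with h3 h4
  · exact le_rfl
  · exact absurd (lt_of_le_of_lt (by linarith) h3) h4
  · exact zero_le
  · exact le_rfl

lemma sawtoothIndicator_add_one_le (ha : Antitone a) {x : ℝ} (hx : 0 < x) :
    sawtoothIndicator a (x + 1) ≤ sawtoothIndicator a x := by
  have h1 : ⌊x + 1⌋₊ = ⌊x⌋₊ + 1 := Nat.floor_add_one hx.le
  simp only [sawtoothIndicator, indicator, mem_ofPred_eq, Int.fract_add_one, h1, Pi.one_apply]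
  split_ifs with h2 h3
  · exact le_rfl
  · exact absurd ⟨h2.1, h2.2.trans_le (ha (Nat.le_succ _))⟩ h3
  · exact zero_le
  · exact le_rfl

lemma ofReal_div_le_Sblack_sawtoothIndicator (n : ℕ) {t : ℝ} (ht : t ∈ Ioo (0 : ℝ) 1)
    (hat : a n < t) : ENNReal.ofReal (a n / t) ≤ Sblack (sawtoothIndicator a) (n + t) := by
  rw [Sblack_natCast_add _ n ht, ENNReal.ofReal_div_of_pos ht.1]
  gcongr
  calc ENNReal.ofReal (a n) = ∫⁻ x in Ioo 0 (a n), 1 := by simp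
    _ = ∫⁻ x in Ioo 0 (a n), (sawtoothIndicator a (n + x) : ℝ≥0∞) := by
        refine setLIntegral_congr_fun measurableSet_Ioo fun x hx => ?_
        rw [sawtoothIndicator_natCast_add a n ⟨hx.1, hx.2.trans (hat.trans ht.2)⟩, if_pos hx.2]
        simp
    _ ≤ _ := lintegral_mono_set (show Ioo 0 (a n) ⊆ Ioc 0 t from
        fun x hx => ⟨hx.1, (hx.2.trans hat).le⟩)

lemma sequences_bound_of_Sblack {u : ℝ → ℝ≥0} (hu : Measurable u) {p : ℝ} (hp : 0 < p)
    {C : ℝ≥0∞} (ha : ∀ n, a n ∈ Icc (0 : ℝ) 1)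
    (hC : ∫⁻ x in Ioi (0 : ℝ), Sblack (sawtoothIndicator a) x ^ p * (u x : ℝ≥0∞) ≤
      C * ∫⁻ x in Ioi (0 : ℝ), (sawtoothIndicator a x : ℝ≥0∞) ^ p * (u x : ℝ≥0∞)) :
    ∑' n : ℕ, ∫⁻ t in Ioc (a n) 1,
        ENNReal.ofReal ((a n / t) ^ p) * (u ((n : ℝ) + t) : ℝ≥0∞) ≤
      C * ∑' n : ℕ, ∫⁻ t in Ioc (0 : ℝ) (a n), (u ((n : ℝ) + t) : ℝ≥0∞) := by
  have hm := measurable_sawtoothIndicator a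
  have hg : Measurable fun z : ℕ × ℝ => ENNReal.ofReal ((a z.1 / z.2) ^ p) :=
    ((((measurable_of_countable a).comp measurable_fst).div measurable_snd).pow_const
      p).ennreal_ofReal
  rw [setLIntegral_Ioi_mul_eq_lintegral_stripMeasure hu ((measurable_Sblack hm).pow_const p),
    setLIntegral_Ioi_mul_eq_lintegral_stripMeasure hu
      (hm.coe_nnreal_ennreal.pow_const p)] at hC
  rw [← stripMeasure_snd_le hu ha, ← setLIntegral_stripMeasure_lt_snd hu ha hg]
  refine le_trans (le_trans ?_ (setLIntegral_le_lintegral {z | z.2 ≤ a z.1}ᶜ _)) (hC.trans ?_)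
  · refine lintegral_mono_ae ?_
    filter_upwards [ae_restrict_of_ae ae_stripMeasure_mem_Ioo,
      ae_restrict_mem (measurableSet_snd_le a).compl] with z hz hza
    rw [← ENNReal.ofReal_rpow_of_nonneg (div_nonneg (ha _).1 hz.1.le) hp.le]
    exact ENNReal.rpow_le_rpow
      (ofReal_div_le_Sblack_sawtoothIndicator z.1 hz (not_le.1 hza)) hp.le
  · gcongr C * ?_
    rw [← lintegral_indicator_one (measurableSet_snd_le a)]
    refine lintegral_mono_ae ?_
    filter_upwards [ae_stripMeasure_mem_Ioo] with z hz
    rw [sawtoothIndicator_natCast_add a z.1 hz]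
    split_ifs with h
    · rw [indicator_of_mem (show z ∈ {z : ℕ × ℝ | z.2 ≤ a z.1} from h.le)]
      simp
    · simp [hp]

end SawtoothIndicator


/-- `S_◁` is bounded in `L^p(u)` on functions decreasing on each interval
`(n,n+1)` and satisfying `f(x) ≥ f(x+1)` if and only if for every decreasing sequence
`(a_n) ⊆ [0,1]`, `∑_n ∫_{a_n}^1 (a_n/t)^p u(n+t) dt ≤ C ∑_n ∫_0^{a_n} u(n+t) dt`. -/
theorem stmt7 (u : ℝ → ℝ≥0) (hu : Measurable u)
    (hloc : MeasureTheory.LocallyIntegrableOn (fun t => (u t : ℝ)) (Set.Ioi 0))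
    (p : ℝ) (hp : 0 < p) :
    (∃ C : ℝ, 0 < C ∧ ∀ f : ℝ → ℝ≥0, Measurable f →
        (∀ n : ℕ, ∀ x y : ℝ, (n : ℝ) < x → x ≤ y → y < (n : ℝ) + 1 → f y ≤ f x) →
        (∀ x : ℝ, 0 < x → f (x + 1) ≤ f x) →
        ∫⁻ x in Set.Ioi (0 : ℝ), Sblack f x ^ p * (u x : ℝ≥0∞) ≤
          ENNReal.ofReal C * ∫⁻ x in Set.Ioi (0 : ℝ), (f x : ℝ≥0∞) ^ p * (u x : ℝ≥0∞)) ↔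
      (∃ C : ℝ, 0 < C ∧ ∀ a : ℕ → ℝ, (∀ n, a n ∈ Set.Icc (0 : ℝ) 1) → Antitone a →
        ∑' n : ℕ, ∫⁻ t in Set.Ioc (a n) 1,
            ENNReal.ofReal ((a n / t) ^ p) * (u ((n : ℝ) + t) : ℝ≥0∞) ≤
          ENNReal.ofReal C *
            ∑' n : ℕ, ∫⁻ t in Set.Ioc (0 : ℝ) (a n), (u ((n : ℝ) + t) : ℝ≥0∞)) := by
  constructor
  · rintro ⟨C, hC, h⟩
    refine ⟨C, hC, fun a ha ha' => sequences_bound_of_Sblack hu hp ha ?_⟩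
    exact h _ (measurable_sawtoothIndicator a) (sawtoothIndicator_le_of_le a)
      fun x hx => sawtoothIndicator_add_one_le ha' hx
  · rintro ⟨C, -, h⟩
    obtain ⟨K, hKt, hK⟩ := exists_Sblack_bound hu hp
      (ENNReal.add_ne_top.2 ⟨ENNReal.one_ne_top, ENNReal.ofReal_ne_top (r := C)⟩)
      fun a ha ha' => cutoff_rpow_bound_of_sequences hu hp ha (h a ha ha')
    refine ⟨K.toReal + 1, by positivity, fun f hf hmono hshift => ?_⟩
    refine (hK f hf hmono hshift).trans ?_
    gcongr
    rw [← ENNReal.ofReal_toReal hKt]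
    exact ENNReal.ofReal_le_ofReal (by rw [ENNReal.ofReal_toReal hKt]; linarith)
end

section
/- There exists C > 0 such that ∫₀^∞ (S_◁ f)^p(x) u(x) dx ≤ C ∫₀^∞ f^p(x) u(x) dx for every nonnegative decreasing measurable f on (0,∞), if and only if there exists C > 0 such that for every n ∈ ℕ ∪ {0} and every a ∈ [0,1], ∫_a^1 (a/t)^p u(n+t) dt ≤ C ∫_0^{n+a} u(t) dt. -/
open MeasureTheory Set
open scoped ENNReal NNReal

theorem setLIntegral_Ioc_affine (F : ℝ → ℝ≥0∞) (m a b : ℝ) {r : ℝ} (hr : 0 < r) :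
    ∫⁻ t in Ioc (m + r * a) (m + r * b), F t =
      ENNReal.ofReal r * ∫⁻ s in Ioc a b, F (m + r * s) := by
  have himg : (fun s : ℝ => m + r * s) '' Ioc a b = Ioc (m + r * a) (m + r * b) := by
    have h1 : (fun s : ℝ => m + r * s) '' Ioc a b
        = (fun s => m + s) '' ((fun s => r * s) '' Ioc a b) := by
      rw [image_image]
    rw [h1, image_mul_left_Ioc hr, image_const_add_Ioc]
  have hd : ∀ x ∈ Ioc a b, HasDerivWithinAt (fun s : ℝ => m + r * s) r (Ioc a b) x := by
    intro x _
    simpa using (((hasDerivAt_id x).const_mul r).const_add m).hasDerivWithinAt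
  have hinj : InjOn (fun s : ℝ => m + r * s) (Ioc a b) := by
    intro x _ y _ hxy
    simpa [hr.ne'] using hxy
  rw [← himg, lintegral_image_eq_lintegral_abs_deriv_mul measurableSet_Ioc hd hinj F,
    abs_of_pos hr, lintegral_const_mul' _ _ ENNReal.ofReal_ne_top]

theorem measure_le_of_initial_segments {μ ν : Measure ℝ} {c : ℝ≥0∞}
    (h : ∀ s : ℝ, 0 < s → μ (Ioc 0 s) ≤ c * ν (Ioc 0 s)) {A : Set ℝ} (hA0 : A ⊆ Ioi 0)
    (hA : ∀ x y : ℝ, 0 < x → x ≤ y → y ∈ A → x ∈ A) : μ A ≤ c * ν A := by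
  have hsub : ∀ s ∈ A, Ioc 0 s ⊆ A := fun s hs x hx => hA x s hx.1 hx.2 hs
  by_cases hmax : ∃ s ∈ A, ∀ x ∈ A, x ≤ s
  · obtain ⟨s, hs, hmax⟩ := hmax
    have : A = Ioc 0 s :=
      Subset.antisymm (fun x hx => ⟨hA0 hx, hmax x hx⟩) (hsub s hs)
    rw [this]
    exact h s (hA0 hs)
  · push Not at hmax
    set T : Set ℚ := {q | (q : ℝ) ∈ A} with hT
    have hAU : A = ⋃ q ∈ T, Ioc (0 : ℝ) q := by
      apply Subset.antisymm
      · intro x hx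
        obtain ⟨y, hy, hxy⟩ := hmax x hx
        obtain ⟨q, hq1, hq2⟩ := exists_rat_btwn hxy
        have hqA : q ∈ T := hA q y ((hA0 hx).trans hq1) hq2.le hy
        exact mem_biUnion hqA ⟨hA0 hx, hq1.le⟩
      · exact iUnion₂_subset fun q hq => hsub q hq
    have hdir : DirectedOn (Function.onFun (· ⊆ ·) fun q : ℚ => Ioc (0 : ℝ) q) T := by
      intro q hq r hr
      rcases le_total q r with hqr | hqr
      · exact ⟨r, hr, Ioc_subset_Ioc_right (by exact_mod_cast hqr), Subset.rfl⟩
      · exact ⟨q, hq, Subset.rfl, Ioc_subset_Ioc_right (by exact_mod_cast hqr)⟩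
    conv_lhs => rw [hAU]
    rw [measure_biUnion_eq_iSup (to_countable T) hdir]
    refine iSup₂_le fun q hq => (h q (hA0 hq)).trans ?_
    gcongr
    exact hsub q hq

theorem setLIntegral_le_of_initial_segments {μ ν : Measure ℝ} {c : ℝ≥0∞} (hc : c ≠ ∞)
    (h : ∀ s : ℝ, 0 < s → μ (Ioc 0 s) ≤ c * ν (Ioc 0 s)) {g : ℝ → ℝ≥0∞} (hg : Measurable g)
    (hfin : ∀ x, g x ≠ ∞) (hmono : ∀ x y : ℝ, 0 < x → x ≤ y → g y ≤ g x) :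
    ∫⁻ x in Ioi 0, g x ∂μ ≤ c * ∫⁻ x in Ioi 0, g x ∂ν := by
  have key : ∀ κ : Measure ℝ, ∫⁻ x in Ioi 0, g x ∂κ
      = ∫⁻ t in Ioi (0 : ℝ), κ ({x | t < (g x).toReal} ∩ Ioi 0) := by
    intro κ
    have h1 := lintegral_eq_lintegral_meas_lt (f := fun x => (g x).toReal)
      (κ.restrict (Ioi 0)) (Filter.Eventually.of_forall fun _ => ENNReal.toReal_nonneg)
      hg.ennreal_toReal.aemeasurable
    simp only [ENNReal.ofReal_toReal (hfin _)] at h1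
    rw [h1]
    refine lintegral_congr fun t => ?_
    rw [Measure.restrict_apply (measurableSet_lt measurable_const hg.ennreal_toReal)]
  rw [key μ, key ν, ← lintegral_const_mul' _ _ hc]
  refine lintegral_mono fun t => measure_le_of_initial_segments h inter_subset_right ?_
  rintro x y hx hxy ⟨hy, -⟩
  exact ⟨lt_of_lt_of_le hy (ENNReal.toReal_mono (hfin x) (hmono x y hx hxy)), hx⟩

theorem setLIntegral_Ioc_rpow {p b : ℝ} (hp : 0 < p) (hb : 0 ≤ b) :
    ∫⁻ s in Ioc 0 b, ENNReal.ofReal (s ^ (p - 1)) = ENNReal.ofReal (b ^ p / p) := by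
  have hint : IntervalIntegrable (fun s : ℝ => s ^ (p - 1)) volume 0 b :=
    intervalIntegral.intervalIntegrable_rpow' (by linarith)
  rw [← ofReal_integral_eq_lintegral_ofReal
    ((intervalIntegrable_iff_integrableOn_Ioc_of_le hb).1 hint),
    ← intervalIntegral.integral_of_le hb, integral_rpow (Or.inl (by linarith))]
  · simp [Real.zero_rpow hp.ne']
  · exact (ae_restrict_iff' measurableSet_Ioc).2
      (Filter.Eventually.of_forall fun s hs => Real.rpow_nonneg hs.1.le _)

theorem rpow_lintegral_le_of_le_one {p : ℝ} (hp : 0 < p) (hp1 : p ≤ 1) {h : ℝ → ℝ≥0∞}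
    {k : ℝ≥0∞} (hk : k ≠ ∞) (hle : ∀ s, h s ≤ k)
    (hmono : ∀ x y : ℝ, 0 < x → x ≤ y → h y ≤ h x) :
    (∫⁻ s in Ioc (0 : ℝ) 1, h s) ^ p ≤
      ∫⁻ s in Ioc (0 : ℝ) 1, ENNReal.ofReal (s ^ (p - 1)) * h s ^ p := by
  set H := ∫⁻ s in Ioc (0 : ℝ) 1, h s with hH
  have hHfin : H ≠ ∞ := by
    refine ne_top_of_le_ne_top hk ((lintegral_mono hle).trans ?_)
    simp
  rcases eq_or_ne H 0 with h0 | h0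
  · rw [h0, ENNReal.zero_rpow_of_pos hp]
    exact zero_le
  have hpt : ∀ s ∈ Ioc (0 : ℝ) 1, h s ≤
      H ^ (1 - p) * (ENNReal.ofReal (s ^ (p - 1)) * h s ^ p) := by
    intro s hs
    have h1 : ENNReal.ofReal s * h s ≤ H := by
      calc ENNReal.ofReal s * h s = ∫⁻ _ in Ioc (0 : ℝ) s, h s := by simp [mul_comm]
        _ ≤ ∫⁻ t in Ioc (0 : ℝ) s, h t :=
            setLIntegral_mono' measurableSet_Ioc fun t ht => hmono t s ht.1 ht.2
        _ ≤ H := lintegral_mono_set (Ioc_subset_Ioc_right hs.2)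
    have hs0 : ENNReal.ofReal s ≠ 0 := by simpa using hs.1
    rcases eq_or_ne (h s) 0 with hz | hz
    · rw [hz]; exact zero_le
    have hfin : h s ≠ ∞ := ne_top_of_le_ne_top hk (hle s)
    calc h s = (ENNReal.ofReal s * h s) ^ (1 - p) * (ENNReal.ofReal (s ^ (p - 1)) * h s ^ p) := by
          rw [ENNReal.mul_rpow_of_nonneg _ _ (by linarith), ← ENNReal.ofReal_rpow_of_pos hs.1,
            mul_mul_mul_comm, ← ENNReal.rpow_add _ _ hs0 ENNReal.ofReal_ne_top,
            ← ENNReal.rpow_add _ _ hz hfin]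
          simp
      _ ≤ _ := by gcongr
  have hle2 : H ≤ H ^ (1 - p) *
      ∫⁻ s in Ioc (0 : ℝ) 1, ENNReal.ofReal (s ^ (p - 1)) * h s ^ p := by
    rw [← lintegral_const_mul' _ _ (ENNReal.rpow_ne_top_of_nonneg (by linarith) hHfin)]
    exact setLIntegral_mono' measurableSet_Ioc hpt
  calc H ^ p = H ^ (p - 1) * H := by
        conv_rhs => rw [← ENNReal.rpow_one H, ← ENNReal.rpow_mul]
        rw [one_mul, ← ENNReal.rpow_add _ _ h0 hHfin]
        simp
    _ ≤ H ^ (p - 1) * (H ^ (1 - p) * _) := by gcongr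
    _ = _ := by
        rw [← mul_assoc, ← ENNReal.rpow_add _ _ h0 hHfin]
        simp

theorem rpow_lintegral_le_of_one_le {p : ℝ} (hp1 : 1 ≤ p) {h : ℝ → ℝ≥0∞}
    (hm : Measurable h) {k : ℝ≥0∞} (hk : k ≠ ∞) (hle : ∀ s, h s ≤ k) :
    (∫⁻ s in Ioc (0 : ℝ) 1, h s) ^ p ≤
      2 ^ p * ∫⁻ s in Ioc (0 : ℝ) 1, ENNReal.ofReal (s ^ (p - 1)) *
        (h s * (∫⁻ r in Ioc (0 : ℝ) 1, h (s * r)) ^ (p - 1)) := by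
  have hfin : ∀ s, h s ≠ ∞ := fun s => ne_top_of_le_ne_top hk (hle s)
  set H : ℝ → ℝ≥0∞ := fun b => ∫⁻ s in Ioc (0 : ℝ) b, h s with hH
  have hint : ∀ a b, IntervalIntegrable (fun s => (h s).toReal) volume a b := by
    intro a b
    refine (intervalIntegrable_const (c := k.toReal)).mono_fun
      hm.ennreal_toReal.aestronglyMeasurable (Filter.Eventually.of_forall fun s => ?_)
    simpa using ENNReal.toReal_mono hk (hle s)
  have hHreal : ∀ b, 0 ≤ b → H b = ENNReal.ofReal (∫ s in (0 : ℝ)..b, (h s).toReal) := by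
    intro b hb
    rw [intervalIntegral.integral_of_le hb, ofReal_integral_eq_lintegral_ofReal
      ((intervalIntegrable_iff_integrableOn_Ioc_of_le hb).1 (hint 0 b))
      (Filter.Eventually.of_forall fun _ => ENNReal.toReal_nonneg)]
    simp only [ENNReal.ofReal_toReal (hfin _), hH]
  obtain ⟨t, ht, hteq⟩ : ∃ t ∈ Icc (0 : ℝ) 1, H t = H 1 / 2 := by
    have hcont := (intervalIntegral.continuous_primitive hint 0).continuousOn (s := Icc 0 1)
    have h1 : 0 ≤ ∫ s in (0 : ℝ)..1, (h s).toReal :=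
      intervalIntegral.integral_nonneg zero_le_one fun _ _ => ENNReal.toReal_nonneg
    obtain ⟨t, ht, hte⟩ := intermediate_value_Icc zero_le_one hcont
      (show (∫ s in (0 : ℝ)..1, (h s).toReal) / 2 ∈ _ by
        rw [intervalIntegral.integral_same]
        constructor <;> linarith)
    refine ⟨t, ht, ?_⟩
    have hte' : ∫ s in (0 : ℝ)..t, (h s).toReal = _ := hte
    rw [hHreal t ht.1, hte', hHreal 1 zero_le_one, ENNReal.ofReal_div_of_pos two_pos]
    simp
  have hH1 : H 1 ≠ ∞ := by rw [hHreal 1 zero_le_one]; exact ENNReal.ofReal_ne_top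
  have hscale : ∀ s ∈ Ioc (0 : ℝ) 1, ENNReal.ofReal (s ^ (p - 1)) *
        (h s * (∫⁻ r in Ioc (0 : ℝ) 1, h (s * r)) ^ (p - 1)) = h s * H s ^ (p - 1) := by
    intro s hs
    have := setLIntegral_Ioc_affine h 0 0 1 hs.1
    simp only [zero_add, mul_zero, mul_one] at this
    simp only [hH]
    rw [this, ENNReal.mul_rpow_of_nonneg _ _ (by linarith), ← ENNReal.ofReal_rpow_of_pos hs.1]
    ring
  have htail : ∫⁻ s in Ioc t 1, h s = H 1 / 2 := by
    have hsplit : H 1 = H t + ∫⁻ s in Ioc t 1, h s := by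
      simp only [hH]
      rw [← Ioc_union_Ioc_eq_Ioc ht.1 ht.2,
        lintegral_union measurableSet_Ioc (Ioc_disjoint_Ioc_of_le le_rfl)]
    have hhalf : H 1 = H 1 / 2 + H 1 / 2 := (ENNReal.add_halves _).symm
    rw [hteq] at hsplit
    exact (ENNReal.add_right_inj (ENNReal.div_ne_top hH1 two_ne_zero)).1 (hsplit.symm.trans hhalf)
  rw [setLIntegral_congr_fun measurableSet_Ioc hscale]
  calc H 1 ^ p = 2 ^ p * (H 1 / 2) ^ p := by
        rw [← ENNReal.mul_rpow_of_nonneg _ _ (by linarith),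
          ENNReal.mul_div_cancel two_ne_zero ENNReal.ofNat_ne_top]
    _ = 2 ^ p * ((H 1 / 2) * (H 1 / 2) ^ (p - 1)) := by
        congr 1
        conv_rhs => enter [1]; rw [← ENNReal.rpow_one (H 1 / 2)]
        rw [← ENNReal.rpow_add_of_nonneg _ _ zero_le_one (by linarith)]
        simp
    _ = 2 ^ p * ∫⁻ s in Ioc t 1, h s * (H 1 / 2) ^ (p - 1) := by
        rw [lintegral_mul_const _ hm, htail]
    _ ≤ 2 ^ p * ∫⁻ s in Ioc t 1, h s * H s ^ (p - 1) := by
        gcongr 2 ^ p * ?_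
        refine setLIntegral_mono' measurableSet_Ioc fun s hs => ?_
        gcongr h s * ?_
        refine ENNReal.rpow_le_rpow ?_ (by linarith)
        rw [← hteq]
        exact lintegral_mono_set (Ioc_subset_Ioc_right hs.1.le)
    _ ≤ 2 ^ p * ∫⁻ s in Ioc (0 : ℝ) 1, h s * H s ^ (p - 1) := by
        gcongr 2 ^ p * ?_
        exact lintegral_mono_set (Ioc_subset_Ioc_left ht.1)

/-- The point dividing the segment from the left end-point of the cell `(⌈x⌉ - 1, ⌈x⌉]` to `x`
in the ratio `s`. -/
noncomputable def cellPoint (x s : ℝ) : ℝ := ((⌈x⌉ : ℝ) - 1) + (x - ((⌈x⌉ : ℝ) - 1)) * s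

theorem cell_length_pos (x : ℝ) : 0 < x - ((⌈x⌉ : ℝ) - 1) := by
  linarith [Int.ceil_lt_add_one x]

theorem cell_left_nonneg {x : ℝ} (hx : 0 < x) : 0 ≤ (⌈x⌉ : ℝ) - 1 := by
  have : (1 : ℝ) ≤ ⌈x⌉ := by exact_mod_cast Int.one_le_ceil_iff.2 hx
  linarith

theorem cell_left_lt_cellPoint (x : ℝ) {s : ℝ} (hs : 0 < s) :
    (⌈x⌉ : ℝ) - 1 < cellPoint x s := by
  have := mul_pos (cell_length_pos x) hs
  unfold cellPoint
  linarith

theorem cellPoint_pos {x s : ℝ} (hx : 0 < x) (hs : 0 < s) : 0 < cellPoint x s :=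
  (cell_left_nonneg hx).trans_lt (cell_left_lt_cellPoint x hs)

theorem cellPoint_le (x : ℝ) {s : ℝ} (hs : s ≤ 1) : cellPoint x s ≤ x := by
  have := mul_le_mul_of_nonneg_left hs (cell_length_pos x).le
  unfold cellPoint
  linarith

theorem cellPoint_mono {x y s : ℝ} (hxy : x ≤ y) (hs0 : 0 < s) (hs1 : s ≤ 1) :
    cellPoint x s ≤ cellPoint y s := by
  rcases (Int.ceil_mono hxy).eq_or_lt with h | h
  · unfold cellPoint
    rw [h]
    gcongr
  · have h' : (⌈x⌉ : ℝ) ≤ ⌈y⌉ - 1 := by exact_mod_cast Int.le_sub_one_of_lt h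
    exact ((cellPoint_le x hs1).trans (Int.le_ceil x)).trans
      (h'.trans (cell_left_lt_cellPoint y hs0).le)

theorem cellPoint_cellPoint (x r : ℝ) {s : ℝ} (hs0 : 0 < s) (hs1 : s ≤ 1) :
    cellPoint (cellPoint x s) r = cellPoint x (s * r) := by
  have h : ⌈cellPoint x s⌉ = ⌈x⌉ :=
    Int.ceil_eq_iff.2 ⟨cell_left_lt_cellPoint x hs0, (cellPoint_le x hs1).trans (Int.le_ceil x)⟩
  rw [cellPoint, h]
  unfold cellPoint
  ring

theorem measurable_cellPoint : Measurable fun z : ℝ × ℝ => cellPoint z.1 z.2 := by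
  have : Measurable fun z : ℝ × ℝ => (⌈z.1⌉ : ℝ) :=
    (measurable_from_top (f := fun n : ℤ => (n : ℝ))).comp (Int.measurable_ceil.comp measurable_fst)
  unfold cellPoint
  fun_prop

theorem measurable_cellPoint_right (x : ℝ) : Measurable fun s => cellPoint x s := by
  unfold cellPoint
  fun_prop

/-- The average of `f` over the part of the cell `(⌈x⌉ - 1, ⌈x⌉]` to the left of `x`. -/
noncomputable def cellAverage (f : ℝ → ℝ≥0∞) (x : ℝ) : ℝ≥0∞ :=
  ∫⁻ s in Ioc (0 : ℝ) 1, f (cellPoint x s)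

theorem measurable_cellAverage {f : ℝ → ℝ≥0∞} (hf : Measurable f) :
    Measurable (cellAverage f) :=
  (hf.comp measurable_cellPoint).lintegral_prod_right'

theorem cellAverage_anti {f : ℝ → ℝ≥0∞} (hf : ∀ x y : ℝ, 0 < x → x ≤ y → f y ≤ f x)
    {x y : ℝ} (hx : 0 < x) (hxy : x ≤ y) : cellAverage f y ≤ cellAverage f x :=
  setLIntegral_mono' measurableSet_Ioc fun _ hs =>
    hf _ _ (cellPoint_pos hx hs.1) (cellPoint_mono hxy hs.1 hs.2)

theorem cellAverage_le {f : ℝ → ℝ≥0∞} {k : ℝ≥0∞} (hf : ∀ x, f x ≤ k) (x : ℝ) :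
    cellAverage f x ≤ k := by
  calc cellAverage f x ≤ ∫⁻ _ in Ioc (0 : ℝ) 1, k := lintegral_mono fun _ => hf _
    _ = k := by simp

theorem Sblack_eq_cellAverage (f : ℝ → ℝ≥0) {x : ℝ} (hx : x ∉ range ((↑) : ℤ → ℝ)) :
    Sblack f x = cellAverage (fun t => (f t : ℝ≥0∞)) x := by
  have hceil : ⌈x⌉ = ⌊x⌋ + 1 := by
    refine Int.ceil_eq_iff.2 ⟨?_, ?_⟩
    · push_cast
      have : (⌊x⌋ : ℝ) ≠ x := fun h => hx ⟨_, h⟩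
      linarith [lt_of_le_of_ne (Int.floor_le x) this]
    · push_cast
      exact (Int.lt_floor_add_one x).le
  have hm : (⌈x⌉ : ℝ) - 1 = ⌊x⌋ := by rw [hceil]; push_cast; ring
  have hlen := cell_length_pos x
  rw [hm] at hlen
  have h := setLIntegral_Ioc_affine (fun t => (f t : ℝ≥0∞)) ⌊x⌋ 0 1 hlen
  simp only [mul_zero, add_zero, mul_one, add_sub_cancel] at h
  unfold Sblack cellAverage cellPoint
  rw [h, hm, mul_comm, ENNReal.mul_div_cancel_right (by simpa using hlen) ENNReal.ofReal_ne_top]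

theorem ae_notMem_range_intCast : ∀ᵐ x : ℝ, x ∉ range ((↑) : ℤ → ℝ) :=
  (countable_range _).ae_notMem volume

/-- The measure `s ^ (p - 1) ds` on `(0, 1]`. -/
noncomputable def rpowMeasure (p : ℝ) : Measure ℝ :=
  (volume.restrict (Ioc 0 1)).withDensity fun s => ENNReal.ofReal (s ^ (p - 1))

instance (p : ℝ) : SFinite (rpowMeasure p) := by
  unfold rpowMeasure
  infer_instance

theorem lintegral_rpowMeasure (p : ℝ) {F : ℝ → ℝ≥0∞} (hF : Measurable F) :
    ∫⁻ s, F s ∂rpowMeasure p =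
      ∫⁻ s in Ioc (0 : ℝ) 1, ENNReal.ofReal (s ^ (p - 1)) * F s := by
  unfold rpowMeasure
  rw [lintegral_withDensity_eq_lintegral_mul _ (by fun_prop) hF]
  rfl

theorem ae_rpowMeasure_mem (p : ℝ) : ∀ᵐ s ∂rpowMeasure p, s ∈ Ioc (0 : ℝ) 1 :=
  (withDensity_absolutelyContinuous _ _).ae_le (ae_restrict_mem measurableSet_Ioc)

theorem rpowMeasure_Iic_le {p b : ℝ} (hp : 0 < p) (hb : 0 ≤ b) :
    rpowMeasure p (Iic b) ≤ ENNReal.ofReal (b ^ p / p) := by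
  unfold rpowMeasure
  rw [withDensity_apply _ measurableSet_Iic, Measure.restrict_restrict measurableSet_Iic,
    ← setLIntegral_Ioc_rpow hp hb]
  exact lintegral_mono_set fun s hs => ⟨hs.2.1, hs.1⟩

theorem rpowMeasure_univ_le {p : ℝ} (hp : 0 < p) :
    rpowMeasure p univ ≤ ENNReal.ofReal (1 / p) := by
  have h := rpowMeasure_Iic_le hp zero_le_one
  rw [Real.one_rpow] at h
  refine le_trans (measure_mono_ae ?_) h
  filter_upwards [ae_rpowMeasure_mem p] with s hs _ using hs.2

theorem rpowMeasure_cellPoint_le {p : ℝ} (hp : 0 < p) (x b : ℝ) :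
    rpowMeasure p {s | cellPoint x s ∈ Ioc 0 b} ≤ ENNReal.ofReal (1 / p) *
      ((Iic b).indicator 1 x + (Ioc b ⌈b⌉).indicator
        (fun y => ENNReal.ofReal (((b - (⌈b⌉ - 1)) / (y - (⌈b⌉ - 1))) ^ p)) x) := by
  rcases le_or_gt x b with hxb | hxb
  · calc _ ≤ rpowMeasure p univ := measure_mono (subset_univ _)
      _ ≤ ENNReal.ofReal (1 / p) * 1 := by rw [mul_one]; exact rpowMeasure_univ_le hp
      _ ≤ _ := by
        gcongr
        rw [indicator_of_mem (show x ∈ Iic b from hxb)]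
        exact le_self_add
  rcases le_or_gt x ⌈b⌉ with hxc | hxc
  · have hceil : ⌈x⌉ = ⌈b⌉ := by
      refine Int.ceil_eq_iff.2 ⟨?_, hxc⟩
      linarith [Int.ceil_lt_add_one b]
    have hlen := cell_length_pos x
    have hb' := cell_length_pos b
    rw [hceil] at hlen
    calc _ ≤ rpowMeasure p (Iic ((b - (⌈b⌉ - 1)) / (x - (⌈b⌉ - 1)))) := by
          refine measure_mono fun s hs => ?_
          have h2 : cellPoint x s ≤ b := hs.2
          unfold cellPoint at h2
          rw [hceil] at h2
          rw [mem_Iic, le_div_iff₀ hlen]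
          linarith
      _ ≤ _ := rpowMeasure_Iic_le hp (by positivity)
      _ = ENNReal.ofReal (1 / p) *
          ENNReal.ofReal (((b - (⌈b⌉ - 1)) / (x - (⌈b⌉ - 1))) ^ p) := by
          rw [← ENNReal.ofReal_mul (by positivity)]
          congr 1
          ring
      _ ≤ _ := by
        gcongr
        rw [indicator_of_mem (show x ∈ Ioc b ⌈b⌉ from ⟨hxb, hxc⟩)]
        exact le_add_self
  · have hz : rpowMeasure p {s | cellPoint x s ∈ Ioc 0 b} = 0 := by
      rw [measure_eq_zero_iff_ae_notMem]
      filter_upwards [ae_rpowMeasure_mem p] with s hs hmem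
      have h1 := cell_left_lt_cellPoint x hs.1
      have h2 : (⌈b⌉ : ℝ) ≤ ⌈x⌉ - 1 := by
        exact_mod_cast Int.le_sub_one_of_lt (Int.lt_ceil.2 hxc)
      exact absurd (hmem.2.trans (Int.le_ceil b)) (not_le.2 (h2.trans_lt h1))
    rw [hz]
    exact zero_le

/-- The push-forward of `u dx ⊗ s ^ (p - 1) ds` on `(0, ∞) × (0, 1]` under `cellPoint`. -/
noncomputable def cellMeasure (u : ℝ → ℝ≥0) (p : ℝ) : Measure ℝ :=
  ((((volume.withDensity fun x => (u x : ℝ≥0∞)).restrict (Ioi 0)).prod (rpowMeasure p)).map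
    fun z => cellPoint z.1 z.2)

theorem lintegral_cellMeasure {u : ℝ → ℝ≥0} (p : ℝ) {g : ℝ → ℝ≥0∞}
    (hg : Measurable g) :
    ∫⁻ y, g y ∂cellMeasure u p =
      ∫⁻ x in Ioi 0, ∫⁻ s, g (cellPoint x s) ∂rpowMeasure p
        ∂(volume.withDensity fun x => (u x : ℝ≥0∞)) := by
  unfold cellMeasure
  rw [lintegral_map hg measurable_cellPoint]
  exact lintegral_prod _ (hg.comp measurable_cellPoint).aemeasurable

theorem cellMeasure_Ioc_le {u : ℝ → ℝ≥0} (hu : Measurable u) {p C : ℝ} (hp : 0 < p)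
    (hC0 : 0 < C)
    (hC : ∀ n : ℕ, ∀ a ∈ Icc (0 : ℝ) 1,
      ∫⁻ t in Ioc a 1, ENNReal.ofReal ((a / t) ^ p) * (u ((n : ℝ) + t) : ℝ≥0∞) ≤
        ENNReal.ofReal C * ∫⁻ t in Ioc (0 : ℝ) ((n : ℝ) + a), (u t : ℝ≥0∞))
    {b : ℝ} (hb : 0 < b) :
    cellMeasure u p (Ioc 0 b) ≤ ENNReal.ofReal ((1 + C) / p) *
      (volume.withDensity fun x => (u x : ℝ≥0∞)) (Ioc 0 b) := by
  set ν := volume.withDensity fun x => (u x : ℝ≥0∞) with hν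
  have hum : Measurable fun x => (u x : ℝ≥0∞) := hu.coe_nnreal_ennreal
  obtain ⟨n, hn⟩ : ∃ n : ℕ, (n : ℝ) = ⌈b⌉ - 1 := by
    refine ⟨(⌈b⌉ - 1).toNat, ?_⟩
    have h : 0 ≤ ⌈b⌉ - 1 := by linarith [Int.one_le_ceil_iff.2 hb]
    have h' : (((⌈b⌉ - 1).toNat : ℤ) : ℝ) = ((⌈b⌉ - 1 : ℤ) : ℝ) := by rw [Int.toNat_of_nonneg h]
    push_cast at h'
    exact h'
  have hrm : Measurable fun y : ℝ =>
      ENNReal.ofReal (((b - (⌈b⌉ - 1)) / (y - (⌈b⌉ - 1))) ^ p) := by fun_prop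
  have htail : ∫⁻ x in Ioc b ⌈b⌉,
      ENNReal.ofReal (((b - (⌈b⌉ - 1)) / (x - (⌈b⌉ - 1))) ^ p) ∂ν
        ≤ ENNReal.ofReal C * ν (Ioc 0 b) := by
    have ha : b - n ∈ Icc (0 : ℝ) 1 := by
      rw [hn]
      exact ⟨(cell_length_pos b).le, by linarith [Int.le_ceil b]⟩
    have h1 := hC n (b - n) ha
    have h2 := setLIntegral_Ioc_affine
      (fun x => ENNReal.ofReal (((b - n) / (x - n)) ^ p) * (u x : ℝ≥0∞)) n (b - n) 1 one_pos
    have h3 : (n : ℝ) + 1 = ⌈b⌉ := by rw [hn]; ring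
    simp only [one_mul, add_sub_cancel, add_sub_cancel_left, ENNReal.ofReal_one, h3] at h1 h2
    rw [hν, restrict_withDensity measurableSet_Ioc,
      lintegral_withDensity_eq_lintegral_mul _ hum hrm, withDensity_apply _ measurableSet_Ioc]
    refine le_trans (le_of_eq ?_) h1
    rw [← h2, hn]
    simp only [Pi.mul_apply, mul_comm]
  have hmeas : cellMeasure u p (Ioc 0 b) =
      ∫⁻ x in Ioi 0, rpowMeasure p {s | cellPoint x s ∈ Ioc 0 b} ∂ν := by
    rw [cellMeasure, Measure.map_apply measurable_cellPoint measurableSet_Ioc,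
      Measure.prod_apply (measurable_cellPoint measurableSet_Ioc)]
    rfl
  rw [hmeas]
  calc _ ≤ ∫⁻ x in Ioi 0, ENNReal.ofReal (1 / p) *
        ((Iic b).indicator 1 x + (Ioc b ⌈b⌉).indicator
          (fun y => ENNReal.ofReal (((b - (⌈b⌉ - 1)) / (y - (⌈b⌉ - 1))) ^ p)) x) ∂ν :=
        lintegral_mono fun x => rpowMeasure_cellPoint_le hp x b
    _ ≤ ENNReal.ofReal (1 / p) * (ν (Ioc 0 b) + ENNReal.ofReal C * ν (Ioc 0 b)) := by
        rw [lintegral_const_mul' _ _ ENNReal.ofReal_ne_top,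
          lintegral_add_left (measurable_one.indicator measurableSet_Iic)]
        gcongr ENNReal.ofReal (1 / p) * (?_ + ?_)
        · rw [lintegral_indicator_one measurableSet_Iic,
            Measure.restrict_apply measurableSet_Iic]
          exact measure_mono fun x hx => ⟨hx.2, hx.1⟩
        · refine (setLIntegral_le_lintegral _ _).trans ?_
          rw [lintegral_indicator measurableSet_Ioc]
          exact htail
    _ = _ := by
        rw [div_eq_mul_one_div (1 + C), mul_comm (1 + C), ENNReal.ofReal_mul (by positivity),
          ENNReal.ofReal_add zero_le_one hC0.le, ENNReal.ofReal_one]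
        ring

theorem lintegral_rpowMeasure_cellPoint_le {u : ℝ → ℝ≥0} (hu : Measurable u) {p C : ℝ}
    (hp : 0 < p) (hC0 : 0 < C)
    (hC : ∀ n : ℕ, ∀ a ∈ Icc (0 : ℝ) 1,
      ∫⁻ t in Ioc a 1, ENNReal.ofReal ((a / t) ^ p) * (u ((n : ℝ) + t) : ℝ≥0∞) ≤
        ENNReal.ofReal C * ∫⁻ t in Ioc (0 : ℝ) ((n : ℝ) + a), (u t : ℝ≥0∞))
    {g : ℝ → ℝ≥0∞} (hg : Measurable g) (hfin : ∀ x, g x ≠ ∞)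
    (hmono : ∀ x y : ℝ, 0 < x → x ≤ y → g y ≤ g x) :
    ∫⁻ x in Ioi 0, (∫⁻ s in Ioc (0 : ℝ) 1, ENNReal.ofReal (s ^ (p - 1)) * g (cellPoint x s))
        ∂(volume.withDensity fun x => (u x : ℝ≥0∞)) ≤
      ENNReal.ofReal ((1 + C) / p) *
        ∫⁻ x in Ioi 0, g x ∂(volume.withDensity fun x => (u x : ℝ≥0∞)) := by
  refine le_trans (le_of_eq ?_) (setLIntegral_le_of_initial_segments ENNReal.ofReal_ne_top
    (fun s hs => cellMeasure_Ioc_le hu hp hC0 hC hs) hg hfin hmono)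
  rw [← lintegral_indicator (μ := cellMeasure u p) measurableSet_Ioi,
    lintegral_cellMeasure p (hg.indicator measurableSet_Ioi)]
  refine setLIntegral_congr_fun measurableSet_Ioi fun x hx => ?_
  refine (lintegral_rpowMeasure p (hg.comp (measurable_cellPoint_right x))).symm.trans ?_
  refine lintegral_congr_ae ?_
  filter_upwards [ae_rpowMeasure_mem p] with s hs
  rw [indicator_of_mem (show cellPoint x s ∈ Ioi 0 from cellPoint_pos hx hs.1)]
  rfl

theorem mul_rpow_le_add_half {p : ℝ} (hp1 : 1 ≤ p) (D a b : ℝ≥0∞) :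
    D * (a * b ^ (p - 1)) ≤ (2 * D) ^ p * a ^ p + b ^ p / 2 := by
  have hsucc : ∀ z : ℝ≥0∞, z * z ^ (p - 1) = z ^ p := fun z => by
    conv_lhs => enter [1]; rw [← ENNReal.rpow_one z]
    rw [← ENNReal.rpow_add_of_nonneg _ _ zero_le_one (by linarith)]
    simp
  rcases le_total b (2 * D * a) with h | h
  · calc D * (a * b ^ (p - 1)) ≤ (2 * D * a) * (2 * D * a) ^ (p - 1) := by
          rw [← mul_assoc]
          gcongr
          exact le_mul_of_one_le_left zero_le one_le_two
      _ = (2 * D) ^ p * a ^ p := by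
          rw [hsucc, ENNReal.mul_rpow_of_nonneg _ _ (by linarith)]
      _ ≤ _ := le_self_add
  · calc D * (a * b ^ (p - 1)) ≤ b / 2 * b ^ (p - 1) := by
          rw [← mul_assoc]
          gcongr
          rw [ENNReal.le_div_iff_mul_le (Or.inl two_ne_zero) (Or.inl ENNReal.ofNat_ne_top)]
          calc D * a * 2 = 2 * D * a := by ring
            _ ≤ b := h
      _ = b ^ p / 2 := by rw [← hsucc b, div_eq_mul_inv, div_eq_mul_inv]; ring
      _ ≤ _ := le_add_self

theorem lintegral_cellAverage_rpow_le_of_bounded {u : ℝ → ℝ≥0} (hu : Measurable u) {p C : ℝ}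
    (hp : 0 < p) (hC0 : 0 < C)
    (hC : ∀ n : ℕ, ∀ a ∈ Icc (0 : ℝ) 1,
      ∫⁻ t in Ioc a 1, ENNReal.ofReal ((a / t) ^ p) * (u ((n : ℝ) + t) : ℝ≥0∞) ≤
        ENNReal.ofReal C * ∫⁻ t in Ioc (0 : ℝ) ((n : ℝ) + a), (u t : ℝ≥0∞))
    {f : ℝ → ℝ≥0∞} (hf : Measurable f) {k : ℝ≥0∞} (hk : k ≠ ∞) (hle : ∀ x, f x ≤ k)
    (hmono : ∀ x y : ℝ, 0 < x → x ≤ y → f y ≤ f x)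
    (hfin : ∫⁻ x in Ioi 0, cellAverage f x ^ p
      ∂(volume.withDensity fun x => (u x : ℝ≥0∞)) ≠ ∞) :
    ∫⁻ x in Ioi 0, cellAverage f x ^ p ∂(volume.withDensity fun x => (u x : ℝ≥0∞)) ≤
      (ENNReal.ofReal ((1 + C) / p) + 2 * (2 * (2 ^ p * ENNReal.ofReal ((1 + C) / p))) ^ p) *
        ∫⁻ x in Ioi 0, f x ^ p ∂(volume.withDensity fun x => (u x : ℝ≥0∞)) := by
  set ν := volume.withDensity fun x => (u x : ℝ≥0∞) with hν
  set c := ENNReal.ofReal ((1 + C) / p) with hc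
  set X := ∫⁻ x in Ioi 0, cellAverage f x ^ p ∂ν with hX
  set Y := ∫⁻ x in Ioi 0, f x ^ p ∂ν with hY
  have hfle : ∀ x, f x ≠ ∞ := fun x => ne_top_of_le_ne_top hk (hle x)
  rw [add_mul]
  rcases le_total p 1 with hp1 | hp1
  · refine le_trans ?_ le_self_add
    refine le_trans ?_ (lintegral_rpowMeasure_cellPoint_le hu hp hC0 hC (hf.pow_const p)
      (fun x => ENNReal.rpow_ne_top_of_nonneg hp.le (hfle x))
      (fun x y hx hxy => ENNReal.rpow_le_rpow (hmono x y hx hxy) hp.le))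
    refine setLIntegral_mono' measurableSet_Ioi fun x hx => ?_
    have hmono' : ∀ s t : ℝ, 0 < s → s ≤ t → f (cellPoint x t) ≤ f (cellPoint x s) := by
      intro s t hs hst
      refine hmono _ _ (cellPoint_pos hx hs) ?_
      have := cell_length_pos x
      unfold cellPoint
      gcongr
    exact rpow_lintegral_le_of_le_one hp hp1 hk (fun s => hle (cellPoint x s)) hmono'
  · refine le_trans ?_ le_add_self
    set D := 2 ^ p * c with hD
    have hA := measurable_cellAverage hf
    have hAle := cellAverage_le hle
    have h1 : X ≤ 2 ^ p * (c * ∫⁻ x in Ioi 0, f x * cellAverage f x ^ (p - 1) ∂ν) := by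
      calc X ≤ ∫⁻ x in Ioi 0, 2 ^ p * (∫⁻ s in Ioc (0 : ℝ) 1, ENNReal.ofReal (s ^ (p - 1)) *
            (f (cellPoint x s) * cellAverage f (cellPoint x s) ^ (p - 1))) ∂ν := by
            refine lintegral_mono fun x => ?_
            refine (rpow_lintegral_le_of_one_le hp1 (hf.comp (measurable_cellPoint_right x)) hk
              fun s => hle (cellPoint x s)).trans ?_
            gcongr 2 ^ p * ?_
            refine (setLIntegral_congr_fun measurableSet_Ioc fun s hs => ?_).le
            simp only [cellAverage, cellPoint_cellPoint x _ hs.1 hs.2, Function.comp]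
        _ = 2 ^ p * ∫⁻ x in Ioi 0, (∫⁻ s in Ioc (0 : ℝ) 1, ENNReal.ofReal (s ^ (p - 1)) *
            (f (cellPoint x s) * cellAverage f (cellPoint x s) ^ (p - 1))) ∂ν :=
            lintegral_const_mul' _ _ (ENNReal.rpow_ne_top_of_nonneg hp.le ENNReal.ofNat_ne_top)
        _ ≤ _ := by
            gcongr 2 ^ p * ?_
            refine lintegral_rpowMeasure_cellPoint_le hu hp hC0 hC
              (g := fun x => f x * cellAverage f x ^ (p - 1)) (hf.mul (hA.pow_const _))
              (fun x => ENNReal.mul_ne_top (hfle x) (ENNReal.rpow_ne_top_of_nonneg (by linarith)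
                (ne_top_of_le_ne_top hk (hAle x)))) (fun x y hx hxy => ?_)
            exact mul_le_mul' (hmono x y hx hxy)
              (ENNReal.rpow_le_rpow (cellAverage_anti hmono hx hxy) (by linarith))
    have h2 : X ≤ (2 * D) ^ p * Y + X / 2 := by
      calc X ≤ D * ∫⁻ x in Ioi 0, f x * cellAverage f x ^ (p - 1) ∂ν := by
            rw [hD, mul_assoc]; exact h1
        _ = ∫⁻ x in Ioi 0, D * (f x * cellAverage f x ^ (p - 1)) ∂ν :=
            (lintegral_const_mul _ (hf.mul (hA.pow_const _))).symm
        _ ≤ ∫⁻ x in Ioi 0, ((2 * D) ^ p * f x ^ p + cellAverage f x ^ p / 2) ∂ν :=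
            lintegral_mono fun x => mul_rpow_le_add_half hp1 _ _ _
        _ = (2 * D) ^ p * Y + X / 2 := by
            rw [lintegral_add_left ((hf.pow_const p).const_mul _),
              lintegral_const_mul _ (hf.pow_const p)]
            simp only [div_eq_mul_inv]
            rw [lintegral_mul_const _ (hA.pow_const p)]
    have hX2 : X / 2 ≠ ∞ := ENNReal.div_ne_top hfin two_ne_zero
    have h3 : X / 2 ≤ (2 * D) ^ p * Y := by
      refine (ENNReal.add_le_add_iff_right hX2).1 ?_
      rwa [ENNReal.add_halves]
    calc X = 2 * (X / 2) := (ENNReal.mul_div_cancel two_ne_zero ENNReal.ofNat_ne_top).symm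
      _ ≤ 2 * ((2 * D) ^ p * Y) := by gcongr
      _ = _ := by ring

/-- The truncation of `f` at height `k`, cut off to the right of `k`. -/
noncomputable def truncation (f : ℝ → ℝ≥0) (k : ℕ) : ℝ → ℝ≥0∞ :=
  (Iic (k : ℝ)).indicator fun x => min (f x : ℝ≥0∞) k

theorem measurable_truncation {f : ℝ → ℝ≥0} (hf : Measurable f) (k : ℕ) :
    Measurable (truncation f k) :=
  (hf.coe_nnreal_ennreal.min measurable_const).indicator measurableSet_Iic

theorem truncation_le (f : ℝ → ℝ≥0) (k : ℕ) (x : ℝ) : truncation f k x ≤ f x :=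
  indicator_le_self' (fun _ _ => zero_le) x |>.trans (min_le_left _ _)

theorem truncation_le_natCast (f : ℝ → ℝ≥0) (k : ℕ) (x : ℝ) : truncation f k x ≤ k :=
  indicator_le_self' (fun _ _ => zero_le) x |>.trans (min_le_right _ _)

theorem truncation_anti {f : ℝ → ℝ≥0} (hf : ∀ x y : ℝ, 0 < x → x ≤ y → f y ≤ f x) (k : ℕ)
    (x y : ℝ) (hx : 0 < x) (hxy : x ≤ y) : truncation f k y ≤ truncation f k x := by
  unfold truncation
  by_cases hy : y ≤ k
  · rw [indicator_of_mem (show y ∈ Iic (k : ℝ) from hy),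
      indicator_of_mem (show x ∈ Iic (k : ℝ) from hxy.trans hy)]
    exact min_le_min_right _ (by exact_mod_cast hf x y hx hxy)
  · rw [indicator_of_notMem (show y ∉ Iic (k : ℝ) from hy)]
    exact zero_le

theorem monotone_truncation (f : ℝ → ℝ≥0) (x : ℝ) : Monotone fun k => truncation f k x := by
  intro k l hkl
  have hkl' : (k : ℝ) ≤ l := by exact_mod_cast hkl
  have hkl'' : (k : ℝ≥0∞) ≤ l := by exact_mod_cast hkl
  exact indicator_le_indicator_of_subset (Iic_subset_Iic.2 hkl') (fun _ => zero_le) x |>.trans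
    (indicator_le_indicator (min_le_min_left _ hkl''))

theorem tendsto_truncation (f : ℝ → ℝ≥0) (x : ℝ) :
    Filter.Tendsto (fun k => truncation f k x) Filter.atTop (nhds (f x)) := by
  refine tendsto_const_nhds.congr' ?_
  filter_upwards [Filter.eventually_ge_atTop ⌈x⌉₊, Filter.eventually_ge_atTop ⌈f x⌉₊] with k h1 h2
  have h3 : (f x : ℝ≥0∞) ≤ k := by exact_mod_cast Nat.ceil_le.1 h2
  unfold truncation
  rw [indicator_of_mem (show x ∈ Iic (k : ℝ) from Nat.ceil_le.1 h1), min_eq_left h3]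

theorem cellAverage_truncation_eq_zero (f : ℝ → ℝ≥0) {k : ℕ} {x : ℝ} (hx : (k : ℝ) < x) :
    cellAverage (truncation f k) x = 0 := by
  unfold cellAverage
  rw [setLIntegral_congr_fun (g := fun _ => 0) measurableSet_Ioc fun s hs => ?_, lintegral_zero]
  refine indicator_of_notMem (fun hmem => ?_) _
  have h1 : (k : ℝ) ≤ ⌈x⌉ - 1 := by
    have : (k : ℤ) ≤ ⌈x⌉ - 1 := Int.le_sub_one_of_lt (Int.lt_ceil.2 (by exact_mod_cast hx))
    exact_mod_cast this
  exact absurd (mem_Iic.1 hmem) (not_le.2 (h1.trans_lt (cell_left_lt_cellPoint x hs.1)))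

theorem withDensity_Ioc_ne_top {u : ℝ → ℝ≥0}
    (hloc : LocallyIntegrableOn (fun t => (u t : ℝ)) (Ioi 0)) {y : ℝ} (hy : 0 < y)
    (hfin : (volume.withDensity fun x => (u x : ℝ≥0∞)) (Ioc 0 y) ≠ ∞) (b : ℝ) :
    (volume.withDensity fun x => (u x : ℝ≥0∞)) (Ioc 0 b) ≠ ∞ := by
  have h1 : IntegrableOn (fun t => (u t : ℝ)) (Icc y b) :=
    hloc.integrableOn_compact_subset (fun x hx => hy.trans_le hx.1) isCompact_Icc
  have h2 : (volume.withDensity fun x => (u x : ℝ≥0∞)) (Icc y b) ≠ ∞ := by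
    rw [withDensity_apply _ measurableSet_Icc]
    simpa [HasFiniteIntegral] using h1.2.ne
  refine ne_top_of_le_ne_top (ENNReal.add_ne_top.2 ⟨hfin, h2⟩)
    ((measure_mono fun x hx => ?_).trans (measure_union_le _ _))
  rcases le_total x y with h | h
  · exact Or.inl ⟨hx.1, h⟩
  · exact Or.inr ⟨h, hx.2⟩

theorem lintegral_cellAverage_rpow_le {u : ℝ → ℝ≥0} (hu : Measurable u)
    (hloc : LocallyIntegrableOn (fun t => (u t : ℝ)) (Ioi 0)) {p C : ℝ}
    (hp : 0 < p) (hC0 : 0 < C)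
    (hC : ∀ n : ℕ, ∀ a ∈ Icc (0 : ℝ) 1,
      ∫⁻ t in Ioc a 1, ENNReal.ofReal ((a / t) ^ p) * (u ((n : ℝ) + t) : ℝ≥0∞) ≤
        ENNReal.ofReal C * ∫⁻ t in Ioc (0 : ℝ) ((n : ℝ) + a), (u t : ℝ≥0∞))
    {f : ℝ → ℝ≥0} (hf : Measurable f) (hmono : ∀ x y : ℝ, 0 < x → x ≤ y → f y ≤ f x) :
    ∫⁻ x in Ioi 0, cellAverage (fun t => (f t : ℝ≥0∞)) x ^ p
        ∂(volume.withDensity fun x => (u x : ℝ≥0∞)) ≤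
      (ENNReal.ofReal ((1 + C) / p) + 2 * (2 * (2 ^ p * ENNReal.ofReal ((1 + C) / p))) ^ p) *
        ∫⁻ x in Ioi 0, (f x : ℝ≥0∞) ^ p ∂(volume.withDensity fun x => (u x : ℝ≥0∞)) := by
  set ν := volume.withDensity fun x => (u x : ℝ≥0∞) with hν
  set K := ENNReal.ofReal ((1 + C) / p) +
    2 * (2 * (2 ^ p * ENNReal.ofReal ((1 + C) / p))) ^ p with hK
  have hK0 : K ≠ 0 := by
    have : 0 < (1 + C) / p := by positivity
    have h' : ENNReal.ofReal ((1 + C) / p) ≠ 0 := by simpa using this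
    intro h
    exact h' (add_eq_zero.1 h).1
  rcases eq_or_ne (∫⁻ x in Ioi 0, (f x : ℝ≥0∞) ^ p ∂ν) ∞ with hY | hY
  · rw [hY, ENNReal.mul_top hK0]
    exact le_top
  by_cases hz : ∀ y, 0 < y → f y = 0
  · have : ∫⁻ x in Ioi 0, cellAverage (fun t => (f t : ℝ≥0∞)) x ^ p ∂ν = 0 := by
      rw [setLIntegral_congr_fun (g := fun _ => 0) measurableSet_Ioi fun x hx => ?_,
        lintegral_zero]
      have h0 : cellAverage (fun t => (f t : ℝ≥0∞)) x = 0 := by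
        unfold cellAverage
        rw [setLIntegral_congr_fun (g := fun _ => 0) measurableSet_Ioc fun s hs => ?_,
          lintegral_zero]
        simp [hz _ (cellPoint_pos hx hs.1)]
      simp [h0, hp]
    rw [this]
    exact zero_le
  push Not at hz
  obtain ⟨y, hy, hfy⟩ := hz
  have hνy : ν (Ioc 0 y) ≠ ∞ := by
    have hfy' : (f y : ℝ≥0∞) ^ p ≠ 0 := by simp [hfy]
    have hle : (f y : ℝ≥0∞) ^ p * ν (Ioc 0 y) ≤ ∫⁻ x in Ioi 0, (f x : ℝ≥0∞) ^ p ∂ν := by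
      rw [← setLIntegral_const]
      refine (setLIntegral_mono' measurableSet_Ioc fun x hx => ?_).trans
        (lintegral_mono_set Ioc_subset_Ioi_self)
      exact ENNReal.rpow_le_rpow (by exact_mod_cast hmono x y hx.1 hx.2) hp.le
    intro htop
    rw [htop, ENNReal.mul_top hfy'] at hle
    exact hY (top_le_iff.1 hle)
  have hfinite : ∀ k : ℕ, ∫⁻ x in Ioi 0, cellAverage (truncation f k) x ^ p ∂ν ≠ ∞ := by
    intro k
    have hpt : ∀ x, cellAverage (truncation f k) x ^ p ≤
        (Iic (k : ℝ)).indicator (fun _ => (k : ℝ≥0∞) ^ p) x := by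
      intro x
      by_cases hx : x ≤ k
      · rw [indicator_of_mem (show x ∈ Iic (k : ℝ) from hx)]
        exact ENNReal.rpow_le_rpow (cellAverage_le (truncation_le_natCast f k) x) hp.le
      · rw [cellAverage_truncation_eq_zero f (not_le.1 hx), ENNReal.zero_rpow_of_pos hp]
        exact zero_le
    refine ne_top_of_le_ne_top ?_ (lintegral_mono hpt)
    rw [lintegral_indicator measurableSet_Iic, Measure.restrict_restrict measurableSet_Iic,
      setLIntegral_const, inter_comm, Ioi_inter_Iic]
    exact ENNReal.mul_ne_top
      (ENNReal.rpow_ne_top_of_nonneg hp.le (ENNReal.natCast_ne_top k))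
      (withDensity_Ioc_ne_top hloc hy hνy k)
  have hmonoA : ∀ x, Monotone fun k => cellAverage (truncation f k) x := fun x k l hkl =>
    lintegral_mono fun s => monotone_truncation f _ hkl
  have htendA : ∀ x, Filter.Tendsto (fun k => cellAverage (truncation f k) x) Filter.atTop
      (nhds (cellAverage (fun t => (f t : ℝ≥0∞)) x)) := fun x =>
    lintegral_tendsto_of_tendsto_of_monotone
      (fun k => ((measurable_truncation hf k).comp (measurable_cellPoint_right x)).aemeasurable)
      (Filter.Eventually.of_forall fun s => monotone_truncation f _)
      (Filter.Eventually.of_forall fun s => tendsto_truncation f _)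
  have htend := lintegral_tendsto_of_tendsto_of_monotone (μ := ν.restrict (Ioi 0))
    (f := fun k x => cellAverage (truncation f k) x ^ p)
    (F := fun x => cellAverage (fun t => (f t : ℝ≥0∞)) x ^ p)
    (fun k => ((measurable_cellAverage (measurable_truncation hf k)).pow_const p).aemeasurable)
    (Filter.Eventually.of_forall fun x k l hkl => ENNReal.rpow_le_rpow (hmonoA x hkl) hp.le)
    (Filter.Eventually.of_forall fun x =>
      (ENNReal.continuous_rpow_const.tendsto _).comp (htendA x))
  refine le_of_tendsto' htend fun k => ?_
  refine (lintegral_cellAverage_rpow_le_of_bounded hu hp hC0 hC (measurable_truncation hf k)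
    (ENNReal.natCast_ne_top k) (truncation_le_natCast f k) (truncation_anti hmono k)
    (hfinite k)).trans ?_
  gcongr K * ?_
  exact lintegral_mono fun x => ENNReal.rpow_le_rpow (truncation_le f k x) hp.le

theorem lintegral_rpow_Ioc_le_of_bounded_operator {u : ℝ → ℝ≥0} {p C : ℝ} (hp : 0 < p)
    (h : ∀ f : ℝ → ℝ≥0, Measurable f → (∀ x y : ℝ, 0 < x → x ≤ y → f y ≤ f x) →
        ∫⁻ x in Ioi (0 : ℝ), Sblack f x ^ p * (u x : ℝ≥0∞) ≤
          ENNReal.ofReal C * ∫⁻ x in Ioi (0 : ℝ), (f x : ℝ≥0∞) ^ p * (u x : ℝ≥0∞))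
    (n : ℕ) {a : ℝ} (ha : a ∈ Icc (0 : ℝ) 1) :
    ∫⁻ t in Ioc a 1, ENNReal.ofReal ((a / t) ^ p) * (u ((n : ℝ) + t) : ℝ≥0∞) ≤
      ENNReal.ofReal C * ∫⁻ t in Ioc (0 : ℝ) ((n : ℝ) + a), (u t : ℝ≥0∞) := by
  set f : ℝ → ℝ≥0 := (Iic ((n : ℝ) + a)).indicator 1 with hf
  have hfanti : ∀ x y : ℝ, 0 < x → x ≤ y → f y ≤ f x := by
    intro x y _ hxy
    by_cases hy : y ≤ n + a
    · simp [hf, hy, hxy.trans hy]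
    · simp [hf, indicator, hy]
  have hS : ∀ x ∈ Ioo ((n : ℝ) + a) (n + 1),
      Sblack f x = ENNReal.ofReal (a / (x - n)) := by
    intro x hx
    have hfloor : ⌊x⌋ = n := by
      refine Int.floor_eq_iff.2 ⟨?_, ?_⟩
      · push_cast; linarith [hx.1, ha.1]
      · push_cast; exact hx.2
    have hcoe : (fun t => (f t : ℝ≥0∞)) = (Iic ((n : ℝ) + a)).indicator 1 := by
      funext t
      by_cases ht : t ≤ n + a <;> simp [hf, indicator, ht]
    have hset : Iic ((n : ℝ) + a) ∩ Ioc (n : ℝ) x = Ioc (n : ℝ) (n + a) := by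
      ext t
      simp only [mem_inter_iff, mem_Iic, mem_Ioc]
      exact ⟨fun ht => ⟨ht.2.1, ht.1⟩, fun ht => ⟨ht.2, ht.1, ht.2.trans hx.1.le⟩⟩
    unfold Sblack
    rw [hcoe, lintegral_indicator_one measurableSet_Iic, Measure.restrict_apply measurableSet_Iic,
      hfloor, Int.cast_natCast, hset, Real.volume_Ioc, add_sub_cancel_left,
      ENNReal.ofReal_div_of_pos (by linarith [hx.1, ha.1])]
  have haff := setLIntegral_Ioc_affine
    (fun x => ENNReal.ofReal ((a / (x - n)) ^ p) * (u x : ℝ≥0∞)) n a 1 one_pos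
  simp only [one_mul, add_sub_cancel_left, ENNReal.ofReal_one, mul_one] at haff
  calc _ = ∫⁻ x in Ioo ((n : ℝ) + a) (n + 1),
        ENNReal.ofReal ((a / (x - n)) ^ p) * (u x : ℝ≥0∞) := by
        rw [← haff, restrict_Ioo_eq_restrict_Ioc]
    _ = ∫⁻ x in Ioo ((n : ℝ) + a) (n + 1), Sblack f x ^ p * (u x : ℝ≥0∞) := by
        refine setLIntegral_congr_fun measurableSet_Ioo fun x hx => ?_
        rw [hS x hx, ENNReal.ofReal_rpow_of_nonneg
          (div_nonneg ha.1 (by linarith [hx.1, ha.1])) hp.le]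
    _ ≤ ∫⁻ x in Ioi (0 : ℝ), Sblack f x ^ p * (u x : ℝ≥0∞) :=
        lintegral_mono_set fun x hx => lt_of_le_of_lt (add_nonneg n.cast_nonneg ha.1) hx.1
    _ ≤ ENNReal.ofReal C * ∫⁻ x in Ioi (0 : ℝ), (f x : ℝ≥0∞) ^ p * (u x : ℝ≥0∞) :=
        h f (measurable_one.indicator measurableSet_Iic) hfanti
    _ = _ := by
        congr 1
        have hcoe : ∀ x, (f x : ℝ≥0∞) ^ p * (u x : ℝ≥0∞) =
            (Iic ((n : ℝ) + a)).indicator (fun x => (u x : ℝ≥0∞)) x := by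
          intro x
          by_cases hx : x ≤ n + a <;> simp [hf, indicator, hx, hp]
        simp only [hcoe]
        rw [lintegral_indicator measurableSet_Iic, Measure.restrict_restrict measurableSet_Iic,
          inter_comm, Ioi_inter_Iic]

/-- `S_◁` is bounded in `L^p(u)` on nonnegative decreasing functions on
`(0,∞)` if and only if for every `n ∈ ℕ` and `a ∈ [0,1]`,
`∫_a^1 (a/t)^p u(n+t) dt ≤ C ∫_0^{n+a} u(t) dt`. -/
theorem stmt8 (u : ℝ → ℝ≥0) (hu : Measurable u)
    (hloc : MeasureTheory.LocallyIntegrableOn (fun t => (u t : ℝ)) (Set.Ioi 0))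
    (p : ℝ) (hp : 0 < p) :
    (∃ C : ℝ, 0 < C ∧ ∀ f : ℝ → ℝ≥0, Measurable f →
        (∀ x y : ℝ, 0 < x → x ≤ y → f y ≤ f x) →
        ∫⁻ x in Set.Ioi (0 : ℝ), Sblack f x ^ p * (u x : ℝ≥0∞) ≤
          ENNReal.ofReal C * ∫⁻ x in Set.Ioi (0 : ℝ), (f x : ℝ≥0∞) ^ p * (u x : ℝ≥0∞)) ↔
      (∃ C : ℝ, 0 < C ∧ ∀ n : ℕ, ∀ a ∈ Set.Icc (0 : ℝ) 1,
        ∫⁻ t in Set.Ioc a 1, ENNReal.ofReal ((a / t) ^ p) * (u ((n : ℝ) + t) : ℝ≥0∞) ≤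
          ENNReal.ofReal C * ∫⁻ t in Set.Ioc (0 : ℝ) ((n : ℝ) + a), (u t : ℝ≥0∞)) := by
  constructor
  · rintro ⟨C, hC0, hC⟩
    exact ⟨C, hC0, fun n a ha => lintegral_rpow_Ioc_le_of_bounded_operator hp hC n ha⟩
  · rintro ⟨C, hC0, hC⟩
    have hum : Measurable fun x => (u x : ℝ≥0∞) := hu.coe_nnreal_ennreal
    set c := ENNReal.ofReal ((1 + C) / p) with hc
    have hc0 : c ≠ 0 := by
      have : 0 < (1 + C) / p := by positivity
      simpa [hc] using this
    set K := c + 2 * (2 * (2 ^ p * c)) ^ p with hK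
    have hKtop : K ≠ ∞ := by
      have h2p : (2 : ℝ≥0∞) ^ p ≠ ∞ :=
        ENNReal.rpow_ne_top_of_nonneg hp.le ENNReal.ofNat_ne_top
      exact ENNReal.add_ne_top.2 ⟨ENNReal.ofReal_ne_top, ENNReal.mul_ne_top ENNReal.ofNat_ne_top
        (ENNReal.rpow_ne_top_of_nonneg hp.le (ENNReal.mul_ne_top ENNReal.ofNat_ne_top
          (ENNReal.mul_ne_top h2p ENNReal.ofReal_ne_top)))⟩
    have hK0 : K ≠ 0 := fun h => hc0 (add_eq_zero.1 h).1
    refine ⟨K.toReal, ENNReal.toReal_pos hK0 hKtop, fun f hf hmono => ?_⟩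
    rw [ENNReal.ofReal_toReal hKtop]
    have hweight : ∀ g : ℝ → ℝ≥0∞, Measurable g →
        ∫⁻ x in Ioi (0 : ℝ), g x ∂(volume.withDensity fun x => (u x : ℝ≥0∞)) =
          ∫⁻ x in Ioi (0 : ℝ), g x * (u x : ℝ≥0∞) := by
      intro g hg
      rw [setLIntegral_withDensity_eq_setLIntegral_mul _ hum hg measurableSet_Ioi]
      simp only [Pi.mul_apply, mul_comm]
    have hmain := lintegral_cellAverage_rpow_le hu hloc hp hC0 hC hf hmono
    rw [hweight _ ((measurable_cellAverage hf.coe_nnreal_ennreal).pow_const p),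
      hweight _ (hf.coe_nnreal_ennreal.pow_const p)] at hmain
    refine le_trans (le_of_eq (lintegral_congr_ae (ae_restrict_of_ae ?_))) hmain
    filter_upwards [ae_notMem_range_intCast] with x hx
    rw [Sblack_eq_cellAverage f hx]
end

section
/- Let u be a weight on (0,∞)² and 0 < p < ∞. The following three conditions are equivalent: (a) there exists C > 0 such that ∫_{(0,∞)²} (Sf)^p u ≤ C ∫_{(0,∞)²} f^p u for every nonnegative measurable f decreasing in each variable; (b) u belongs to B_p((0,∞)²); (c) there exist constants C₁, C₂ > 0 such that ∫_{(0,∞)²} (S₁f)^p u ≤ C₁ ∫_{(0,∞)²} f^p u and ∫_{(0,∞)²} (S₂f)^p u ≤ C₂ ∫_{(0,∞)²} f^p u for every nonnegative measurable f decreasing in each variable. -/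
open MeasureTheory Set
open scoped ENNReal NNReal

/-- A set `D ⊆ (0,∞)²` is decreasing if its indicator is decreasing in each variable. -/
def DecSet2 (D : Set (ℝ × ℝ)) : Prop :=
  D ⊆ Set.Ioi 0 ×ˢ Set.Ioi 0 ∧
    ∀ z ∈ D, ∀ w : ℝ × ℝ, 0 < w.1 → w.1 ≤ z.1 → 0 < w.2 → w.2 ≤ z.2 → w ∈ D

/-- A function on `(0,∞)²` is decreasing in each variable. -/
def DecFun2 (f : ℝ × ℝ → ℝ≥0) : Prop :=
  ∀ x y x' y' : ℝ, 0 < x' → x' ≤ x → 0 < y' → y' ≤ y → f (x, y) ≤ f (x', y')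

/-- The two-dimensional Hardy operator `Sf(x,y) = (1/(xy)) ∫₀^x ∫₀^y f(s,t) dt ds`. -/
noncomputable def hardy2 (f : ℝ × ℝ → ℝ≥0) (z : ℝ × ℝ) : ℝ≥0∞ :=
  (∫⁻ w in Set.Ioc 0 z.1 ×ˢ Set.Ioc 0 z.2, (f w : ℝ≥0∞)) / ENNReal.ofReal (z.1 * z.2)

/-- The partial Hardy operator `S₁f(x,y) = (1/x) ∫₀^x f(s,y) ds`. -/
noncomputable def hardyS1 (f : ℝ × ℝ → ℝ≥0) (z : ℝ × ℝ) : ℝ≥0∞ :=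
  (∫⁻ s in Set.Ioc 0 z.1, (f (s, z.2) : ℝ≥0∞)) / ENNReal.ofReal z.1

/-- The partial Hardy operator `S₂f(x,y) = (1/y) ∫₀^y f(x,t) dt`. -/
noncomputable def hardyS2 (f : ℝ × ℝ → ℝ≥0) (z : ℝ × ℝ) : ℝ≥0∞ :=
  (∫⁻ t in Set.Ioc 0 z.2, (f (z.1, t) : ℝ≥0∞)) / ENNReal.ofReal z.2

/-- The `B_p((0,∞)²)` condition for a weight `u` on `(0,∞)²`. -/
def Bp2 (u : ℝ × ℝ → ℝ≥0) (p : ℝ) : Prop :=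
  ∃ C : ℝ, 0 < C ∧ ∀ D : Set (ℝ × ℝ), DecSet2 D →
    ∫⁻ z in (Set.Ioi (0 : ℝ) ×ˢ Set.Ioi (0 : ℝ)) \ D,
        (volume (D ∩ (Set.Ioc 0 z.1 ×ˢ Set.Ioc 0 z.2)) / ENNReal.ofReal (z.1 * z.2)) ^ p *
          (u z : ℝ≥0∞) ≤
      ENNReal.ofReal C * ∫⁻ z in D, (u z : ℝ≥0∞)

/-- The mean over `(0, x]` of an antitone function is antitone in `x`. -/
lemma antitoneOn_lintegral_Ioc_div {φ : ℝ → ℝ≥0∞} (hφ : AntitoneOn φ (Ioi 0)) :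
    AntitoneOn (fun x => (∫⁻ s in Ioc 0 x, φ s) / ENNReal.ofReal x) (Ioi 0) := by
  intro x hx y hy hxy
  have hx : 0 < x := hx
  have hy : 0 < y := hy
  have hlow : ENNReal.ofReal x * φ x ≤ ∫⁻ s in Ioc 0 x, φ s := by
    calc ENNReal.ofReal x * φ x = ∫⁻ s in Ioc 0 x, φ x := by
          simp [mul_comm]
      _ ≤ _ := setLIntegral_mono' measurableSet_Ioc fun s hs => hφ hs.1 hx hs.2
  have hupp : ∫⁻ s in Ioc x y, φ s ≤ ENNReal.ofReal (y - x) * φ x := by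
    calc ∫⁻ s in Ioc x y, φ s ≤ ∫⁻ s in Ioc x y, φ x :=
          setLIntegral_mono' measurableSet_Ioc fun s hs => hφ hx (hx.trans hs.1) hs.1.le
      _ = _ := by simp [mul_comm]
  have hsplit : ∫⁻ s in Ioc 0 y, φ s = (∫⁻ s in Ioc 0 x, φ s) + ∫⁻ s in Ioc x y, φ s := by
    rw [← Ioc_union_Ioc_eq_Ioc hx.le hxy, lintegral_union measurableSet_Ioc]
    exact Ioc_disjoint_Ioc_of_le le_rfl
  have hx0 : ENNReal.ofReal x ≠ 0 := by simpa using hx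
  have hy0 : ENNReal.ofReal y ≠ 0 := by simpa using hy
  change (∫⁻ s in Ioc 0 y, φ s) / ENNReal.ofReal y ≤ (∫⁻ s in Ioc 0 x, φ s) / ENNReal.ofReal x
  rw [ENNReal.div_le_iff hy0 ENNReal.ofReal_ne_top, div_eq_mul_inv, mul_assoc,
    mul_comm (ENNReal.ofReal x)⁻¹, ← mul_assoc, ← div_eq_mul_inv]
  rw [ENNReal.le_div_iff_mul_le (Or.inl hx0) (Or.inl ENNReal.ofReal_ne_top)]
  calc (∫⁻ s in Ioc 0 y, φ s) * ENNReal.ofReal x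
      ≤ ((∫⁻ s in Ioc 0 x, φ s) + ENNReal.ofReal (y - x) * φ x) * ENNReal.ofReal x := by
        rw [hsplit]; gcongr
    _ = (∫⁻ s in Ioc 0 x, φ s) * ENNReal.ofReal x
          + ENNReal.ofReal (y - x) * (ENNReal.ofReal x * φ x) := by ring
    _ ≤ (∫⁻ s in Ioc 0 x, φ s) * ENNReal.ofReal x
          + ENNReal.ofReal (y - x) * ∫⁻ s in Ioc 0 x, φ s := by gcongr
    _ = (∫⁻ s in Ioc 0 x, φ s) * (ENNReal.ofReal x + ENNReal.ofReal (y - x)) := by ring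
    _ = (∫⁻ s in Ioc 0 x, φ s) * ENNReal.ofReal y := by
        rw [← ENNReal.ofReal_add hx.le (sub_nonneg.2 hxy), add_sub_cancel]

lemma mul_le_lintegral_Ioc {φ : ℝ → ℝ≥0∞} (hφ : AntitoneOn φ (Ioi 0)) {x : ℝ} (hx : 0 < x) :
    φ x * ENNReal.ofReal x ≤ ∫⁻ s in Ioc 0 x, φ s := by
  calc φ x * ENNReal.ofReal x = ∫⁻ s in Ioc 0 x, φ x := by simp
    _ ≤ _ := setLIntegral_mono' measurableSet_Ioc fun s hs => hφ hs.1 hx hs.2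

lemma lintegral_Ioc_le_mul {φ : ℝ → ℝ≥0} {N : ℝ≥0} (hN : ∀ s, φ s ≤ N) (x : ℝ) :
    ∫⁻ s in Ioc 0 x, (φ s : ℝ≥0∞) ≤ N * ENNReal.ofReal x := by
  calc ∫⁻ s in Ioc 0 x, (φ s : ℝ≥0∞) ≤ ∫⁻ s in Ioc 0 x, (N : ℝ≥0∞) :=
        lintegral_mono fun s => ENNReal.coe_le_coe.2 (hN s)
    _ = _ := by simp

lemma exists_lintegral_Ioc_eq_half {φ : ℝ → ℝ≥0} (hφ : Measurable φ) {N : ℝ≥0}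
    (hN : ∀ s, φ s ≤ N) {x : ℝ} (hx : 0 < x) :
    ∃ a ∈ Icc 0 x, ∫⁻ s in Ioc 0 a, (φ s : ℝ≥0∞) = (∫⁻ s in Ioc 0 x, (φ s : ℝ≥0∞)) / 2 := by
  have hint : ∀ a b : ℝ, IntervalIntegrable (fun s => (φ s : ℝ)) volume a b := fun a b =>
    (intervalIntegrable_const (c := (N : ℝ))).mono_fun'
      hφ.coe_nnreal_real.aestronglyMeasurable (ae_of_all _ fun s => by simpa using hN s)
  have hval : ∀ b : ℝ, 0 ≤ b → ∫⁻ s in Ioc 0 b, (φ s : ℝ≥0∞)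
      = ENNReal.ofReal (∫ s in (0 : ℝ)..b, (φ s : ℝ)) := fun b hb => by
    rw [intervalIntegral.integral_of_le hb, ofReal_integral_eq_lintegral_ofReal
      ((intervalIntegrable_iff_integrableOn_Ioc_of_le hb).1 (hint 0 b))
      (ae_of_all _ fun s => NNReal.coe_nonneg _)]
    simp
  have hcont := intervalIntegral.continuous_primitive (μ := volume) hint 0
  have hnonneg : 0 ≤ ∫ s in (0 : ℝ)..x, (φ s : ℝ) :=
    intervalIntegral.integral_nonneg hx.le fun s _ => NNReal.coe_nonneg _
  obtain ⟨a, ha, hax⟩ := intermediate_value_Icc hx.le hcont.continuousOn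
    (show (∫ s in (0 : ℝ)..x, (φ s : ℝ)) / 2 ∈ Icc _ _ by
      constructor
      · rw [intervalIntegral.integral_same]
        positivity
      · linarith)
  refine ⟨a, ha, ?_⟩
  simp only at hax
  rw [hval a ha.1, hval x hx.le, hax, ENNReal.ofReal_div_of_pos two_pos]
  simp

lemma lintegral_Ioc_rpow_le_of_one_le {φ : ℝ → ℝ≥0} (hφ : Measurable φ) {N : ℝ≥0}
    (hN : ∀ s, φ s ≤ N) {p : ℝ} (hp : 1 ≤ p) {x : ℝ} (hx : 0 < x) :
    (∫⁻ s in Ioc 0 x, (φ s : ℝ≥0∞)) ^ p ≤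
      2 ^ p * ∫⁻ s in Ioc 0 x, (φ s : ℝ≥0∞) * (∫⁻ r in Ioc 0 s, (φ r : ℝ≥0∞)) ^ (p - 1) := by
  obtain ⟨a, ha, hax⟩ := exists_lintegral_Ioc_eq_half hφ hN hx
  set F := ∫⁻ s in Ioc 0 x, (φ s : ℝ≥0∞) with hF
  have hFtop : F ≠ ⊤ := ((lintegral_Ioc_le_mul hN x).trans_lt
    (ENNReal.mul_lt_top ENNReal.coe_lt_top ENNReal.ofReal_lt_top)).ne
  have hsplit : F = F / 2 + ∫⁻ s in Ioc a x, (φ s : ℝ≥0∞) := by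
    rw [← hax, hF, ← Ioc_union_Ioc_eq_Ioc ha.1 ha.2, lintegral_union measurableSet_Ioc]
    exact Ioc_disjoint_Ioc_of_le le_rfl
  have hhalf : ∫⁻ s in Ioc a x, (φ s : ℝ≥0∞) = F / 2 := by
    have h : F / 2 + ∫⁻ s in Ioc a x, (φ s : ℝ≥0∞) = F / 2 + F / 2 := by
      rw [← hsplit, ENNReal.add_halves]
    exact (ENNReal.add_right_inj (ENNReal.div_ne_top hFtop two_ne_zero)).1 h
  calc F ^ p = 2 ^ p * (F / 2) ^ p := by
        rw [← ENNReal.mul_rpow_of_nonneg _ _ (by linarith),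
          ENNReal.mul_div_cancel two_ne_zero ENNReal.ofNat_ne_top]
    _ ≤ 2 ^ p * ∫⁻ s in Ioc a x, (φ s : ℝ≥0∞) * (F / 2) ^ (p - 1) := by
        rw [lintegral_mul_const _ hφ.coe_nnreal_ennreal, hhalf]
        gcongr
        rcases eq_or_ne (F / 2) 0 with h0 | h0
        · rw [h0, ENNReal.zero_rpow_of_pos (by linarith)]; simp
        · conv_rhs => rw [← ENNReal.rpow_one (F / 2), ← ENNReal.rpow_mul, one_mul,
            ← ENNReal.rpow_add _ _ h0 (ENNReal.div_ne_top hFtop two_ne_zero)]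
          simp
    _ ≤ 2 ^ p * ∫⁻ s in Ioc a x, (φ s : ℝ≥0∞) *
          (∫⁻ r in Ioc 0 s, (φ r : ℝ≥0∞)) ^ (p - 1) := by
        gcongr 2 ^ p * ?_
        refine setLIntegral_mono' measurableSet_Ioc fun s hs => ?_
        rw [← hax]
        gcongr
        exact hs.1.le
    _ ≤ _ := by
        gcongr
        exact ha.1

lemma lintegral_Ioc_rpow_le_of_le_one {φ : ℝ → ℝ≥0} (hφ : Measurable φ) {N : ℝ≥0}
    (hN : ∀ s, φ s ≤ N) (hanti : AntitoneOn φ (Ioi 0)) {p : ℝ} (hp0 : 0 < p) (hp : p ≤ 1)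
    {x : ℝ} :
    (∫⁻ s in Ioc 0 x, (φ s : ℝ≥0∞)) ^ p ≤
      ∫⁻ s in Ioc 0 x, (φ s : ℝ≥0∞) ^ p * ENNReal.ofReal (s ^ (p - 1)) := by
  have hanti' : AntitoneOn (fun s => (φ s : ℝ≥0∞)) (Ioi 0) := fun a ha b hb hab => by
    exact ENNReal.coe_le_coe.2 (hanti ha hb hab)
  set F := ∫⁻ s in Ioc 0 x, (φ s : ℝ≥0∞) with hF
  have hFtop : F ≠ ⊤ := ((lintegral_Ioc_le_mul hN x).trans_lt
    (ENNReal.mul_lt_top ENNReal.coe_lt_top ENNReal.ofReal_lt_top)).ne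
  rcases eq_or_ne F 0 with h0 | h0
  · rw [h0, ENNReal.zero_rpow_of_pos hp0]; exact zero_le
  calc F ^ p = F * F ^ (p - 1) := by
        conv_rhs => rw [← ENNReal.rpow_one F, ← ENNReal.rpow_mul, one_mul,
          ← ENNReal.rpow_add _ _ h0 hFtop]
        simp
    _ = ∫⁻ s in Ioc 0 x, (φ s : ℝ≥0∞) * F ^ (p - 1) := by
        rw [lintegral_mul_const _ hφ.coe_nnreal_ennreal]
    _ ≤ _ := by
        refine setLIntegral_mono' measurableSet_Ioc fun s hs => ?_
        have hs0 : 0 < s := hs.1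
        rcases eq_or_ne (φ s : ℝ≥0∞) 0 with hz | hz
        · simp [hz]
        have hle : (φ s : ℝ≥0∞) * ENNReal.ofReal s ≤ F :=
          (mul_le_lintegral_Ioc hanti' hs0).trans (lintegral_mono_set (Ioc_subset_Ioc_right hs.2))
        have hneg : F ^ (p - 1) ≤ ((φ s : ℝ≥0∞) * ENNReal.ofReal s) ^ (p - 1) := by
          rw [← neg_sub, ENNReal.rpow_neg, ENNReal.rpow_neg]
          exact ENNReal.inv_le_inv.2 (ENNReal.rpow_le_rpow hle (by linarith))
        calc (φ s : ℝ≥0∞) * F ^ (p - 1)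
            ≤ (φ s : ℝ≥0∞) * ((φ s : ℝ≥0∞) * ENNReal.ofReal s) ^ (p - 1) := by gcongr
          _ = (φ s : ℝ≥0∞) ^ (1 : ℝ) * ((φ s : ℝ≥0∞) ^ (p - 1) * ENNReal.ofReal s ^ (p - 1)) := by
              rw [ENNReal.mul_rpow_of_ne_top ENNReal.coe_ne_top ENNReal.ofReal_ne_top,
                ENNReal.rpow_one]
          _ = (φ s : ℝ≥0∞) ^ p * ENNReal.ofReal (s ^ (p - 1)) := by
              rw [← mul_assoc, ← ENNReal.rpow_add _ _ hz ENNReal.coe_ne_top,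
                ENNReal.ofReal_rpow_of_pos hs0]
              simp

lemma lintegral_Ioc_ofReal_rpow {p : ℝ} (hp : 0 < p) {L : ℝ} (hL : 0 ≤ L) :
    ∫⁻ s in Ioc 0 L, ENNReal.ofReal (s ^ (p - 1)) = ENNReal.ofReal (1 / p) * ENNReal.ofReal L ^ p := by
  have hint := (intervalIntegrable_iff_integrableOn_Ioc_of_le hL).1
    (intervalIntegral.intervalIntegrable_rpow' (a := 0) (b := L) (r := p - 1) (by linarith))
  rw [← ofReal_integral_eq_lintegral_ofReal hint
    ((ae_restrict_iff' measurableSet_Ioc).2 (ae_of_all _ fun s hs => Real.rpow_nonneg hs.1.le _)),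
    ← intervalIntegral.integral_of_le hL, integral_rpow (Or.inl (by linarith)),
    ENNReal.ofReal_rpow_of_nonneg hL hp.le, ← ENNReal.ofReal_mul (by positivity)]
  congr 1
  rw [sub_add_cancel, Real.zero_rpow hp.ne']
  ring

/-- Layer-cake bound for the weighted integral of an antitone function against `s ^ (p - 1)`. -/
lemma lintegral_Ioc_mul_rpow_le {ψ : ℝ → ℝ≥0} (hψ : Measurable ψ) (hanti : AntitoneOn ψ (Ioi 0))
    {p : ℝ} (hp : 0 < p) {x : ℝ} :
    ∫⁻ s in Ioc 0 x, (ψ s : ℝ≥0∞) * ENNReal.ofReal (s ^ (p - 1)) ≤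
      ENNReal.ofReal (1 / p) *
        ∫⁻ t in Ioi (0 : ℝ), (volume {s ∈ Ioc 0 x | t < (ψ s : ℝ)}) ^ p := by
  have hw : Measurable fun s : ℝ => ENNReal.ofReal (s ^ (p - 1)) := by fun_prop
  have hmeas : ∀ t : ℝ, MeasurableSet {s | t < (ψ s : ℝ)} := fun t =>
    measurableSet_lt measurable_const hψ.coe_nnreal_real
  have hlayer := lintegral_eq_lintegral_meas_lt
    ((volume.restrict (Ioc 0 x)).withDensity fun s => ENNReal.ofReal (s ^ (p - 1)))
    (f := fun s => (ψ s : ℝ)) (ae_of_all _ fun s => NNReal.coe_nonneg _)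
    hψ.coe_nnreal_real.aemeasurable
  rw [lintegral_withDensity_eq_lintegral_mul _ hw hψ.coe_nnreal_real.ennreal_ofReal] at hlayer
  calc ∫⁻ s in Ioc 0 x, (ψ s : ℝ≥0∞) * ENNReal.ofReal (s ^ (p - 1))
      = ∫⁻ s in Ioc 0 x, ((fun s => ENNReal.ofReal (s ^ (p - 1))) *
          fun s => ENNReal.ofReal (ψ s : ℝ)) s := by
        simp [mul_comm]
    _ = _ := hlayer
    _ ≤ ∫⁻ t in Ioi (0 : ℝ), ENNReal.ofReal (1 / p) *
          (volume {s ∈ Ioc 0 x | t < (ψ s : ℝ)}) ^ p := by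
        refine lintegral_mono fun t => ?_
        rw [withDensity_apply _ (hmeas t), Measure.restrict_restrict (hmeas t)]
        set A : Set ℝ := {s ∈ Ioc 0 x | t < (ψ s : ℝ)} with hA
        have hAe : {s | t < (ψ s : ℝ)} ∩ Ioc 0 x = A := by
          ext s; simp [hA, and_comm]
        have hAtop : volume A ≠ ⊤ :=
          ((measure_mono (sep_subset _ _)).trans_lt (measure_Ioc_lt_top (a := 0) (b := x))).ne
        have hsub : A ⊆ Ioc 0 (volume A).toReal := by
          intro s hs
          refine ⟨hs.1.1, ?_⟩
          have : Ioc 0 s ⊆ A := fun r hr =>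
            ⟨⟨hr.1, hr.2.trans hs.1.2⟩, hs.2.trans_le (by exact_mod_cast hanti hr.1 hs.1.1 hr.2)⟩
          have h := measure_mono (μ := volume) this
          rw [Real.volume_Ioc, sub_zero] at h
          exact (ENNReal.ofReal_le_iff_le_toReal hAtop).1 h
        rw [hAe]
        calc ∫⁻ s in A, ENNReal.ofReal (s ^ (p - 1))
            ≤ ∫⁻ s in Ioc 0 (volume A).toReal, ENNReal.ofReal (s ^ (p - 1)) :=
              lintegral_mono_set hsub
          _ = _ := by
              rw [lintegral_Ioc_ofReal_rpow hp ENNReal.toReal_nonneg, ENNReal.ofReal_toReal hAtop]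
    _ = _ := lintegral_const_mul' _ _ ENNReal.ofReal_ne_top

/-- Boundedness of an operator on decreasing functions, with constant `K`. -/
def DecBound (T : (ℝ × ℝ → ℝ≥0) → ℝ × ℝ → ℝ≥0∞) (u : ℝ × ℝ → ℝ≥0) (p : ℝ) (K : ℝ≥0∞) : Prop :=
  ∀ f : ℝ × ℝ → ℝ≥0, Measurable f → DecFun2 f →
    ∫⁻ z in Ioi (0 : ℝ) ×ˢ Ioi (0 : ℝ), T f z ^ p * (u z : ℝ≥0∞) ≤
      K * ∫⁻ z in Ioi (0 : ℝ) ×ˢ Ioi (0 : ℝ), (f z : ℝ≥0∞) ^ p * (u z : ℝ≥0∞)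

/-- The bound for the two-dimensional Hardy operator on indicators of measurable decreasing
sets. -/
def BoxBound (u : ℝ × ℝ → ℝ≥0) (p : ℝ) (K : ℝ≥0∞) : Prop :=
  ∀ D : Set (ℝ × ℝ), MeasurableSet D → DecSet2 D →
    ∫⁻ z in Ioi (0 : ℝ) ×ˢ Ioi (0 : ℝ),
        (volume (D ∩ (Ioc 0 z.1 ×ˢ Ioc 0 z.2)) / ENNReal.ofReal (z.1 * z.2)) ^ p *
          (u z : ℝ≥0∞) ≤
      K * ∫⁻ z in D, (u z : ℝ≥0∞)

/-- The bound for the first partial Hardy operator on indicators of measurable decreasing sets. -/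
def SliceBound (u : ℝ × ℝ → ℝ≥0) (p : ℝ) (K : ℝ≥0∞) : Prop :=
  ∀ D : Set (ℝ × ℝ), MeasurableSet D → DecSet2 D →
    ∫⁻ z in Ioi (0 : ℝ) ×ˢ Ioi (0 : ℝ),
        (volume {s ∈ Ioc 0 z.1 | (s, z.2) ∈ D} / ENNReal.ofReal z.1) ^ p * (u z : ℝ≥0∞) ≤
      K * ∫⁻ z in D, (u z : ℝ≥0∞)

lemma measurableSet_quadrant : MeasurableSet (Ioi (0 : ℝ) ×ˢ Ioi (0 : ℝ)) :=
  measurableSet_Ioi.prod measurableSet_Ioi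

lemma measurableSet_mem_Ioc_zero {α : Type*} [MeasurableSpace α] {a b : α → ℝ}
    (ha : Measurable a) (hb : Measurable b) : MeasurableSet {q | a q ∈ Ioc 0 (b q)} :=
  (measurableSet_lt measurable_const ha).inter (measurableSet_le ha hb)

lemma DecFun2.antitoneOn_slice {f : ℝ × ℝ → ℝ≥0} (hf : DecFun2 f) {y : ℝ} (hy : 0 < y) :
    AntitoneOn (fun s => f (s, y)) (Ioi 0) :=
  fun _ ha _ _ hab => hf _ _ _ _ ha hab hy le_rfl

lemma DecFun2.decSet2_lt {f : ℝ × ℝ → ℝ≥0} (hf : DecFun2 f) (t : ℝ) :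
    DecSet2 ({z | t < (f z : ℝ)} ∩ Ioi 0 ×ˢ Ioi 0) := by
  refine ⟨inter_subset_right, fun z hz w hw1 hwz1 hw2 hwz2 => ⟨?_, hw1, hw2⟩⟩
  exact lt_of_lt_of_le hz.1 (NNReal.coe_le_coe.2 (hf z.1 z.2 w.1 w.2 hw1 hwz1 hw2 hwz2))

lemma BoxBound.sliceBound {u : ℝ × ℝ → ℝ≥0} {p : ℝ} (hp : 0 < p) {K : ℝ≥0∞}
    (h : BoxBound u p K) : SliceBound u p K := by
  intro D hDm hD
  refine le_trans (setLIntegral_mono' measurableSet_quadrant fun z hz => ?_) (h D hDm hD)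
  have hx : 0 < z.1 := hz.1
  have hy : 0 < z.2 := hz.2
  gcongr ?_ ^ p * _
  set A : Set ℝ := {s ∈ Ioc 0 z.1 | (s, z.2) ∈ D}
  have hsub : A ×ˢ Ioc 0 z.2 ⊆ D ∩ (Ioc 0 z.1 ×ˢ Ioc 0 z.2) := fun w hw =>
    ⟨hD.2 _ hw.1.2 w hw.1.1.1 le_rfl hw.2.1 hw.2.2, hw.1.1, hw.2⟩
  have hvol := measure_mono (μ := volume) hsub
  rw [Measure.volume_eq_prod, Measure.prod_prod, Real.volume_Ioc, sub_zero] at hvol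
  rw [Measure.volume_eq_prod, ENNReal.ofReal_mul hx.le]
  calc volume A / ENNReal.ofReal z.1
      = volume A * ENNReal.ofReal z.2 / (ENNReal.ofReal z.1 * ENNReal.ofReal z.2) :=
        (ENNReal.mul_div_mul_right _ _ (by simpa using hy) ENNReal.ofReal_ne_top).symm
    _ ≤ _ := by gcongr

lemma SliceBound.weighted {u : ℝ × ℝ → ℝ≥0} (hu : Measurable u) {p : ℝ} (hp : 0 < p) {K : ℝ≥0∞}
    (hS : SliceBound u p K) {h : ℝ × ℝ → ℝ≥0} (hh : Measurable h) (hdec : DecFun2 h) :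
    ∫⁻ z in Ioi (0 : ℝ) ×ˢ Ioi (0 : ℝ),
        (∫⁻ s in Ioc 0 z.1, (h (s, z.2) : ℝ≥0∞) * ENNReal.ofReal (s ^ (p - 1))) /
          ENNReal.ofReal z.1 ^ p * (u z : ℝ≥0∞) ≤
      ENNReal.ofReal (1 / p) * K *
        ∫⁻ z in Ioi (0 : ℝ) ×ˢ Ioi (0 : ℝ), (h z : ℝ≥0∞) * (u z : ℝ≥0∞) := by
  set Q : Set (ℝ × ℝ) := Ioi (0 : ℝ) ×ˢ Ioi (0 : ℝ)
  have hu' : Measurable fun z => (u z : ℝ≥0∞) := hu.coe_nnreal_ennreal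
  have hmeas : ∀ t : ℝ, MeasurableSet {z | t < (h z : ℝ)} := fun t =>
    measurableSet_lt measurable_const hh.coe_nnreal_real
  set k : ℝ × ℝ → ℝ → ℝ≥0∞ := fun z t =>
    (volume {s ∈ Ioc 0 z.1 | t < (h (s, z.2) : ℝ)} / ENNReal.ofReal z.1) ^ p * (u z : ℝ≥0∞)
  have hk : Measurable (Function.uncurry k) := by
    have hset : MeasurableSet {q : ((ℝ × ℝ) × ℝ) × ℝ |
        q.2 ∈ Ioc 0 q.1.1.1 ∧ q.1.2 < (h (q.2, q.1.1.2) : ℝ)} := by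
      refine (measurableSet_mem_Ioc_zero (by fun_prop) (by fun_prop)).inter
        (measurableSet_lt (f := fun q : ((ℝ × ℝ) × ℝ) × ℝ => q.1.2)
          (g := fun q : ((ℝ × ℝ) × ℝ) × ℝ => (h (q.2, q.1.1.2) : ℝ)) (by fun_prop) (by fun_prop))
    have hvol := measurable_measure_prodMk_left (ν := (volume : Measure ℝ)) hset
    exact ((hvol.div (by fun_prop)).pow_const p).mul (hu'.comp measurable_fst)
  have hlayer := lintegral_eq_lintegral_meas_lt
    ((volume.restrict Q).withDensity fun z => (u z : ℝ≥0∞))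
    (f := fun z => (h z : ℝ)) (ae_of_all _ fun s => NNReal.coe_nonneg _)
    hh.coe_nnreal_real.aemeasurable
  rw [lintegral_withDensity_eq_lintegral_mul _ hu' hh.coe_nnreal_real.ennreal_ofReal] at hlayer
  calc _ ≤ ∫⁻ z in Q, ENNReal.ofReal (1 / p) * ∫⁻ t in Ioi (0 : ℝ), k z t := by
        refine setLIntegral_mono' measurableSet_quadrant fun z hz => ?_
        have hx : 0 < z.1 := hz.1
        have hslice : Measurable fun s => h (s, z.2) := hh.comp measurable_prodMk_right
        have hinv : (ENNReal.ofReal z.1 ^ p)⁻¹ ≠ ⊤ := by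
          simpa using (ENNReal.rpow_pos (by simpa using hx) ENNReal.ofReal_ne_top).ne'
        calc _ ≤ ENNReal.ofReal (1 / p) *
              (∫⁻ t in Ioi (0 : ℝ), (volume {s ∈ Ioc 0 z.1 | t < (h (s, z.2) : ℝ)}) ^ p) /
                ENNReal.ofReal z.1 ^ p * (u z : ℝ≥0∞) := by
              gcongr
              exact lintegral_Ioc_mul_rpow_le hslice (hdec.antitoneOn_slice hz.2) hp
          _ = _ := by
              simp only [k, ENNReal.div_rpow_of_nonneg _ _ hp.le]
              rw [mul_div_assoc, mul_assoc, lintegral_mul_const' _ _ ENNReal.coe_ne_top]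
              simp only [div_eq_mul_inv]
              rw [lintegral_mul_const' _ _ hinv]
    _ = ENNReal.ofReal (1 / p) * ∫⁻ t in Ioi (0 : ℝ), ∫⁻ z in Q, k z t := by
        rw [lintegral_const_mul' _ _ ENNReal.ofReal_ne_top,
          lintegral_lintegral_swap hk.aemeasurable]
    _ ≤ ENNReal.ofReal (1 / p) * ∫⁻ t in Ioi (0 : ℝ), K *
          ∫⁻ z in {z | t < (h z : ℝ)} ∩ Q, (u z : ℝ≥0∞) := by
        gcongr with t
        refine le_trans (setLIntegral_mono' measurableSet_quadrant fun z hz => ?_)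
          (hS _ ((hmeas t).inter measurableSet_quadrant) (hdec.decSet2_lt t))
        simp only [k]
        gcongr ?_ ^ p * _
        refine ENNReal.div_le_div_right (measure_mono ?_) _
        exact fun s hs => ⟨hs.1, hs.2, hs.1.1, hz.2⟩
    _ ≤ ENNReal.ofReal (1 / p) * (K * ∫⁻ t in Ioi (0 : ℝ),
          ∫⁻ z in {z | t < (h z : ℝ)} ∩ Q, (u z : ℝ≥0∞)) := by
        gcongr
        refine (lintegral_const_mul _ (Antitone.measurable fun t t' htt' => ?_)).le
        exact lintegral_mono_set (inter_subset_inter_left _ fun z hz => lt_of_le_of_lt htt' hz)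
    _ = _ := by
        rw [mul_assoc]
        congr 2
        calc _ = ∫⁻ t in Ioi (0 : ℝ),
                ((volume.restrict Q).withDensity fun z => (u z : ℝ≥0∞)) {z | t < (h z : ℝ)} := by
              refine lintegral_congr fun t => ?_
              rw [withDensity_apply _ (hmeas t), Measure.restrict_restrict (hmeas t)]
          _ = _ := hlayer.symm
          _ = _ := by simp [mul_comm]

lemma measurable_hardyS1 {f : ℝ × ℝ → ℝ≥0} (hf : Measurable f) : Measurable (hardyS1 f) := by
  have hset : MeasurableSet {q : (ℝ × ℝ) × ℝ | q.2 ∈ Ioc 0 q.1.1} :=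
    measurableSet_mem_Ioc_zero (by fun_prop) (by fun_prop)
  have hint : Measurable ({q : (ℝ × ℝ) × ℝ | q.2 ∈ Ioc 0 q.1.1}.indicator
      fun q => (f (q.2, q.1.2) : ℝ≥0∞)) := Measurable.indicator (by fun_prop) hset
  have h := hint.lintegral_prod_right' (ν := (volume : Measure ℝ))
  refine Measurable.div ?_ (by fun_prop)
  convert h using 2 with z
  rw [← lintegral_indicator measurableSet_Ioc]
  rfl

lemma measurable_hardy2 {f : ℝ × ℝ → ℝ≥0} (hf : Measurable f) : Measurable (hardy2 f) := by
  have hset : MeasurableSet {q : (ℝ × ℝ) × (ℝ × ℝ) | q.2 ∈ Ioc 0 q.1.1 ×ˢ Ioc 0 q.1.2} :=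
    (measurableSet_mem_Ioc_zero (by fun_prop) (by fun_prop)).inter
      (measurableSet_mem_Ioc_zero (by fun_prop) (by fun_prop))
  have hint : Measurable ({q : (ℝ × ℝ) × (ℝ × ℝ) | q.2 ∈ Ioc 0 q.1.1 ×ˢ Ioc 0 q.1.2}.indicator
      fun q => (f q.2 : ℝ≥0∞)) := Measurable.indicator (by fun_prop) hset
  have h := hint.lintegral_prod_right' (ν := (volume : Measure (ℝ × ℝ)))
  refine Measurable.div ?_ (by fun_prop)
  convert h using 2 with z
  rw [← lintegral_indicator (measurableSet_Ioc.prod measurableSet_Ioc)]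
  rfl

lemma hardyS1_le {f : ℝ × ℝ → ℝ≥0} {N : ℝ≥0} (hN : ∀ z, f z ≤ N) (z : ℝ × ℝ) :
    hardyS1 f z ≤ N :=
  ENNReal.div_le_of_le_mul (lintegral_Ioc_le_mul (fun s => hN (s, z.2)) z.1)

lemma DecFun2.hardyS1_le_hardyS1 {f : ℝ × ℝ → ℝ≥0} (hf : DecFun2 f) {x y x' y' : ℝ} (hx' : 0 < x')
    (hx : x' ≤ x) (hy' : 0 < y') (hy : y' ≤ y) : hardyS1 f (x, y) ≤ hardyS1 f (x', y') := by
  have hanti : AntitoneOn (fun s => (f (s, y) : ℝ≥0∞)) (Ioi 0) := fun a ha b hb hab =>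
    ENNReal.coe_le_coe.2 (hf.antitoneOn_slice (hy'.trans_le hy) ha hb hab)
  refine (antitoneOn_lintegral_Ioc_div hanti hx' (hx'.trans_le hx) hx).trans ?_
  refine ENNReal.div_le_div_right (setLIntegral_mono' measurableSet_Ioc fun s hs => ?_) _
  exact ENNReal.coe_le_coe.2 (hf _ _ _ _ hs.1 le_rfl hy' hy)

lemma DecFun2.toNNReal_hardyS1 {f : ℝ × ℝ → ℝ≥0} (hf : DecFun2 f) {N : ℝ≥0} (hN : ∀ z, f z ≤ N) :
    DecFun2 fun z => (hardyS1 f z).toNNReal := fun _ _ _ _ hx' hx hy' hy =>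
  ENNReal.toNNReal_mono (ne_top_of_le_ne_top ENNReal.coe_ne_top (hardyS1_le hN _))
    (hf.hardyS1_le_hardyS1 hx' hx hy' hy)

lemma mul_rpow_sub_one_le {p : ℝ} (hp : 1 ≤ p) {A a g : ℝ≥0∞} (hg : g ≠ ⊤) :
    A * (a * g ^ (p - 1)) ≤ g ^ p / 2 + A * (2 * A) ^ (p - 1) * a ^ p := by
  have hmul : ∀ b : ℝ≥0∞, b ≠ ⊤ → b * b ^ (p - 1) ≤ b ^ p := fun b hb => by
    rcases eq_or_ne b 0 with h0 | h0
    · simp [h0]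
    · conv_lhs => rw [← ENNReal.rpow_one b, ← ENNReal.rpow_mul, one_mul,
        ← ENNReal.rpow_add _ _ h0 hb]
      simp
  rcases le_total (2 * (A * a)) g with hle | hle
  · refine le_trans ?_ le_self_add
    rw [ENNReal.le_div_iff_mul_le (by simp) (by simp)]
    calc A * (a * g ^ (p - 1)) * 2 = 2 * (A * a) * g ^ (p - 1) := by ring
      _ ≤ g * g ^ (p - 1) := by gcongr
      _ ≤ g ^ p := hmul g hg
  · refine le_trans ?_ le_add_self
    rcases eq_or_ne a ⊤ with ha | ha
    · subst ha
      rcases eq_or_ne A 0 with h0 | h0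
      · simp [h0]
      · rw [ENNReal.top_rpow_of_pos (by linarith), ENNReal.mul_top]
        · exact le_top
        · refine mul_ne_zero h0 ?_
          intro h
          rcases ENNReal.rpow_eq_zero_iff.1 h with h | h
          · simp [h0] at h
          · linarith [h.2]
    · calc A * (a * g ^ (p - 1)) ≤ A * (a * (2 * (A * a)) ^ (p - 1)) := by gcongr
        _ = A * (2 * A) ^ (p - 1) * (a * a ^ (p - 1)) := by
            rw [← mul_assoc 2 A a, ENNReal.mul_rpow_of_nonneg _ _ (by linarith : 0 ≤ p - 1)]
            ring
        _ ≤ _ := by gcongr; exact hmul a ha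

lemma hardyS1_rpow_eq (f : ℝ × ℝ → ℝ≥0) (z : ℝ × ℝ) {p : ℝ} (hp : 0 ≤ p) :
    hardyS1 f z ^ p = (∫⁻ s in Ioc 0 z.1, (f (s, z.2) : ℝ≥0∞)) ^ p / ENNReal.ofReal z.1 ^ p :=
  ENNReal.div_rpow_of_nonneg _ _ hp

lemma SliceBound.hardyS1_le_of_le_one {u : ℝ × ℝ → ℝ≥0} (hu : Measurable u) {p : ℝ} (hp0 : 0 < p)
    (hp : p ≤ 1) {K : ℝ≥0∞} (hS : SliceBound u p K) {f : ℝ × ℝ → ℝ≥0} (hf : Measurable f)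
    (hdec : DecFun2 f) {N : ℝ≥0} (hN : ∀ z, f z ≤ N) :
    ∫⁻ z in Ioi (0 : ℝ) ×ˢ Ioi (0 : ℝ), hardyS1 f z ^ p * (u z : ℝ≥0∞) ≤
      ENNReal.ofReal (1 / p) * K *
        ∫⁻ z in Ioi (0 : ℝ) ×ˢ Ioi (0 : ℝ), (f z : ℝ≥0∞) ^ p * (u z : ℝ≥0∞) := by
  have hpow := hS.weighted hu hp0 (h := fun z => f z ^ p) (hf.pow_const p)
    fun x y x' y' hx' hx hy' hy => NNReal.rpow_le_rpow (hdec x y x' y' hx' hx hy' hy) hp0.le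
  simp only [ENNReal.coe_rpow_of_nonneg _ hp0.le] at hpow
  refine le_trans (setLIntegral_mono' measurableSet_quadrant fun z hz => ?_) hpow
  rw [hardyS1_rpow_eq f z hp0.le]
  gcongr
  exact lintegral_Ioc_rpow_le_of_le_one (hf.comp measurable_prodMk_right) (fun s => hN _)
    (hdec.antitoneOn_slice hz.2) hp0 hp

lemma SliceBound.lintegral_hardyS1_lt_top {u : ℝ × ℝ → ℝ≥0} (hu : Measurable u) {p : ℝ}
    (hp : 0 < p) {K : ℝ≥0∞} (hK : K ≠ ⊤) (hS : SliceBound u p K) {f : ℝ × ℝ → ℝ≥0}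
    (hf : Measurable f) (hdec : DecFun2 f) {N ε : ℝ≥0} (hN : ∀ z, f z ≤ N) (hε : 0 < ε)
    (hfε : ∀ z, f z = 0 ∨ ε ≤ f z)
    (hfin : ∫⁻ z in Ioi (0 : ℝ) ×ˢ Ioi (0 : ℝ), (f z : ℝ≥0∞) ^ p * (u z : ℝ≥0∞) ≠ ⊤) :
    ∫⁻ z in Ioi (0 : ℝ) ×ˢ Ioi (0 : ℝ), hardyS1 f z ^ p * (u z : ℝ≥0∞) ≠ ⊤ := by
  set Q : Set (ℝ × ℝ) := Ioi (0 : ℝ) ×ˢ Ioi (0 : ℝ)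
  set D : Set (ℝ × ℝ) := {z | (0 : ℝ) < (f z : ℝ)} ∩ Q
  have hDm : MeasurableSet D :=
    (measurableSet_lt measurable_const hf.coe_nnreal_real).inter measurableSet_quadrant
  have hεp : (ε : ℝ≥0∞) ^ p ≠ 0 := (ENNReal.rpow_pos (by exact_mod_cast hε) ENNReal.coe_ne_top).ne'
  have hD : ∫⁻ z in D, (u z : ℝ≥0∞) ≠ ⊤ := by
    have hle : (ε : ℝ≥0∞) ^ p * ∫⁻ z in D, (u z : ℝ≥0∞) ≤
        ∫⁻ z in Q, (f z : ℝ≥0∞) ^ p * (u z : ℝ≥0∞) := by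
      rw [← lintegral_const_mul _ hu.coe_nnreal_ennreal]
      refine (setLIntegral_mono' hDm fun z hz => ?_).trans
        (lintegral_mono_set inter_subset_right)
      gcongr
      exact (hfε z).resolve_left fun h => by simpa [h] using hz.1
    intro h
    rw [h, ENNReal.mul_top hεp] at hle
    exact hfin (top_le_iff.1 hle)
  refine ne_top_of_le_ne_top (b := (N : ℝ≥0∞) ^ p * (K * ∫⁻ z in D, (u z : ℝ≥0∞))) ?_ ?_
  · exact ENNReal.mul_ne_top (ENNReal.rpow_ne_top_of_nonneg hp.le ENNReal.coe_ne_top)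
      (ENNReal.mul_ne_top hK hD)
  · calc _ ≤ ∫⁻ z in Q, (N : ℝ≥0∞) ^ p *
          ((volume {s ∈ Ioc 0 z.1 | (s, z.2) ∈ D} / ENNReal.ofReal z.1) ^ p * (u z : ℝ≥0∞)) := by
          refine setLIntegral_mono' measurableSet_quadrant fun z hz => ?_
          rw [← mul_assoc, ← ENNReal.mul_rpow_of_nonneg _ _ hp.le, ← mul_div_assoc]
          gcongr
          refine ENNReal.div_le_div_right ?_ _
          have hsec : MeasurableSet {s : ℝ | (s, z.2) ∈ D} := measurable_prodMk_right hDm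
          calc ∫⁻ s in Ioc 0 z.1, (f (s, z.2) : ℝ≥0∞)
              ≤ ∫⁻ s in Ioc 0 z.1, {s : ℝ | (s, z.2) ∈ D}.indicator (fun _ => (N : ℝ≥0∞)) s := by
                refine setLIntegral_mono' measurableSet_Ioc fun s hs => ?_
                by_cases h : f (s, z.2) = 0
                · simp [h]
                · have hmem : s ∈ {s : ℝ | (s, z.2) ∈ D} :=
                    ⟨NNReal.coe_pos.2 (pos_iff_ne_zero.2 h), hs.1, hz.2⟩
                  rw [indicator_of_mem hmem]
                  exact ENNReal.coe_le_coe.2 (hN _)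
            _ = _ := by
                rw [lintegral_indicator_const hsec, Measure.restrict_apply hsec, inter_comm]
                rfl
      _ ≤ _ := by
          rw [lintegral_const_mul' _ _ (ENNReal.rpow_ne_top_of_nonneg hp.le ENNReal.coe_ne_top)]
          gcongr
          exact hS D hDm (hdec.decSet2_lt 0)

lemma SliceBound.hardyS1_le_of_one_le {u : ℝ × ℝ → ℝ≥0} (hu : Measurable u) {p : ℝ} (hp : 1 ≤ p)
    {K : ℝ≥0∞} (hS : SliceBound u p K) {f : ℝ × ℝ → ℝ≥0} (hf : Measurable f)
    (hdec : DecFun2 f) {N : ℝ≥0} (hN : ∀ z, f z ≤ N)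
    (hfin : ∫⁻ z in Ioi (0 : ℝ) ×ˢ Ioi (0 : ℝ), hardyS1 f z ^ p * (u z : ℝ≥0∞) ≠ ⊤)
    {A : ℝ≥0∞} (hA : A = 2 ^ p * (ENNReal.ofReal (1 / p) * K)) :
    ∫⁻ z in Ioi (0 : ℝ) ×ˢ Ioi (0 : ℝ), hardyS1 f z ^ p * (u z : ℝ≥0∞) ≤
      2 * (A * (2 * A) ^ (p - 1)) *
        ∫⁻ z in Ioi (0 : ℝ) ×ˢ Ioi (0 : ℝ), (f z : ℝ≥0∞) ^ p * (u z : ℝ≥0∞) := by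
  have hp0 : 0 < p := by linarith
  have hp1 : 0 ≤ p - 1 := by linarith
  have hu' : Measurable fun z => (u z : ℝ≥0∞) := hu.coe_nnreal_ennreal
  have hS1 := measurable_hardyS1 hf
  have hne : ∀ z, hardyS1 f z ≠ ⊤ := fun z =>
    ne_top_of_le_ne_top ENNReal.coe_ne_top (hardyS1_le hN z)
  set Q : Set (ℝ × ℝ) := Ioi (0 : ℝ) ×ˢ Ioi (0 : ℝ)
  set I := ∫⁻ z in Q, hardyS1 f z ^ p * (u z : ℝ≥0∞)
  set J := ∫⁻ z in Q, (f z : ℝ≥0∞) ^ p * (u z : ℝ≥0∞)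
  have hweight := hS.weighted hu hp0 (h := fun z => f z * (hardyS1 f z).toNNReal ^ (p - 1))
    (hf.mul (hS1.ennreal_toNNReal.pow_const _))
    fun x y x' y' hx' hx hy' hy => mul_le_mul' (hdec x y x' y' hx' hx hy' hy)
      (NNReal.rpow_le_rpow (hdec.toNNReal_hardyS1 hN x y x' y' hx' hx hy' hy) hp1)
  simp only [ENNReal.coe_mul, ENNReal.coe_rpow_of_nonneg _ hp1, ENNReal.coe_toNNReal (hne _)]
    at hweight
  have hmain : I ≤ I / 2 + A * (2 * A) ^ (p - 1) * J := by
    calc I ≤ ∫⁻ z in Q, 2 ^ p *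
          ((∫⁻ s in Ioc 0 z.1, (f (s, z.2) : ℝ≥0∞) * hardyS1 f (s, z.2) ^ (p - 1) *
            ENNReal.ofReal (s ^ (p - 1))) / ENNReal.ofReal z.1 ^ p * (u z : ℝ≥0∞)) := by
          refine setLIntegral_mono' measurableSet_quadrant fun z hz => ?_
          rw [hardyS1_rpow_eq f z hp0.le, ← mul_assoc, ← mul_div_assoc]
          gcongr
          refine (lintegral_Ioc_rpow_le_of_one_le (hf.comp measurable_prodMk_right)
            (fun s => hN (s, z.2)) hp hz.1).trans_eq ?_
          congr 1
          refine setLIntegral_congr_fun measurableSet_Ioc fun s hs => ?_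
          have hs0 : 0 < s := hs.1
          have hs' : ENNReal.ofReal s ≠ 0 := by simpa using hs0
          simp only [Function.comp_apply]
          rw [mul_assoc, ← ENNReal.ofReal_rpow_of_pos hs0, ← ENNReal.mul_rpow_of_nonneg _ _ hp1]
          congr 2
          exact (ENNReal.div_mul_cancel hs' ENNReal.ofReal_ne_top).symm
      _ ≤ 2 ^ p * (ENNReal.ofReal (1 / p) * K *
            ∫⁻ z in Q, (f z : ℝ≥0∞) * hardyS1 f z ^ (p - 1) * (u z : ℝ≥0∞)) := by
          rw [lintegral_const_mul' _ _ (ENNReal.rpow_ne_top_of_nonneg hp0.le ENNReal.ofNat_ne_top)]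
          gcongr
      _ = ∫⁻ z in Q, A * ((f z : ℝ≥0∞) * hardyS1 f z ^ (p - 1)) * (u z : ℝ≥0∞) := by
          rw [← mul_assoc, ← hA, ← lintegral_const_mul _ (by fun_prop)]
          simp only [mul_assoc]
      _ ≤ ∫⁻ z in Q, (hardyS1 f z ^ p * (u z : ℝ≥0∞) / 2 +
            A * (2 * A) ^ (p - 1) * ((f z : ℝ≥0∞) ^ p * (u z : ℝ≥0∞))) := by
          refine lintegral_mono fun z => ?_
          calc _ ≤ (hardyS1 f z ^ p / 2 + A * (2 * A) ^ (p - 1) * (f z : ℝ≥0∞) ^ p) * u z := by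
                gcongr; exact mul_rpow_sub_one_le hp (hne z)
            _ = _ := by simp only [div_eq_mul_inv]; ring
      _ = _ := by
          simp only [div_eq_mul_inv]
          rw [lintegral_add_left (by fun_prop), lintegral_mul_const _ (by fun_prop),
            lintegral_const_mul _ (by fun_prop)]
  have hhalf : I / 2 ≤ A * (2 * A) ^ (p - 1) * J := by
    have h : I / 2 + I / 2 ≤ I / 2 + A * (2 * A) ^ (p - 1) * J := by
      rwa [ENNReal.add_halves]
    exact (ENNReal.add_le_add_iff_left (ENNReal.div_ne_top hfin two_ne_zero)).1 h
  calc I = 2 * (I / 2) := (ENNReal.mul_div_cancel two_ne_zero ENNReal.ofNat_ne_top).symm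
    _ ≤ 2 * (A * (2 * A) ^ (p - 1) * J) := by gcongr
    _ = _ := by ring

/-- Truncation of `f` from above at height `n` and from below at height `1 / (n + 1)`. -/
noncomputable def levelTrunc (f : ℝ × ℝ → ℝ≥0) (n : ℕ) (z : ℝ × ℝ) : ℝ≥0 :=
  if 1 / ((n : ℝ≥0) + 1) < f z then min (f z) (n + 1) else 0

lemma levelTrunc_le (f : ℝ × ℝ → ℝ≥0) (n : ℕ) (z : ℝ × ℝ) : levelTrunc f n z ≤ f z := by
  unfold levelTrunc; split_ifs <;> simp

lemma levelTrunc_le_natCast (f : ℝ × ℝ → ℝ≥0) (n : ℕ) (z : ℝ × ℝ) :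
    levelTrunc f n z ≤ (n + 1 : ℝ≥0) := by
  unfold levelTrunc; split_ifs <;> simp

lemma levelTrunc_eq_zero_or_le (f : ℝ × ℝ → ℝ≥0) (n : ℕ) (z : ℝ × ℝ) :
    levelTrunc f n z = 0 ∨ 1 / ((n : ℝ≥0) + 1) ≤ levelTrunc f n z := by
  unfold levelTrunc
  split_ifs with h
  · refine Or.inr (le_min h.le ?_)
    exact (div_le_self zero_le_one (by simp)).trans (by simp)
  · exact Or.inl rfl

lemma measurable_levelTrunc {f : ℝ × ℝ → ℝ≥0} (hf : Measurable f) (n : ℕ) :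
    Measurable (levelTrunc f n) :=
  Measurable.ite (measurableSet_lt measurable_const hf) (hf.min measurable_const) measurable_const

lemma DecFun2.levelTrunc {f : ℝ × ℝ → ℝ≥0} (hf : DecFun2 f) (n : ℕ) :
    DecFun2 (levelTrunc f n) := by
  intro x y x' y' hx' hx hy' hy
  have h := hf x y x' y' hx' hx hy' hy
  unfold _root_.levelTrunc
  split_ifs with h1 h2
  · exact min_le_min_right _ h
  · exact absurd (h1.trans_le h) h2
  · exact zero_le
  · exact le_rfl

lemma monotone_levelTrunc (f : ℝ × ℝ → ℝ≥0) (z : ℝ × ℝ) : Monotone fun n => levelTrunc f n z := by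
  intro m n hmn
  have hmn' : (m : ℝ≥0) ≤ n := by exact_mod_cast hmn
  unfold levelTrunc
  simp only
  split_ifs with h1 h2
  · exact min_le_min_left _ (by gcongr)
  · refine absurd (lt_of_le_of_lt ?_ h1) h2
    gcongr
  · exact zero_le
  · exact le_rfl

lemma tendsto_levelTrunc (f : ℝ × ℝ → ℝ≥0) (z : ℝ × ℝ) :
    Filter.Tendsto (fun n => (levelTrunc f n z : ℝ≥0∞)) Filter.atTop (nhds (f z)) := by
  rw [ENNReal.tendsto_coe]
  rcases eq_or_ne (f z) 0 with h0 | h0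
  · have : ∀ n, levelTrunc f n z = 0 := fun n =>
      le_antisymm ((levelTrunc_le f n z).trans h0.le) zero_le
    simp [this, h0]
  · obtain ⟨n₁, hn₁⟩ := exists_nat_one_div_lt (K := ℝ≥0) (pos_iff_ne_zero.2 h0)
    obtain ⟨n₂, hn₂⟩ := exists_nat_ge (f z)
    refine tendsto_const_nhds.congr' ?_
    filter_upwards [Filter.eventually_ge_atTop n₁, Filter.eventually_ge_atTop n₂] with n h1 h2
    have h1' : (n₁ : ℝ≥0) ≤ n := by exact_mod_cast h1
    have h2' : (n₂ : ℝ≥0) ≤ n := by exact_mod_cast h2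
    unfold levelTrunc
    rw [if_pos (lt_of_le_of_lt (by gcongr) hn₁),
      min_eq_left (hn₂.trans (h2'.trans (by simp)))]

lemma tendsto_lintegral_levelTrunc {α : Type*} [MeasurableSpace α] {μ : Measure α}
    {f : ℝ × ℝ → ℝ≥0} (hf : Measurable f) {g : α → ℝ × ℝ} (hg : Measurable g) (c : ℝ≥0∞)
    (hc : c ≠ 0) :
    Filter.Tendsto (fun n => (∫⁻ a, (levelTrunc f n (g a) : ℝ≥0∞) ∂μ) / c) Filter.atTop
      (nhds ((∫⁻ a, (f (g a) : ℝ≥0∞) ∂μ) / c)) := by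
  refine ENNReal.Tendsto.div_const ?_ (Or.inr hc)
  refine lintegral_tendsto_of_tendsto_of_monotone
    (fun n => ((measurable_levelTrunc hf n).comp hg).coe_nnreal_ennreal.aemeasurable)
    (ae_of_all _ fun a m n hmn => ENNReal.coe_le_coe.2 (monotone_levelTrunc f (g a) hmn))
    (ae_of_all _ fun a => tendsto_levelTrunc f (g a))

/-- It suffices to bound an operator on truncations when it is continuous along them. -/
lemma decBound_of_levelTrunc {T : (ℝ × ℝ → ℝ≥0) → ℝ × ℝ → ℝ≥0∞}
    (hTm : ∀ f, Measurable f → Measurable (T f))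
    (hT : ∀ f, Measurable f → ∀ z ∈ Ioi (0 : ℝ) ×ˢ Ioi (0 : ℝ),
      Filter.Tendsto (fun n => T (levelTrunc f n) z) Filter.atTop (nhds (T f z)))
    {u : ℝ × ℝ → ℝ≥0} (hu : Measurable u) {p : ℝ} (hp : 0 < p) {K : ℝ≥0∞}
    (h : ∀ f n, Measurable f → DecFun2 f →
      ∫⁻ z in Ioi (0 : ℝ) ×ˢ Ioi (0 : ℝ), T (levelTrunc f n) z ^ p * (u z : ℝ≥0∞) ≤
        K * ∫⁻ z in Ioi (0 : ℝ) ×ˢ Ioi (0 : ℝ), (levelTrunc f n z : ℝ≥0∞) ^ p * (u z : ℝ≥0∞)) :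
    DecBound T u p K := by
  intro f hf hdec
  calc ∫⁻ z in Ioi (0 : ℝ) ×ˢ Ioi (0 : ℝ), T f z ^ p * (u z : ℝ≥0∞)
      = ∫⁻ z in Ioi (0 : ℝ) ×ˢ Ioi (0 : ℝ),
          Filter.liminf (fun n => T (levelTrunc f n) z ^ p * (u z : ℝ≥0∞)) Filter.atTop := by
        refine setLIntegral_congr_fun measurableSet_quadrant fun z hz => ?_
        exact (ENNReal.Tendsto.mul_const ((ENNReal.continuous_rpow_const.tendsto _).comp
          (hT f hf z hz)) (Or.inr ENNReal.coe_ne_top)).liminf_eq.symm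
    _ ≤ Filter.liminf (fun n => ∫⁻ z in Ioi (0 : ℝ) ×ˢ Ioi (0 : ℝ),
          T (levelTrunc f n) z ^ p * (u z : ℝ≥0∞)) Filter.atTop :=
        lintegral_liminf_le fun n => ((hTm _ (measurable_levelTrunc hf n)).pow_const p).mul
          hu.coe_nnreal_ennreal
    _ ≤ K * ∫⁻ z in Ioi (0 : ℝ) ×ˢ Ioi (0 : ℝ), (f z : ℝ≥0∞) ^ p * (u z : ℝ≥0∞) := by
        refine Filter.liminf_le_of_le (by isBoundedDefault) fun b hb => ?_
        obtain ⟨n, hn⟩ := hb.exists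
        refine hn.trans ((h f n hf hdec).trans ?_)
        gcongr with z
        exact levelTrunc_le f n z

lemma SliceBound.exists_decBound_hardyS1 {u : ℝ × ℝ → ℝ≥0} (hu : Measurable u) {p : ℝ} (hp : 0 < p)
    {K : ℝ≥0∞} (hK : K ≠ ⊤) (hS : SliceBound u p K) :
    ∃ K' : ℝ≥0∞, K' ≠ ⊤ ∧ DecBound hardyS1 u p K' := by
  have hT : ∀ f, Measurable f → ∀ z ∈ Ioi (0 : ℝ) ×ˢ Ioi (0 : ℝ),
      Filter.Tendsto (fun n => hardyS1 (levelTrunc f n) z) Filter.atTop (nhds (hardyS1 f z)) :=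
    fun f hf z hz => tendsto_lintegral_levelTrunc hf measurable_prodMk_right _
      (by simpa using hz.1)
  have hK₁ : ENNReal.ofReal (1 / p) * K ≠ ⊤ := ENNReal.mul_ne_top ENNReal.ofReal_ne_top hK
  rcases le_total p 1 with hp1 | hp1
  · exact ⟨_, hK₁, decBound_of_levelTrunc (fun f => measurable_hardyS1) hT hu hp
      fun f n hf hdec => hS.hardyS1_le_of_le_one hu hp hp1 (measurable_levelTrunc hf n)
        (hdec.levelTrunc n) (levelTrunc_le_natCast f n)⟩
  · set A : ℝ≥0∞ := 2 ^ p * (ENNReal.ofReal (1 / p) * K) with hA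
    have hAtop : A ≠ ⊤ :=
      ENNReal.mul_ne_top (ENNReal.rpow_ne_top_of_nonneg hp.le ENNReal.ofNat_ne_top) hK₁
    refine ⟨2 * (A * (2 * A) ^ (p - 1)) + 1, ?_, decBound_of_levelTrunc
      (fun f => measurable_hardyS1) hT hu hp fun f n hf hdec => ?_⟩
    · refine ENNReal.add_ne_top.2 ⟨ENNReal.mul_ne_top ENNReal.ofNat_ne_top
        (ENNReal.mul_ne_top hAtop (ENNReal.rpow_ne_top_of_nonneg (by linarith)
          (ENNReal.mul_ne_top ENNReal.ofNat_ne_top hAtop))), ENNReal.one_ne_top⟩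
    · by_cases hfin : ∫⁻ z in Ioi (0 : ℝ) ×ˢ Ioi (0 : ℝ),
          (levelTrunc f n z : ℝ≥0∞) ^ p * (u z : ℝ≥0∞) = ⊤
      · rw [hfin, ENNReal.mul_top (by simp)]
        exact le_top
      · have hfm := measurable_levelTrunc hf n
        have hfin' := hS.lintegral_hardyS1_lt_top hu hp hK hfm (hdec.levelTrunc n)
          (levelTrunc_le_natCast f n) (by positivity) (levelTrunc_eq_zero_or_le f n) hfin
        refine (hS.hardyS1_le_of_one_le hu hp1 hfm (hdec.levelTrunc n)
          (levelTrunc_le_natCast f n) hfin' hA).trans ?_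
        gcongr
        exact le_self_add

lemma setLIntegral_swap (s : Set (ℝ × ℝ)) (g : ℝ × ℝ → ℝ≥0∞) :
    ∫⁻ z in Prod.swap ⁻¹' s, g z.swap = ∫⁻ z in s, g z :=
  (Measure.measurePreserving_swap (μ := (volume : Measure ℝ)) (ν := (volume : Measure ℝ))
    ).setLIntegral_comp_preimage_emb MeasurableEquiv.prodComm.measurableEmbedding g s

lemma setLIntegral_quadrant_swap (g : ℝ × ℝ → ℝ≥0∞) :
    ∫⁻ z in Ioi (0 : ℝ) ×ˢ Ioi (0 : ℝ), g z.swap = ∫⁻ z in Ioi (0 : ℝ) ×ˢ Ioi (0 : ℝ), g z := by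
  rw [← setLIntegral_swap _ g, preimage_swap_prod]

lemma volume_preimage_swap (s : Set (ℝ × ℝ)) : volume (Prod.swap ⁻¹' s) = volume s :=
  (Measure.measurePreserving_swap (μ := (volume : Measure ℝ)) (ν := (volume : Measure ℝ))
    ).measure_preimage_equiv (f := MeasurableEquiv.prodComm) s

lemma DecSet2.preimage_swap {D : Set (ℝ × ℝ)} (hD : DecSet2 D) : DecSet2 (Prod.swap ⁻¹' D) :=
  ⟨fun _ hz => ⟨(hD.1 hz).2, (hD.1 hz).1⟩,
    fun z hz w h1 h2 h3 h4 => hD.2 z.swap hz w.swap h3 h4 h1 h2⟩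

lemma DecFun2.comp_swap {f : ℝ × ℝ → ℝ≥0} (hf : DecFun2 f) : DecFun2 fun z => f z.swap :=
  fun _ _ _ _ hx' hx hy' hy => hf _ _ _ _ hy' hy hx' hx

lemma BoxBound.comp_swap {u : ℝ × ℝ → ℝ≥0} {p : ℝ} {K : ℝ≥0∞} (h : BoxBound u p K) :
    BoxBound (fun z => u z.swap) p K := by
  intro D hDm hD
  have hbound := h _ (measurable_swap hDm) hD.preimage_swap
  rw [← setLIntegral_swap D, ← setLIntegral_quadrant_swap]
  simp only [Prod.swap_swap]
  refine le_trans (le_of_eq ?_) hbound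
  refine lintegral_congr fun z => ?_
  rw [← volume_preimage_swap, preimage_inter, preimage_swap_prod, Prod.fst_swap, Prod.snd_swap,
    mul_comm z.2]

lemma DecBound.hardyS2_of_swap {u : ℝ × ℝ → ℝ≥0} {p : ℝ} {K : ℝ≥0∞}
    (h : DecBound hardyS1 (fun z => u z.swap) p K) : DecBound hardyS2 u p K := by
  intro f hf hdec
  have hbound := h _ (hf.comp measurable_swap) hdec.comp_swap
  rw [← setLIntegral_quadrant_swap, ← setLIntegral_quadrant_swap fun z => (f z : ℝ≥0∞) ^ p * u z]
  exact hbound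

lemma hardy2_eq_hardyS1 {f g : ℝ × ℝ → ℝ≥0} (hf : Measurable f)
    (hg : ∀ z, (g z : ℝ≥0∞) = hardyS2 f z) {z : ℝ × ℝ} (hz : z ∈ Ioi (0 : ℝ) ×ˢ Ioi (0 : ℝ)) :
    hardy2 f z = hardyS1 g z := by
  have hx : 0 < z.1 := hz.1
  have hy : ENNReal.ofReal z.2 ≠ 0 := by simpa using hz.2
  unfold hardy2 hardyS1
  simp only [hg, hardyS2]
  rw [Measure.volume_eq_prod, ← Measure.prod_restrict,
    lintegral_prod _ hf.coe_nnreal_ennreal.aemeasurable, ENNReal.ofReal_mul hx.le]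
  simp only [div_eq_mul_inv]
  rw [lintegral_mul_const' _ _ (ENNReal.inv_ne_top.2 hy),
    ENNReal.mul_inv (Or.inr ENNReal.ofReal_ne_top) (Or.inr hy)]
  ring

lemma DecBound.hardy2_of_partial {u : ℝ × ℝ → ℝ≥0} (hu : Measurable u) {p : ℝ} (hp : 0 < p)
    {K₁ K₂ : ℝ≥0∞} (h₁ : DecBound hardyS1 u p K₁) (h₂ : DecBound hardyS2 u p K₂) :
    DecBound hardy2 u p (K₁ * K₂) := by
  refine decBound_of_levelTrunc (fun f => measurable_hardy2)
    (fun f hf z hz => tendsto_lintegral_levelTrunc hf measurable_id _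
      (by simpa using mul_pos hz.1 hz.2)) hu hp fun f n hf hdec => ?_
  have hfm := measurable_levelTrunc hf n
  have hsm : Measurable fun z : ℝ × ℝ => levelTrunc f n z.swap := hfm.comp measurable_swap
  have hsN : ∀ z : ℝ × ℝ, levelTrunc f n z.swap ≤ (n + 1 : ℝ≥0) := fun z =>
    levelTrunc_le_natCast f n _
  set g : ℝ × ℝ → ℝ≥0 := fun z => (hardyS2 (levelTrunc f n) z).toNNReal
  have hg : ∀ z, (g z : ℝ≥0∞) = hardyS2 (levelTrunc f n) z := fun z =>
    ENNReal.coe_toNNReal (ne_top_of_le_ne_top ENNReal.coe_ne_top (hardyS1_le hsN z.swap))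
  have hgm : Measurable g := (measurable_hardyS1 hsm).ennreal_toNNReal.comp measurable_swap
  have hgdec : DecFun2 g := ((hdec.levelTrunc n).comp_swap.toNNReal_hardyS1 hsN).comp_swap
  calc _ = ∫⁻ z in Ioi (0 : ℝ) ×ˢ Ioi (0 : ℝ), hardyS1 g z ^ p * (u z : ℝ≥0∞) :=
        setLIntegral_congr_fun measurableSet_quadrant fun z hz => by
          simp only [hardy2_eq_hardyS1 hfm hg hz]
    _ ≤ K₁ * ∫⁻ z in Ioi (0 : ℝ) ×ˢ Ioi (0 : ℝ),
          hardyS2 (levelTrunc f n) z ^ p * (u z : ℝ≥0∞) := by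
        simpa only [hg] using h₁ g hgm hgdec
    _ ≤ _ := by
        rw [mul_assoc]
        gcongr
        exact h₂ _ hfm (hdec.levelTrunc n)

lemma DecSet2.volume_frontier {D : Set (ℝ × ℝ)} (hD : DecSet2 D) : volume (frontier D) = 0 := by
  have hord : OrdConnected ((Homeomorph.finTwoArrow (X := ℝ)) ⁻¹' D) := by
    refine ⟨fun v hv w hw r hr => hD.2 _ hw _ ?_ (hr.2 0) ?_ (hr.2 1)⟩
    · exact lt_of_lt_of_le (hD.1 hv).1 (hr.1 0)
    · exact lt_of_lt_of_le (hD.1 hv).2 (hr.1 1)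
  have hnull := hord.null_frontier
  rw [← Homeomorph.preimage_frontier] at hnull
  rw [← (volume_preserving_finTwoArrow ℝ).measure_preimage_equiv]
  exact hnull

lemma DecSet2.interior {D : Set (ℝ × ℝ)} (hD : DecSet2 D) : DecSet2 (interior D) := by
  refine ⟨interior_subset.trans hD.1, fun z hz w h1 h2 h3 h4 => ?_⟩
  have hshift : Filter.Tendsto (fun v : ℝ × ℝ => v + (z - w)) (nhds w) (nhds z) := by
    have : Continuous fun v : ℝ × ℝ => v + (z - w) := by fun_prop
    simpa using this.tendsto w
  rw [mem_interior_iff_mem_nhds] at hz ⊢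
  filter_upwards [hshift hz, (isOpen_Ioi.prod isOpen_Ioi).mem_nhds (show w ∈ Ioi 0 ×ˢ Ioi 0 from
    ⟨h1, h3⟩)] with v hv hv0
  refine hD.2 _ hv v hv0.1 ?_ hv0.2 ?_ <;> simp [h2, h4]

lemma hardy2_indicator {D : Set (ℝ × ℝ)} (hD : MeasurableSet D) (z : ℝ × ℝ) :
    hardy2 (D.indicator 1) z =
      volume (D ∩ (Ioc 0 z.1 ×ˢ Ioc 0 z.2)) / ENNReal.ofReal (z.1 * z.2) := by
  unfold hardy2
  congr 1
  calc _ = ∫⁻ w in Ioc 0 z.1 ×ˢ Ioc 0 z.2, D.indicator 1 w :=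
        lintegral_congr fun w => by by_cases h : w ∈ D <;> simp [h]
    _ = _ := by rw [lintegral_indicator_one hD, Measure.restrict_apply hD]

lemma DecSet2.decFun2_indicator {D : Set (ℝ × ℝ)} (hD : DecSet2 D) :
    DecFun2 (D.indicator 1) := by
  intro x y x' y' hx' hx hy' hy
  by_cases h : (x, y) ∈ D
  · simp [h, hD.2 _ h (x', y') hx' hx hy' hy]
  · simp [h]

lemma DecBound.boxBound {u : ℝ × ℝ → ℝ≥0} {p : ℝ} (hp : 0 < p) {K : ℝ≥0∞}
    (h : DecBound hardy2 u p K) : BoxBound u p K := by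
  intro D hDm hD
  have hbound := h _ (measurable_one.indicator hDm) hD.decFun2_indicator
  simp only [hardy2_indicator hDm] at hbound
  refine hbound.trans_eq ?_
  congr 1
  calc _ = ∫⁻ z in Ioi (0 : ℝ) ×ˢ Ioi (0 : ℝ), D.indicator (fun z => (u z : ℝ≥0∞)) z :=
        lintegral_congr fun z => by by_cases hz : z ∈ D <;> simp [hz, hp]
    _ = _ := by
        rw [lintegral_indicator hDm, Measure.restrict_restrict hDm, inter_eq_left.2 hD.1]

lemma BoxBound.bp2 {u : ℝ × ℝ → ℝ≥0} {p : ℝ} (hp : 0 < p) {C : ℝ} (hC : 0 < C)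
    (h : BoxBound u p (ENNReal.ofReal C)) : Bp2 u p := by
  refine ⟨C, hC, fun D hD => ?_⟩
  have hnull : volume (D \ interior D) = 0 :=
    measure_mono_null (sdiff_subset_sdiff_left subset_closure) hD.volume_frontier
  calc _ ≤ ∫⁻ z in Ioi (0 : ℝ) ×ˢ Ioi (0 : ℝ),
        (volume (interior D ∩ (Ioc 0 z.1 ×ˢ Ioc 0 z.2)) / ENNReal.ofReal (z.1 * z.2)) ^ p *
          (u z : ℝ≥0∞) := by
        refine (lintegral_mono_set sdiff_subset).trans (lintegral_mono fun z => ?_)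
        gcongr ?_ ^ p * _
        refine ENNReal.div_le_div_right ?_ _
        calc volume (D ∩ (Ioc 0 z.1 ×ˢ Ioc 0 z.2))
            ≤ volume (interior D ∩ (Ioc 0 z.1 ×ˢ Ioc 0 z.2) ∪ D \ interior D) :=
              measure_mono fun w hw => by
                by_cases hi : w ∈ interior D
                · exact Or.inl ⟨hi, hw.2⟩
                · exact Or.inr ⟨hw.1, hi⟩
          _ ≤ _ := (measure_union_le _ _).trans (by rw [hnull, add_zero])
    _ ≤ ENNReal.ofReal C * ∫⁻ z in interior D, (u z : ℝ≥0∞) :=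
        h _ isOpen_interior.measurableSet hD.interior
    _ ≤ _ := by gcongr; exact interior_subset

lemma Bp2.exists_boxBound {u : ℝ × ℝ → ℝ≥0} {p : ℝ} (hp : 0 < p) (h : Bp2 u p) :
    ∃ K : ℝ≥0∞, K ≠ ⊤ ∧ BoxBound u p K := by
  obtain ⟨C, -, hC⟩ := h
  refine ⟨1 + ENNReal.ofReal C, by simp, fun D hDm hD => ?_⟩
  set k : ℝ × ℝ → ℝ≥0∞ := fun z =>
    (volume (D ∩ (Ioc 0 z.1 ×ˢ Ioc 0 z.2)) / ENNReal.ofReal (z.1 * z.2)) ^ p * (u z : ℝ≥0∞)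
  calc ∫⁻ z in Ioi (0 : ℝ) ×ˢ Ioi (0 : ℝ), k z
      = (∫⁻ z in D, k z) + ∫⁻ z in (Ioi (0 : ℝ) ×ˢ Ioi (0 : ℝ)) \ D, k z := by
        rw [← lintegral_inter_add_sdiff k (Ioi (0 : ℝ) ×ˢ Ioi (0 : ℝ)) hDm, inter_eq_right.2 hD.1]
    _ ≤ (∫⁻ z in D, (u z : ℝ≥0∞)) + ENNReal.ofReal C * ∫⁻ z in D, (u z : ℝ≥0∞) := by
        refine add_le_add (setLIntegral_mono' hDm fun z hz => ?_) (hC D hD)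
        refine mul_le_of_le_one_left' (ENNReal.rpow_le_one (ENNReal.div_le_of_le_mul ?_) hp.le)
        rw [one_mul, ENNReal.ofReal_mul (le_of_lt (hD.1 hz).1)]
        refine (measure_mono inter_subset_right).trans_eq ?_
        rw [Measure.volume_eq_prod, Measure.prod_prod, Real.volume_Ioc, Real.volume_Ioc, sub_zero,
          sub_zero]
    _ = _ := by rw [add_mul, one_mul]

lemma exists_real_const_iff_decBound {T : (ℝ × ℝ → ℝ≥0) → ℝ × ℝ → ℝ≥0∞} {u : ℝ × ℝ → ℝ≥0}
    {p : ℝ} : (∃ C : ℝ, 0 < C ∧ DecBound T u p (ENNReal.ofReal C)) ↔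
      ∃ K : ℝ≥0∞, K ≠ ⊤ ∧ DecBound T u p K := by
  constructor
  · rintro ⟨C, -, hC⟩
    exact ⟨_, ENNReal.ofReal_ne_top, hC⟩
  · rintro ⟨K, hK, h⟩
    refine ⟨K.toReal + 1, by positivity, fun f hf hdec => (h f hf hdec).trans ?_⟩
    gcongr
    exact ENNReal.le_ofReal_iff_toReal_le hK (by positivity) |>.2 (by simp)

/-- For `0 < p < ∞` and a weight `u` on `(0,∞)²`, the following are
equivalent: (a) `S : L^p_dec(u) → L^p(u)` is bounded; (b) `u ∈ B_p((0,∞)²)`;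
(c) both `S₁` and `S₂` are bounded on `L^p_dec(u)`. -/
theorem stmt12 (u : ℝ × ℝ → ℝ≥0) (hu : Measurable u)
    (hloc : MeasureTheory.LocallyIntegrableOn (fun z => (u z : ℝ))
      (Set.Ioi 0 ×ˢ Set.Ioi 0))
    (p : ℝ) (hp : 0 < p) :
    ((∃ C : ℝ, 0 < C ∧ ∀ f : ℝ × ℝ → ℝ≥0, Measurable f → DecFun2 f →
        ∫⁻ z in Set.Ioi (0 : ℝ) ×ˢ Set.Ioi (0 : ℝ), hardy2 f z ^ p * (u z : ℝ≥0∞) ≤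
          ENNReal.ofReal C *
            ∫⁻ z in Set.Ioi (0 : ℝ) ×ˢ Set.Ioi (0 : ℝ), (f z : ℝ≥0∞) ^ p * (u z : ℝ≥0∞)) ↔
      Bp2 u p) ∧
    ((∃ C : ℝ, 0 < C ∧ ∀ f : ℝ × ℝ → ℝ≥0, Measurable f → DecFun2 f →
        ∫⁻ z in Set.Ioi (0 : ℝ) ×ˢ Set.Ioi (0 : ℝ), hardy2 f z ^ p * (u z : ℝ≥0∞) ≤
          ENNReal.ofReal C *
            ∫⁻ z in Set.Ioi (0 : ℝ) ×ˢ Set.Ioi (0 : ℝ), (f z : ℝ≥0∞) ^ p * (u z : ℝ≥0∞)) ↔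
      ((∃ C₁ : ℝ, 0 < C₁ ∧ ∀ f : ℝ × ℝ → ℝ≥0, Measurable f → DecFun2 f →
          ∫⁻ z in Set.Ioi (0 : ℝ) ×ˢ Set.Ioi (0 : ℝ), hardyS1 f z ^ p * (u z : ℝ≥0∞) ≤
            ENNReal.ofReal C₁ *
              ∫⁻ z in Set.Ioi (0 : ℝ) ×ˢ Set.Ioi (0 : ℝ),
                (f z : ℝ≥0∞) ^ p * (u z : ℝ≥0∞)) ∧
        (∃ C₂ : ℝ, 0 < C₂ ∧ ∀ f : ℝ × ℝ → ℝ≥0, Measurable f → DecFun2 f →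
          ∫⁻ z in Set.Ioi (0 : ℝ) ×ˢ Set.Ioi (0 : ℝ), hardyS2 f z ^ p * (u z : ℝ≥0∞) ≤
            ENNReal.ofReal C₂ *
              ∫⁻ z in Set.Ioi (0 : ℝ) ×ˢ Set.Ioi (0 : ℝ),
                (f z : ℝ≥0∞) ^ p * (u z : ℝ≥0∞)))) := by
  have hab : (∃ C : ℝ, 0 < C ∧ DecBound hardy2 u p (ENNReal.ofReal C)) → Bp2 u p :=
    fun ⟨_, hC, h⟩ => (h.boxBound hp).bp2 hp hC
  have hbc : Bp2 u p → (∃ C : ℝ, 0 < C ∧ DecBound hardyS1 u p (ENNReal.ofReal C)) ∧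
      ∃ C : ℝ, 0 < C ∧ DecBound hardyS2 u p (ENNReal.ofReal C) := by
    intro h
    obtain ⟨K, hK, hbox⟩ := h.exists_boxBound hp
    obtain ⟨K₁, hK₁, h₁⟩ := (hbox.sliceBound hp).exists_decBound_hardyS1 hu hp hK
    obtain ⟨K₂, hK₂, h₂⟩ := (hbox.comp_swap.sliceBound hp).exists_decBound_hardyS1
      (hu.comp measurable_swap) hp hK
    exact ⟨exists_real_const_iff_decBound.2 ⟨K₁, hK₁, h₁⟩,
      exists_real_const_iff_decBound.2 ⟨K₂, hK₂, h₂.hardyS2_of_swap⟩⟩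
  have hca : ((∃ C : ℝ, 0 < C ∧ DecBound hardyS1 u p (ENNReal.ofReal C)) ∧
      ∃ C : ℝ, 0 < C ∧ DecBound hardyS2 u p (ENNReal.ofReal C)) →
      ∃ C : ℝ, 0 < C ∧ DecBound hardy2 u p (ENNReal.ofReal C) :=
    fun ⟨⟨_, _, h₁⟩, ⟨_, _, h₂⟩⟩ => exists_real_const_iff_decBound.2
      ⟨_, ENNReal.mul_ne_top ENNReal.ofReal_ne_top ENNReal.ofReal_ne_top,
        h₁.hardy2_of_partial hu hp h₂⟩
  exact ⟨⟨hab, fun h => hca (hbc h)⟩, ⟨fun h => hbc (hab h), hca⟩⟩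
end
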